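/- Let f ∈ ℂ[z] be a polynomial of degree d > 1 and let g_f(z) := lim_{n→∞} d^{−n}·log⁺|f^n(z)| (this limit exists locally uniformly on ℂ and is the Green function of the filled-in Julia set of f with pole ∞). If z₀ ∈ ℂ satisfies g_f(z₀) ≥ g_f(c) for every critical point c ∈ ℂ of f, then |f′(z₀)| ≤ d²·e^{(d−1)·g_f(z₀)}; moreover, if some critical point of f in ℂ has unbounded forward orbit under f, then this inequality is strict. -/

import Mathlib

section
namespace DB
open Polynomial

/-! ### Part 1: de Branges weights -/

/-- Fourier coefficients of `U_{n-1}(1 - s + s cos φ)` as polynomials in `s`. -/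
noncomputable def e : ℕ → ℤ → ℝ[X]
  | 0, _ => 0
  | 1, m => if m = 0 then 1 else 0
  | (n+2), m => 2 * (1 - X) * e (n+1) m + X * (e (n+1) (m-1) + e (n+1) (m+1)) - e n m

lemma e_ode (n : ℕ) : ∀ m : ℤ, X * (derivative (e n m) + derivative (e n (m+1)))
    = (m : ℝ[X]) * e n m - ((m : ℝ[X]) + 1) * e n (m+1) := by
  induction n using Nat.strong_induction_on with
  | _ n ih =>
    match n with
    | 0 => intro m; simp [e]
    | 1 =>
      intro m
      simp only [e]
      by_cases h : m = 0
      · subst h; simp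
      · by_cases h' : m + 1 = 0
        · have : (m : ℝ[X]) + 1 = 0 := by exact_mod_cast congrArg (Int.cast : ℤ → ℝ[X]) h'
          rw [if_neg h, if_pos h', this]; simp
        · simp [h, h']
    | (n+2) =>
      intro m
      have h1 := ih (n+1) (by omega) m
      have h2 := ih (n+1) (by omega) (m-1)
      have h3 := ih (n+1) (by omega) (m+1)
      have h4 := ih n (by omega) m
      simp only [e]
      have e1 : m - 1 + 1 = m := by ring
      have e2 : m + 1 - 1 = m := by ring
      rw [e1] at h2
      rw [e2]
      push_cast at h1 h2 h3 h4 ⊢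
      simp only [derivative_sub, derivative_add, derivative_mul, derivative_X, derivative_one, derivative_ofNat]
      linear_combination (2 * (1 - X)) * h1 + X * h2 + X * h3 - h4

lemma e_zero (n : ℕ) : ∀ m : ℤ, (n : ℤ) ≤ |m| → e n m = 0 := by
  induction n using Nat.strong_induction_on with
  | _ n ih =>
    match n with
    | 0 => intro m _; simp [e]
    | 1 => intro m hm; simp only [e]; rw [if_neg]; rintro rfl; simp at hm
    | (n+2) =>
      intro m hm
      simp only [e]
      push_cast at hm
      rw [ih (n+1) (by omega) m (by push_cast; omega), ih n (by omega) m (by omega),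
        ih (n+1) (by omega) (m-1) (by push_cast; grind), ih (n+1) (by omega) (m+1) (by push_cast; grind)]
      simp

lemma e_one (n : ℕ) : ∀ m : ℤ, (e n m).eval 1 = if |m| < n ∧ (n + m) % 2 = 1 then 1 else 0 := by
  induction n using Nat.strong_induction_on with
  | _ n ih =>
    match n with
    | 0 => intro m; simp [e]
    | 1 =>
      intro m; simp only [e]
      by_cases h : m = 0
      · subst h; simp
      · rw [if_neg h, if_neg]
        · simp
        · push_cast; rintro ⟨h1, -⟩; apply h; grind
    | (n+2) =>
      intro m
      simp only [e, eval_sub, eval_add, eval_mul, eval_X, eval_one]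
      rw [ih (n+1) (by omega) m, ih n (by omega) m,
        ih (n+1) (by omega) (m-1), ih (n+1) (by omega) (m+1)]
      push_cast
      have hp : ((n:ℤ) + 1 + (m - 1)) % 2 = ((n:ℤ)+m) % 2 := by omega
      have hq : ((n:ℤ) + 1 + (m + 1)) % 2 = ((n:ℤ)+m) % 2 := by omega
      have hr : ((n:ℤ) + 2 + m) % 2 = ((n:ℤ)+m) % 2 := by omega
      rw [hp, hq, hr]
      rcases Int.emod_two_eq_zero_or_one ((n:ℤ)+m) with h | h
      · simp [h]
      · simp only [h, and_true]
        have c1 : |m - 1| < (n:ℤ) + 1 ↔ (-(n:ℤ) < m ∧ m < n + 2) := by rw [abs_lt]; omega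
        have c2 : |m + 1| < (n:ℤ) + 1 ↔ (-(n:ℤ) - 2 < m ∧ m < n) := by rw [abs_lt]; omega
        have c3 : |m| < (n:ℤ) ↔ (-(n:ℤ) < m ∧ m < n) := by rw [abs_lt]
        have c4 : |m| < (n:ℤ) + 2 ↔ (-(n:ℤ) - 2 < m ∧ m < n + 2) := by rw [abs_lt]; omega
        simp only [c1, c2, c3, c4]
        have := Int.natCast_nonneg n
        split_ifs <;> first | (exfalso; omega) | norm_num

end DB
end

section
namespace DB
open Polynomial

/-- coefficient matrix of the `n`-th symmetric power of `[[a,b],[c,d]]` -/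
noncomputable def M {R : Type*} [CommRing R] (n : ℕ) (a b c d : R) (i j : ℕ) : R :=
  ((C a + C b * X) ^ (n - i) * (C c + C d * X) ^ i).coeff j

noncomputable def tr {R : Type*} [CommRing R] (n : ℕ) (a b c d : R) : R :=
  ∑ i ∈ Finset.range (n+1), M n a b c d i i

noncomputable def ts {R : Type*} [CommRing R] (n : ℕ) (a b c d : R) : R :=
  ∑ i ∈ Finset.range n, ((C a + C b * X) ^ (n - 1 - i) * (C c + C d * X) ^ (i+1)).coeff i

lemma coeff_lin_mul {R : Type*} [CommRing R] (a b : R) (Q : R[X]) (i : ℕ) :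
    ((C a + C b * X) * Q).coeff (i+1) = a * Q.coeff (i+1) + b * Q.coeff i := by
  rw [add_mul, coeff_add, coeff_C_mul, mul_assoc, coeff_C_mul, coeff_X_mul]

lemma coeff_lin_mul_zero {R : Type*} [CommRing R] (a b : R) (Q : R[X]) :
    ((C a + C b * X) * Q).coeff 0 = a * Q.coeff 0 := by
  rw [add_mul, coeff_add, coeff_C_mul, mul_assoc, coeff_C_mul, coeff_X_mul_zero]; ring

lemma coeff_lin_pow {R : Type*} [CommRing R] (c d : R) (n : ℕ) :
    ((C c + C d * X) ^ n).coeff n = d ^ n := by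
  have h : (C c + C d * X).natDegree ≤ 1 := by
    rw [add_comm]; exact natDegree_linear_le
  have := coeff_pow_of_natDegree_le (m := n) h
  simpa using this

lemma tr_succ {R : Type*} [CommRing R] (n : ℕ) (a b c d : R) :
    tr (n+1) a b c d = a * tr n a b c d + b * ts n a b c d + d ^ (n+1) := by
  unfold tr
  rw [Finset.sum_range_succ]
  congr 1
  · rw [Finset.sum_range_succ' _ n, Finset.sum_range_succ' _ n, ts, mul_add, Finset.mul_sum, Finset.mul_sum]
    have h0 : M (n+1) a b c d 0 0 = a * M n a b c d 0 0 := by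
      simp only [M, Nat.sub_zero, pow_zero, mul_one, pow_succ' _ n]
      exact coeff_lin_mul_zero _ _ _
    have h1 : ∀ i ∈ Finset.range n, M (n+1) a b c d (i+1) (i+1) = a * M n a b c d (i+1) (i+1)
        + b * ((C a + C b * X) ^ (n - 1 - i) * (C c + C d * X) ^ (i+1)).coeff i := by
      intro i hi
      have hi := Finset.mem_range.1 hi
      simp only [M]
      have e1 : n + 1 - (i+1) = (n - (i+1)) + 1 := by omega
      have e2 : n - 1 - i = n - (i+1) := by omega
      rw [e1, e2, pow_succ', mul_assoc, coeff_lin_mul]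
    rw [Finset.sum_congr rfl h1, Finset.sum_add_distrib, h0]; ring
  · simp [M, coeff_lin_pow]

lemma ts_succ {R : Type*} [CommRing R] (n : ℕ) (a b c d : R) :
    ts (n+1) a b c d = c * tr n a b c d + d * ts n a b c d := by
  unfold tr
  rw [ts, ts, Finset.sum_range_succ' _ n, Finset.sum_range_succ' _ n, mul_add, Finset.mul_sum, Finset.mul_sum]
  have h0 : ((C a + C b * X) ^ (n + 1 - 1 - 0) * (C c + C d * X) ^ (0+1)).coeff 0 = c * M n a b c d 0 0 := by
    simp only [M]
    rw [show n + 1 - 1 - 0 = n by omega, zero_add, pow_one, mul_comm, coeff_lin_mul_zero]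
    simp
  have h1 : ∀ i ∈ Finset.range n, ((C a + C b * X) ^ (n + 1 - 1 - (i+1)) * (C c + C d * X) ^ (i+1+1)).coeff (i+1) = c * M n a b c d (i+1) (i+1)
        + d * ((C a + C b * X) ^ (n - 1 - i) * (C c + C d * X) ^ (i+1)).coeff i := by
      intro i hi
      have hi := Finset.mem_range.1 hi
      simp only [M]
      have e1 : n + 1 - 1 - (i+1) = n - (i+1) := by omega
      have e2 : n - 1 - i = n - (i+1) := by omega
      rw [e1, e2, pow_succ' _ (i+1), mul_left_comm, coeff_lin_mul]
  rw [Finset.sum_congr rfl h1, Finset.sum_add_distrib, h0]; ring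

lemma tr_rec {R : Type*} [CommRing R] (n : ℕ) (a b c d : R) :
    tr (n+2) a b c d = (a + d) * tr (n+1) a b c d - (a * d - b * c) * tr n a b c d := by
  rw [tr_succ (n+1), ts_succ, tr_succ n]; ring

/-- homogenization -/
noncomputable def hom {R S : Type*} [CommRing R] [CommRing S] [Algebra R S] (n : ℕ) (Q : R[X]) (u v : S) : S :=
  ∑ j ∈ Finset.range (n+1), algebraMap R S (Q.coeff j) * u ^ (n - j) * v ^ j

lemma hom_mul {R S : Type*} [CommRing R] [CommRing S] [Algebra R S] (n : ℕ) (Q : R[X]) (hQ : Q.natDegree ≤ n)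
    (u v : S) (a b : R) :
    hom (n+1) ((C a + C b * X) * Q) u v = (algebraMap R S a * u + algebraMap R S b * v) * hom n Q u v := by
  unfold hom
  have hz : Q.coeff (n+1) = 0 := coeff_eq_zero_of_natDegree_lt (by omega)
  rw [Finset.sum_range_succ' _ (n+1), add_mul (algebraMap R S a * u), Finset.mul_sum, Finset.mul_sum]
  have h1 : ∀ j ∈ Finset.range (n+1), algebraMap R S (((C a + C b * X) * Q).coeff (j+1)) * u ^ (n + 1 - (j+1)) * v ^ (j+1)
     = algebraMap R S a * (algebraMap R S (Q.coeff (j+1)) * u ^ (n + 1 - (j+1)) * v ^ (j+1)) +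
      algebraMap R S b * v * (algebraMap R S (Q.coeff j) * u ^ (n - j) * v ^ j) := by
    intro j hj
    rw [coeff_lin_mul, map_add, map_mul, map_mul, show n + 1 - (j+1) = n - j by omega]; ring
  rw [Finset.sum_congr rfl h1, Finset.sum_add_distrib, coeff_lin_mul_zero, map_mul]
  have h2 : ∑ j ∈ Finset.range (n+1), algebraMap R S a * u * (algebraMap R S (Q.coeff j) * u ^ (n - j) * v ^ j)
     = ∑ j ∈ Finset.range (n+1+1), algebraMap R S a * (algebraMap R S (Q.coeff j) * u ^ (n + 1 - j) * v ^ j) := by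
    rw [Finset.sum_range_succ _ (n+1), hz]
    simp only [map_zero, zero_mul, mul_zero, add_zero]
    refine Finset.sum_congr rfl fun j hj => ?_
    have := Finset.mem_range.1 hj
    rw [show n + 1 - j = (n - j) + 1 by omega, pow_succ]; ring
  rw [h2, Finset.sum_range_succ' _ (n+1)]
  simp only [pow_zero, mul_one, Nat.sub_zero]; ring

lemma natDegree_M {R : Type*} [CommRing R] (p q : ℕ) (a b c d : R) :
    ((C a + C b * X) ^ p * (C c + C d * X) ^ q).natDegree ≤ p + q := by
  have h : ∀ x y : R, (C x + C y * X).natDegree ≤ 1 := fun x y => by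
    rw [add_comm]; exact natDegree_linear_le
  refine natDegree_mul_le.trans (add_le_add ?_ ?_)
  · refine (natDegree_pow_le_of_le p (h a b)).trans (by simp)
  · refine (natDegree_pow_le_of_le q (h c d)).trans (by simp)

lemma hom_pow {R S : Type*} [CommRing R] [CommRing S] [Algebra R S] (p q : ℕ) (u v : S) (a b c d : R) :
    hom (p+q) ((C a + C b * X) ^ p * (C c + C d * X) ^ q) u v =
     (algebraMap R S a * u + algebraMap R S b * v) ^ p * (algebraMap R S c * u + algebraMap R S d * v) ^ q := by
  induction p with
  | zero =>
    induction q with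
    | zero => simp [hom]
    | succ q ih =>
      have h := natDegree_M 0 q a b c d
      simp only [zero_add, pow_zero, one_mul] at *
      rw [pow_succ', hom_mul q _ h, ih, pow_succ' _ q]
  | succ p ih =>
    have h := natDegree_M p q a b c d
    rw [show p + 1 + q = p + q + 1 by ring, pow_succ', mul_assoc, hom_mul _ _ h, ih, pow_succ' _ p, mul_assoc]

lemma hom_M {R S : Type*} [CommRing R] [CommRing S] [Algebra R S] (n i : ℕ) (hi : i ≤ n) (u v : S) (a b c d : R) :
    ∑ j ∈ Finset.range (n+1), algebraMap R S (M n a b c d i j) * u ^ (n - j) * v ^ j =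
     (algebraMap R S a * u + algebraMap R S b * v) ^ (n - i) * (algebraMap R S c * u + algebraMap R S d * v) ^ i := by
  have := hom_pow (n - i) i u v a b c d
  rw [show n - i + i = n by omega] at this
  exact this

lemma M_mul {R : Type*} [CommRing R] (n i k : ℕ) (hi : i ≤ n) (a b c d a' b' c' d' : R) :
    M n (a * a' + b * c') (a * b' + b * d') (c * a' + d * c') (c * b' + d * d') i k =
      ∑ j ∈ Finset.range (n+1), M n a b c d i j * M n a' b' c' d' j k := by
  have h := hom_M (S := R[X]) n i hi (C a' + C b' * X) (C c' + C d' * X) a b c d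
  have h2 := congrArg (fun P => coeff P k) h
  simp only [finsetSum_coeff, algebraMap_eq, mul_assoc, coeff_C_mul] at h2
  simp only [M] at h2 ⊢
  rw [h2]
  congr 3 <;> simp only [map_add, map_mul] <;> ring

lemma M_diag {R : Type*} [CommRing R] [Algebra ℝ R] (n i k : ℕ) (hi : i ≤ n) (hk : k ≤ n) (q : R) (a b c d : ℝ) :
    M n (algebraMap ℝ R a * q) (algebraMap ℝ R b) (algebraMap ℝ R c * q) (algebraMap ℝ R d) i k =
      algebraMap ℝ R (M n a b c d i k) * q ^ (n - k) := by
  have h := hom_M (S := R[X]) n i hi (C q) X a b c d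
  have h2 := congrArg (fun P => coeff P k) h
  simp only [finsetSum_coeff, Polynomial.algebraMap_apply, ← C_pow, ← C_mul, coeff_C_mul, coeff_X_pow] at h2
  rw [Finset.sum_eq_single k] at h2
  · simp only [if_true, mul_one] at h2
    rw [h2]; rfl
  · intro j _ hj; rw [if_neg (Ne.symm hj), mul_zero]
  · intro h; exact absurd (Finset.mem_range.2 (by omega)) h

lemma coeff_swap (P : ℝ[X][X]) (i j : ℕ) : ((Bivariate.swap P).coeff i).coeff j = (P.coeff j).coeff i := by
  induction P using Polynomial.induction_on' with
  | add p q hp hq => simp [map_add, hp, hq]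
  | monomial n f =>
    rw [Bivariate.swap_monomial, coeff_mul_C, coeff_map, coeff_C_mul, coeff_X_pow, coeff_monomial]
    by_cases h : j = n
    · subst h; simp
    · rw [if_neg h, if_neg (Ne.symm h)]; simp

lemma M_symm (n i j : ℕ) (hi : i ≤ n) (hj : j ≤ n) (a b c d : ℝ) :
    (n.choose i : ℝ) * M n a b c d i j = (n.choose j : ℝ) * M n a c b d j i := by
  have key : ∀ (a b c d : ℝ) (i j : ℕ), i ≤ n → (((C (C a + C b * X) + X * C (C c + C d * X) : ℝ[X][X]) ^ n).coeff i).coeff j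
     = (n.choose i : ℝ) * M n a b c d i j := by
    intro a b c d i j hi
    rw [add_comm, add_pow]
    simp only [mul_pow, ← C_pow]
    rw [finsetSum_coeff, Finset.sum_eq_single i]
    · rw [show ((n.choose i : ℕ) : ℝ[X][X]) = C (C (n.choose i : ℝ)) by simp, mul_assoc, mul_assoc, ← C_mul, ← C_mul,
        coeff_X_pow_mul', if_pos le_rfl, Nat.sub_self, coeff_C_zero, ← mul_assoc, mul_comm, coeff_C_mul, M,
        mul_comm (_ ^ i)]
    · intro k _ hk
      rw [show ((n.choose k : ℕ) : ℝ[X][X]) = C (C (n.choose k : ℝ)) by simp, mul_assoc, mul_assoc, ← C_mul, ← C_mul,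
        mul_comm, coeff_C_mul_X_pow, if_neg (Ne.symm hk)]
    · intro h; exact absurd (Finset.mem_range.2 (by omega)) h
  rw [← key a b c d i j hi, ← key a c b d j i hj, ← coeff_swap]
  congr 2
  rw [map_pow]
  congr 1
  simp only [map_add, map_mul, Bivariate.swap_Y, Bivariate.swap_X, Bivariate.swap_C_C]
  ring

lemma M_mul_nonneg (n i j : ℕ) (hi : i ≤ n) (hj : j ≤ n) (a b c d : ℝ) :
    0 ≤ M n a b c d i j * M n a c b d j i := by
  have h := M_symm n i j hi hj a b c d
  have h1 : (0:ℝ) < n.choose i := by exact_mod_cast Nat.choose_pos hi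
  have h2 : (0:ℝ) < n.choose j := by exact_mod_cast Nat.choose_pos hj
  have h3 : M n a c b d j i = (n.choose i : ℝ) / n.choose j * M n a b c d i j := by
    field_simp; linarith
  rw [h3]
  have : M n a b c d i j * ((n.choose i : ℝ) / n.choose j * M n a b c d i j)
    = (n.choose i : ℝ) / n.choose j * (M n a b c d i j)^2 := by ring
  rw [this]; positivity

end DB
end

section
namespace DB
open Polynomial
open LaurentPolynomial (T)
open scoped LaurentPolynomial

lemma lp_coeff_T_mul (k m : ℤ) (P : ℝ[T;T⁻¹]) : (T k * P).coeff m = P.coeff (m - k) := by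
  have h : (T k : ℝ[T;T⁻¹]) = AddMonoidAlgebra.single k 1 := rfl
  rw [h, AddMonoidAlgebra.coeff_single_mul_apply, one_mul]
  congr 1; ring

lemma e_eq_coeff (n : ℕ) (s p r : ℝ) (hp : p ^ 2 = 1 - s) (hr : r ^ 2 = s) : ∀ m : ℤ,
    (e (n+1) m).eval s = (tr n
      (algebraMap ℝ ℝ[T;T⁻¹] p * T 1 * (algebraMap ℝ ℝ[T;T⁻¹] p * T (-1)) + algebraMap ℝ ℝ[T;T⁻¹] r * (algebraMap ℝ ℝ[T;T⁻¹] r * T (-1)))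
      (algebraMap ℝ ℝ[T;T⁻¹] p * T 1 * algebraMap ℝ ℝ[T;T⁻¹] (-r) + algebraMap ℝ ℝ[T;T⁻¹] r * algebraMap ℝ ℝ[T;T⁻¹] p)
      (algebraMap ℝ ℝ[T;T⁻¹] (-r) * T 1 * (algebraMap ℝ ℝ[T;T⁻¹] p * T (-1)) + algebraMap ℝ ℝ[T;T⁻¹] p * (algebraMap ℝ ℝ[T;T⁻¹] r * T (-1)))
      (algebraMap ℝ ℝ[T;T⁻¹] (-r) * T 1 * algebraMap ℝ ℝ[T;T⁻¹] (-r) + algebraMap ℝ ℝ[T;T⁻¹] p * algebraMap ℝ ℝ[T;T⁻¹] p)).coeff m := by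
  set P := algebraMap ℝ ℝ[T;T⁻¹] p with hP
  set r' := algebraMap ℝ ℝ[T;T⁻¹] r with hr'
  rw [map_neg, ← hr']
  have hT : (T 1 : ℝ[T;T⁻¹]) * T (-1) = 1 := by rw [← LaurentPolynomial.T_add]; simp
  have hPr : P ^ 2 + r' ^ 2 = 1 := by
    rw [hP, hr', ← map_pow, ← map_pow, ← map_add, hp, hr]; simp
  have hP2 : P ^ 2 = algebraMap ℝ ℝ[T;T⁻¹] (1 - s) := by rw [hP, ← map_pow, hp]
  have hr2 : r' ^ 2 = algebraMap ℝ ℝ[T;T⁻¹] s := by rw [hr', ← map_pow, hr]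
  set A := P * T 1 * (P * T (-1)) + r' * (r' * T (-1)) with hA
  set B := P * T 1 * (-r') + r' * P with hB
  set Γ := (-r') * T 1 * (P * T (-1)) + P * (r' * T (-1)) with hC
  set D := (-r') * T 1 * (-r') + P * P with hD
  have htrace : A + D = algebraMap ℝ ℝ[T;T⁻¹] (2 * (1 - s)) + algebraMap ℝ ℝ[T;T⁻¹] s * (T 1 + T (-1)) := by
    rw [map_mul, ← hP2, ← hr2, hA, hD, map_ofNat]
    linear_combination P ^ 2 * hT
  have hdet : A * D - B * Γ = 1 := by
    rw [hA, hB, hC, hD]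
    linear_combination (P^2+r'^2)^2 * hT + (P^2 + r'^2+1) * hPr
  have hal : ∀ (x : ℝ) (Q : ℝ[T;T⁻¹]) (m : ℤ), (algebraMap ℝ ℝ[T;T⁻¹] x * Q).coeff m = x * Q.coeff m := by
    intro x Q m
    rw [← Algebra.smul_def]; rfl
  have h0 : ∀ m : ℤ, (1 : ℝ[T;T⁻¹]).coeff m = if m = 0 then 1 else 0 := by
    intro m
    rw [← LaurentPolynomial.T_zero, LaurentPolynomial.T_apply]
    simp only [eq_comm]
  have hstep : ∀ (x y : ℝ[T;T⁻¹]) (m : ℤ), ((A + D) * x - y).coeff m =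
      2 * (1 - s) * x.coeff m + s * (x.coeff (m-1) + x.coeff (m+1)) - y.coeff m := by
    intro x y m
    rw [htrace, add_mul, mul_assoc, add_mul (T 1), AddMonoidAlgebra.coeff_sub, AddMonoidAlgebra.coeff_add]
    simp only [Finsupp.sub_apply, Finsupp.add_apply, hal, AddMonoidAlgebra.coeff_add, lp_coeff_T_mul, sub_neg_eq_add]
  induction n using Nat.strong_induction_on with
  | _ n ih =>
    match n with
    | 0 => intro m; simp [e, tr, M]; rw [h0]; split_ifs <;> simp
    | 1 =>
      intro m
      have h1 : tr 1 A B Γ D = (A + D) * 1 - 0 := by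
        simp [tr, M, Finset.sum_range_succ, coeff_X, coeff_C]
      rw [h1, hstep]
      simp only [e, h0]
      simp
      split_ifs <;> simp
    | (n+2) =>
      intro m
      rw [tr_rec, hdet, one_mul, hstep]
      have i1 := ih (n+1) (by omega)
      have i0 := ih n (by omega)
      rw [← i1, ← i1, ← i1, ← i0]
      rw [show n + 2 + 1 = (n+1) + 2 by ring, e]
      simp

lemma e_nonneg (n : ℕ) (s : ℝ) (h0 : 0 ≤ s) (h1 : s ≤ 1) (m : ℤ) : 0 ≤ (e n m).eval s := by
  cases n with
  | zero => simp [e]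
  | succ n =>
    rw [e_eq_coeff n s (Real.sqrt (1-s)) (Real.sqrt s) (Real.sq_sqrt (by linarith)) (Real.sq_sqrt h0), tr,
      AddMonoidAlgebra.coeff_sum, Finsupp.finsetSum_apply]
    refine Finset.sum_nonneg fun i hi => ?_
    have hi : i ≤ n := by have := Finset.mem_range.1 hi; omega
    rw [M_mul n i i hi, AddMonoidAlgebra.coeff_sum, Finsupp.finsetSum_apply]
    refine Finset.sum_nonneg fun j hj => ?_
    have hj : j ≤ n := by have := Finset.mem_range.1 hj; omega
    rw [M_diag n i j hi hj, M_diag n j i hj hi, LaurentPolynomial.T_pow, LaurentPolynomial.T_pow]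
    have : ∀ (x y : ℝ) (k l : ℤ), algebraMap ℝ ℝ[T;T⁻¹] x * T k * (algebraMap ℝ ℝ[T;T⁻¹] y * T l)
       = (x * y) • T (k + l) := by
      intro x y k l
      rw [Algebra.smul_def, map_mul, LaurentPolynomial.T_add]; ring
    rw [this, AddMonoidAlgebra.coeff_smul, Finsupp.smul_apply, LaurentPolynomial.T_apply, smul_eq_mul]
    refine mul_nonneg (M_mul_nonneg n i j hi hj _ _ _ _) ?_
    split_ifs <;> norm_num

/-- de Branges weight functions in the variable `s = exp (-t)`, for index `k ≤ N` (`N = n` in the paper,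
`e (N+1)`). -/
noncomputable def tau (N k : ℕ) : ℝ[X] :=
  e (N+1) k + 2 * ∑ j ∈ Finset.Ioc k N, e (N+1) j

lemma tau_sub (N k : ℕ) : tau N k - tau N (k+1) = e (N+1) k + e (N+1) (k+1) := by
  unfold tau
  by_cases h : k < N
  · have : Finset.Ioc k N = insert (k+1) (Finset.Ioc (k+1) N) := by
      ext x; simp only [Finset.mem_Ioc, Finset.mem_insert]; omega
    rw [this, Finset.sum_insert (by simp)]; push_cast; ring
  · have h1 : Finset.Ioc k N = ∅ := by ext x; simp; omega
    have h2 : Finset.Ioc (k+1) N = ∅ := by ext x; simp; omega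
    have h3 : e (N+1) ((k:ℤ)+1) = 0 := e_zero _ _ (by push_cast; grind)
    rw [h1, h2]; push_cast; rw [h3]; simp

lemma tau_top (N k : ℕ) (hk : N < k) : tau N k = 0 := by
  unfold tau
  have h1 : Finset.Ioc k N = ∅ := by ext x; simp; omega
  rw [h1, e_zero _ _ (by push_cast; grind)]; simp

lemma tau_deriv (N k : ℕ) : X * derivative (tau N k) = (k : ℝ[X]) * e (N+1) k := by
  by_cases h : N < k
  · rw [tau_top N k h, e_zero _ _ (by push_cast; grind)]; simp
  · have key : ∀ j : ℕ, j ≤ N + 1 → X * derivative (tau N (N+1-j)) = ((N+1-j : ℕ) : ℝ[X]) * e (N+1) ((N+1-j : ℕ) : ℤ) := by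
      intro j
      induction j with
      | zero => intro _; rw [tau_top N _ (by omega), e_zero _ _ (by push_cast; grind)]; simp
      | succ j ih =>
        intro hj
        have ih := ih (by omega)
        have h1 := tau_sub N (N+1-(j+1))
        rw [show N+1-(j+1)+1 = N+1-j by omega] at h1
        have h2 := e_ode (N+1) ((N+1-(j+1) : ℕ) : ℤ)
        have e1 : (((N+1-(j+1) : ℕ) : ℤ) + 1) = ((N+1-j : ℕ) : ℤ) := by omega
        rw [e1] at h2 h1
        have e2 : ((((N+1-(j+1) : ℕ) : ℤ) : ℝ[X]) + 1) = ((N+1-j : ℕ) : ℝ[X]) := by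
          have := congrArg (Int.cast : ℤ → ℝ[X]) e1
          simpa using this
        rw [e2] at h2
        have h3 : derivative (tau N (N+1-(j+1))) = derivative (tau N (N+1-j)) + derivative (e (N+1) ((N+1-(j+1) : ℕ) : ℤ))
           + derivative (e (N+1) ((N+1-j : ℕ) : ℤ)) := by
          have := congrArg derivative h1
          simp only [derivative_sub, derivative_add] at this
          linear_combination this
        rw [h3]
        push_cast at h2 ⊢
        linear_combination ih + h2
    have := key (N+1-k) (by omega)
    rwa [show N+1-(N+1-k) = k by omega] at this

lemma tau_one (N k : ℕ) (hk : k ≤ N + 1) : (tau N k).eval 1 = (N : ℝ) + 1 - k := by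
  have key : ∀ j : ℕ, j ≤ N + 1 → (tau N (N+1-j)).eval 1 = (j : ℝ) := by
    intro j
    induction j with
    | zero => intro _; rw [tau_top N _ (by omega)]; simp
    | succ j ih =>
      intro hj
      have ih := ih (by omega)
      have h1 := tau_sub N (N+1-(j+1))
      rw [show N+1-(j+1)+1 = N+1-j by omega] at h1
      have h2 := congrArg (eval 1) h1
      simp only [eval_sub, eval_add, e_one] at h2
      have e1 : (((N+1-(j+1) : ℕ) : ℤ) + 1) = ((N+1-j : ℕ) : ℤ) := by omega
      have e2 : ((N+1-(j+1) : ℕ) : ℤ) = N - j := by omega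
      rw [ih, e2] at h2
      have e3 : (if |(N:ℤ) - j| < ((N+1 : ℕ):ℤ) ∧ (((N+1 : ℕ):ℤ) + ((N:ℤ) - j)) % 2 = 1 then (1:ℝ) else 0)
        + (if |(N:ℤ) - j + 1| < ((N+1 : ℕ):ℤ) ∧ (((N+1 : ℕ):ℤ) + ((N:ℤ) - j + 1)) % 2 = 1 then (1:ℝ) else 0) = 1 := by
        have a1 : |(N:ℤ) - j| = N - j := abs_of_nonneg (by omega)
        have a2 : |(N:ℤ) - j + 1| = N - j + 1 := abs_of_nonneg (by omega)
        rw [a1, a2]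
        push_cast
        split_ifs <;> first | (exfalso; omega) | norm_num
      rw [e3] at h2
      rw [Nat.cast_succ]; linarith
  have := key (N+1-k) (by omega)
  rw [show N+1-(N+1-k) = k by omega] at this
  rw [this]; push_cast [hk]; ring

lemma tau_nonneg (N k : ℕ) (s : ℝ) (h0 : 0 ≤ s) (h1 : s ≤ 1) : 0 ≤ (tau N k).eval s := by
  unfold tau
  rw [eval_add, eval_mul, eval_finsetSum]
  have := e_nonneg (N+1) s h0 h1
  have h2 := Finset.sum_nonneg (s := Finset.Ioc k N) (f := fun j : ℕ => (e (N+1) (j:ℤ)).eval s) (fun i _ => this i)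
  have h3 := this k
  have h4 : eval s (2 : ℝ[X]) = 2 := by simp
  rw [h4]; linarith

end DB
end

section
open Polynomial

namespace DB

/-- n-th Taylor coefficient at zero -/
noncomputable def cf (n : ℕ) (F : ℂ → ℂ) : ℂ := iteratedDeriv n F 0 / (n.factorial : ℂ)

lemma cf_congr {F G : ℂ → ℂ} (h : F =ᶠ[nhds 0] G) (n : ℕ) : cf n F = cf n G := by
  unfold cf; rw [h.iteratedDeriv_eq]

lemma cf_zero (F : ℂ → ℂ) : cf 0 F = F 0 := by simp [cf]

lemma cf_one (F : ℂ → ℂ) : cf 1 F = deriv F 0 := by simp [cf, iteratedDeriv_one]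

lemma cf_deriv (F : ℂ → ℂ) (n : ℕ) : cf n (deriv F) = (n + 1) * cf (n + 1) F := by
  unfold cf
  rw [iteratedDeriv_succ', Nat.factorial_succ]
  have h1 : (n.factorial : ℂ) ≠ 0 := by exact_mod_cast n.factorial_ne_zero
  have h2 : (n : ℂ) + 1 ≠ 0 := by exact_mod_cast n.succ_ne_zero
  push_cast
  field_simp

lemma cf_add {F G : ℂ → ℂ} (hF : AnalyticAt ℂ F 0) (hG : AnalyticAt ℂ G 0) (n : ℕ) :
    cf n (fun z => F z + G z) = cf n F + cf n G := by
  unfold cf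
  have := iteratedDeriv_add (n := n) hF.contDiffAt hG.contDiffAt
  rw [show (fun z => F z + G z) = F + G from rfl, this]; ring

lemma cf_const_mul {F : ℂ → ℂ} (hF : AnalyticAt ℂ F 0) (c : ℂ) (n : ℕ) :
    cf n (fun z => c * F z) = c * cf n F := by
  unfold cf
  rw [iteratedDeriv_const_mul c hF.contDiffAt]; ring

lemma cf_neg {F : ℂ → ℂ} (hF : AnalyticAt ℂ F 0) (n : ℕ) :
    cf n (fun z => - F z) = - cf n F := by
  have := cf_const_mul hF (-1) n
  simpa using this

lemma cf_sub {F G : ℂ → ℂ} (hF : AnalyticAt ℂ F 0) (hG : AnalyticAt ℂ G 0) (n : ℕ) :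
    cf n (fun z => F z - G z) = cf n F - cf n G := by
  have := cf_add hF hG.neg n
  simp only [Pi.neg_apply] at this
  rw [show (fun z => F z - G z) = fun z => F z + - G z by ext; ring, this,
    show (-G) = fun z => - G z from rfl, cf_neg hG]
  ring

lemma cf_mul {F G : ℂ → ℂ} (hF : AnalyticAt ℂ F 0) (hG : AnalyticAt ℂ G 0) (n : ℕ) :
    cf n (fun z => F z * G z) = ∑ i ∈ Finset.range (n + 1), cf i F * cf (n - i) G := by
  unfold cf
  rw [show (fun z => F z * G z) = F * G from rfl,
    iteratedDeriv_mul (n := n) hF.contDiffAt hG.contDiffAt, Finset.sum_div]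
  apply Finset.sum_congr rfl
  intro i hi
  have hi' : i ≤ n := by simpa [Nat.lt_succ_iff] using hi
  have h0 : (n.factorial : ℂ) ≠ 0 := by exact_mod_cast n.factorial_ne_zero
  have h1 : (i.factorial : ℂ) ≠ 0 := by exact_mod_cast i.factorial_ne_zero
  have h2 : ((n - i).factorial : ℂ) ≠ 0 := by exact_mod_cast (n - i).factorial_ne_zero
  have h3 : (n.choose i : ℂ) * i.factorial * (n - i).factorial = n.factorial := by
    exact_mod_cast Nat.choose_mul_factorial_mul_factorial hi'
  rw [← h3]
  field_simp
  have : (n.choose i : ℂ) ≠ 0 := by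
    intro h; rw [h] at h3; simp at h3; exact h0 h3.symm
  field_simp

lemma cf_const (c : ℂ) (n : ℕ) : cf n (fun _ => c) = if n = 0 then c else 0 := by
  unfold cf
  rw [iteratedDeriv_const]
  split_ifs with h
  · simp [h]
  · simp

lemma cf_id (n : ℕ) : cf n (fun z => z) = if n = 1 then 1 else 0 := by
  rcases n with _ | n
  · simp [cf_zero]
  · have h := cf_deriv (fun z => z) n
    rw [show deriv (fun z : ℂ => z) = fun _ => 1 by ext; simp, cf_const] at h
    rcases n with _ | n
    · simpa using h.symm
    · have h2 : ((n + 1 : ℕ) : ℂ) + 1 ≠ 0 := by exact_mod_cast (n + 1).succ_ne_zero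
      simp only [Nat.add_eq_zero_iff, one_ne_zero, and_false, if_false] at h
      rcases mul_eq_zero.1 h.symm with h | h
      · exact absurd h h2
      · simp [h]

lemma cf_id_mul {F : ℂ → ℂ} (hF : AnalyticAt ℂ F 0) (n : ℕ) :
    cf (n + 1) (fun z => z * F z) = cf n F := by
  rw [cf_mul (F := fun z => z) analyticAt_id hF, Finset.sum_eq_single 1]
  · rw [cf_id]; simp
  · intro b _ hb
    rw [cf_id]; simp [hb]
  · intro h; simp at h

lemma cf_scale {F : ℂ → ℂ} (hF : AnalyticAt ℂ F 0) (c : ℂ) (n : ℕ) :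
    cf n (fun z => F (c * z)) = c ^ n * cf n F := by
  have : iteratedDeriv n (fun z => F (c * z)) 0 = c ^ n * iteratedDeriv n F 0 := by
    induction n generalizing F with
    | zero => simp
    | succ n ih =>
      rw [iteratedDeriv_succ', iteratedDeriv_succ']
      have h1 : deriv (fun z => F (c * z)) = fun z => c * (deriv F) (c * z) := by
        ext z; simpa using deriv_comp_mul_left c F z
      rw [h1, iteratedDeriv_const_mul c, ih hF.deriv]
      · ring
      · have h2 : AnalyticAt ℂ (fun z => deriv F (c * z)) 0 := by
          have h3 : AnalyticAt ℂ (deriv F) (c * 0) := by simpa using hF.deriv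
          exact h3.comp_of_eq (f := fun z => c * z) (by fun_prop) rfl
        exact h2.contDiffAt
  unfold cf
  rw [this]; ring

lemma cf_bound {F : ℂ → ℂ} {r B : ℝ} (hr : 0 < r) (hF : DiffContOnCl ℂ F (Metric.ball 0 r))
    (hB : ∀ z ∈ Metric.sphere (0:ℂ) r, ‖F z‖ ≤ B) (n : ℕ) : ‖cf n F‖ ≤ B / r ^ n := by
  have := Complex.norm_iteratedDeriv_le_of_forall_mem_sphere_norm_le n hr hF hB
  unfold cf
  have h0 : (0:ℝ) < (n.factorial : ℝ) := by exact_mod_cast n.factorial_pos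
  rw [norm_div, Complex.norm_natCast, div_le_iff₀ h0]
  calc _ ≤ _ := this
    _ = _ := by ring

lemma cf_bound' {F : ℂ → ℂ} {r B : ℝ} (hr : 0 < r) (hF : DifferentiableOn ℂ F (Metric.ball 0 1))
    (hr1 : r < 1)
    (hB : ∀ z ∈ Metric.sphere (0:ℂ) r, ‖F z‖ ≤ B) (n : ℕ) : ‖cf n F‖ ≤ B / r ^ n := by
  refine cf_bound hr ?_ hB n
  apply DifferentiableOn.diffContOnCl
  rw [closure_ball _ hr.ne']
  exact hF.mono (Metric.closedBall_subset_ball hr1)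

lemma an_of_diff {F : ℂ → ℂ} {r : ℝ} (hr : 0 < r) (hF : DifferentiableOn ℂ F (Metric.ball 0 r)) :
    AnalyticAt ℂ F 0 := hF.analyticAt (Metric.ball_mem_nhds 0 hr)

end DB
end

section
open Polynomial

namespace DB

/-- Milin exponent -/
noncomputable def mil (A : ℕ → ℂ) (n : ℕ) : ℝ :=
  (∑ v ∈ Finset.range n, ((n:ℝ) - v) * ((v + 1) * ‖A (v + 1)‖ ^ 2 - 1 / (v + 1))) / (n + 1)

lemma mil_succ (A : ℕ → ℂ) (n : ℕ) :
    mil A (n + 1) = mil A n +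
      ((∑ v ∈ Finset.range (n + 1), ((v:ℝ) + 1) ^ 2 * ‖A (v + 1)‖ ^ 2) - (n + 1))
        / ((n + 1) * (n + 2)) := by
  have h1 : (n:ℝ) + 1 ≠ 0 := by positivity
  have h2 : (n:ℝ) + 2 ≠ 0 := by positivity
  have e1 : mil A n = (∑ v ∈ Finset.range (n + 1), ((n:ℝ) - v) *
      ((v + 1) * ‖A (v + 1)‖ ^ 2 - 1 / (v + 1))) / (n + 1) := by
    rw [Finset.sum_range_succ]; simp [mil]
  have e2 : (∑ v ∈ Finset.range (n + 1), ((v:ℝ) + 1) ^ 2 * ‖A (v + 1)‖ ^ 2) - ((n:ℝ) + 1) =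
     ∑ v ∈ Finset.range (n + 1), (((v:ℝ) + 1) ^ 2 * ‖A (v + 1)‖ ^ 2 - 1) := by
    simp
  rw [e1, e2, mil, Finset.sum_div, Finset.sum_div, Finset.sum_div, ← Finset.sum_add_distrib]
  apply Finset.sum_congr rfl
  intro v _
  have h3 : (v:ℝ) + 1 ≠ 0 := by positivity
  push_cast
  have h4 : (n:ℝ) + 1 + 1 ≠ 0 := by positivity
  field_simp
  ring

lemma lebedev (A D : ℕ → ℂ) (h0 : D 0 = 1)
    (hD : ∀ k : ℕ, ((k:ℂ) + 1) * D (k + 1) = ∑ i ∈ Finset.range (k + 1), ((i:ℂ) + 1) * A (i + 1) * D (k - i))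
    (n : ℕ) : ∑ k ∈ Finset.range (n + 1), ‖D k‖ ^ 2 ≤ (n + 1) * Real.exp (mil A n) := by
  induction n with
  | zero => simp [h0, mil]
  | succ n ih =>
    set a := ∑ v ∈ Finset.range (n + 1), ((v:ℝ) + 1) ^ 2 * ‖A (v + 1)‖ ^ 2 with ha
    set d := ∑ k ∈ Finset.range (n + 1), ‖D k‖ ^ 2 with hd
    have hn : (0:ℝ) < n + 1 := by positivity
    have ha0 : 0 ≤ a := by positivity
    have hd0 : 0 ≤ d := by positivity
    have cs : ((n:ℝ) + 1) ^ 2 * ‖D (n + 1)‖ ^ 2 ≤ a * d := by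
      have e1 : ((n:ℝ) + 1) * ‖D (n + 1)‖ ≤
          ∑ i ∈ Finset.range (n + 1), (((i:ℝ) + 1) * ‖A (i + 1)‖) * ‖D (n - i)‖ := by
        have := congrArg norm (hD n)
        rw [norm_mul, show ((n:ℂ) + 1) = ((n + 1 : ℕ) : ℂ) by push_cast; ring,
          Complex.norm_natCast] at this
        push_cast at this
        rw [this]
        refine (norm_sum_le _ _).trans (le_of_eq ?_)
        apply Finset.sum_congr rfl
        intro i _
        rw [norm_mul, norm_mul, show ((i:ℂ) + 1) = ((i + 1 : ℕ) : ℂ) by push_cast; ring,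
          Complex.norm_natCast]
        push_cast; ring
      have e2 := Finset.sum_mul_sq_le_sq_mul_sq (Finset.range (n + 1))
        (fun i => ((i:ℝ) + 1) * ‖A (i + 1)‖) (fun i => ‖D (n - i)‖)
      have e3 : ∑ i ∈ Finset.range (n + 1), ‖D (n - i)‖ ^ 2 = d := by
        rw [hd, ← Finset.sum_range_reflect]
        apply Finset.sum_congr rfl
        intro i hi
        have : i ≤ n := by simpa [Nat.lt_succ_iff] using hi
        congr 3
        omega
      rw [e3] at e2
      have e4 : ∑ i ∈ Finset.range (n + 1), (((i:ℝ) + 1) * ‖A (i + 1)‖) ^ 2 = a := by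
        rw [ha]; apply Finset.sum_congr rfl; intro i _; ring
      rw [e4] at e2
      calc _ = (((n:ℝ) + 1) * ‖D (n + 1)‖) ^ 2 := by ring
        _ ≤ _ := pow_le_pow_left₀ (by positivity) e1 2
        _ ≤ _ := e2
    rw [Finset.sum_range_succ, ← hd, mil_succ, ← ha, Real.exp_add]
    set t := (a - (n + 1)) / (((n:ℝ) + 1) * (n + 2)) with ht
    have e5 : ‖D (n + 1)‖ ^ 2 ≤ a * d / ((n:ℝ) + 1) ^ 2 := by
      rw [le_div_iff₀ (by positivity)]; linarith
    have e6 : d + a * d / ((n:ℝ) + 1) ^ 2 = d * (((n + 2) / (n + 1)) * (t + 1)) := by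
      rw [ht]; field_simp; ring
    have e7 : t + 1 ≤ Real.exp t := Real.add_one_le_exp t
    calc d + ‖D (n + 1)‖ ^ 2 ≤ d * (((n + 2) / (n + 1)) * (t + 1)) := by rw [← e6]; linarith
      _ ≤ d * (((n + 2) / (n + 1)) * Real.exp t) := by gcongr
      _ ≤ ((n + 1) * Real.exp (mil A n)) * (((n + 2) / (n + 1)) * Real.exp t) := by gcongr
      _ = _ := by push_cast; field_simp; ring

lemma conv_le (D : ℕ → ℂ) (n : ℕ) :
    ‖∑ i ∈ Finset.range (n + 1), D i * D (n - i)‖ ≤ ∑ k ∈ Finset.range (n + 1), ‖D k‖ ^ 2 := by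
  have e3 : ∑ i ∈ Finset.range (n + 1), ‖D (n - i)‖ ^ 2 = ∑ k ∈ Finset.range (n + 1), ‖D k‖ ^ 2 := by
    rw [← Finset.sum_range_reflect]
    apply Finset.sum_congr rfl
    intro i hi
    have : i ≤ n := by simpa [Nat.lt_succ_iff] using hi
    congr 3
    omega
  calc _ ≤ ∑ i ∈ Finset.range (n + 1), ‖D i * D (n - i)‖ := norm_sum_le _ _
    _ ≤ ∑ i ∈ Finset.range (n + 1), (‖D i‖ ^ 2 + ‖D (n - i)‖ ^ 2) / 2 := by
        gcongr with i _
        rw [norm_mul]; nlinarith [sq_nonneg (‖D i‖ - ‖D (n - i)‖)]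
    _ = _ := by rw [← Finset.sum_div, Finset.sum_add_distrib, e3]; ring

/-- Milin inequality implies the coefficient bound -/
lemma coeff_of_milin {L : ℂ → ℂ} (hL : AnalyticAt ℂ L 0) (h0 : L 0 = 0) (n : ℕ)
    (hM : ∑ v ∈ Finset.range n, ((n:ℝ) - v) * ((v + 1) * ‖cf (v + 1) L‖ ^ 2 - 4 / (v + 1)) ≤ 0) :
    ‖cf (n + 1) (fun z => z * Complex.exp (L z))‖ ≤ n + 1 := by
  set E : ℂ → ℂ := fun z => Complex.exp (L z / 2) with hE
  have hEa : AnalyticAt ℂ E 0 := by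
    have : AnalyticAt ℂ (fun z => L z / 2) 0 := by fun_prop
    exact this.cexp
  have hA := hL
  rw [cf_id_mul (F := fun z => Complex.exp (L z)) hL.cexp]
  have e1 : (fun z => Complex.exp (L z)) = fun z => E z * E z := by
    ext z; rw [hE]; simp only; rw [← Complex.exp_add]; congr 1; ring
  rw [e1, cf_mul hEa hEa]
  refine (conv_le _ n).trans ?_
  have key := lebedev (fun k => cf k L / 2) (fun k => cf k E) (by simp [cf_zero, hE, h0]) ?_ n
  · refine key.trans ?_
    have : mil (fun k => cf k L / 2) n ≤ 0 := by
      unfold mil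
      apply div_nonpos_of_nonpos_of_nonneg _ (by positivity)
      have : ∑ v ∈ Finset.range n, ((n:ℝ) - v) * ((v + 1) * ‖cf (v + 1) L / 2‖ ^ 2 - 1 / (v + 1))
        = (∑ v ∈ Finset.range n, ((n:ℝ) - v) * ((v + 1) * ‖cf (v + 1) L‖ ^ 2 - 4 / (v + 1))) / 4 := by
        rw [Finset.sum_div]
        apply Finset.sum_congr rfl
        intro v _
        have h3 : (v:ℝ) + 1 ≠ 0 := by positivity
        rw [norm_div]
        simp only [Complex.norm_ofNat]
        field_simp
        ring
      rw [this]; linarith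
    have h1 : Real.exp (mil (fun k => cf k L / 2) n) ≤ 1 := Real.exp_le_one_iff.2 this
    have : (0:ℝ) < n + 1 := by positivity
    nlinarith
  · intro k
    have hder : deriv E =ᶠ[nhds 0] fun z => (deriv L z / 2) * E z := by
      filter_upwards [hL.eventually_analyticAt] with z hz
      have h2 : HasDerivAt (fun z => L z / 2) (deriv L z / 2) z :=
        hz.differentiableAt.hasDerivAt.div_const 2
      rw [h2.cexp.deriv]; ring
    have h3 := cf_deriv E k
    rw [cf_congr hder, cf_mul (F := fun z => deriv L z / 2) (by have := hL.deriv; fun_prop) hEa] at h3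
    rw [← h3]
    apply Finset.sum_congr rfl
    intro i _
    have h4 : cf i (fun z => deriv L z / 2) = (i + 1) * (cf (i + 1) L) / 2 := by
      have := cf_const_mul hL.deriv (1/2) i
      rw [cf_deriv] at this
      rw [show (fun z => deriv L z / 2) = fun z => 1 / 2 * deriv L z by ext; ring, this]; ring
    rw [h4]; ring

end DB
end

section
open Polynomial

namespace DB

lemma abel_aux (b la ta : ℕ → ℝ) (hb : b 0 = 1)
    (h : ∀ k, ta k - ta (k + 1) = la k + la (k + 1)) (n : ℕ) :
    ∑ i ∈ Finset.range n, (b (i + 1) - b i) * ta (i + 1) =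
      (b n - 1) * (ta (n + 1) + la (n + 1))
        + ∑ i ∈ Finset.range n, la (i + 1) * (b (i + 1) + b i - 2) := by
  induction n with
  | zero => simp [hb]
  | succ n ih =>
    rw [Finset.sum_range_succ, ih, Finset.sum_range_succ]
    have := h (n + 1)
    have h2 : ta (n + 1 + 1) = ta (n + 1) - la (n + 1) - la (n + 1 + 1) := by linarith
    rw [h2]; ring

/-- the bracket -/
noncomputable def Wb (N : ℕ) (la ta : ℕ → ℝ) (d P : ℕ → ℂ) : ℝ :=
  ∑ i ∈ Finset.range N, (‖d (i + 1)‖ ^ 2 - 4) * la (i + 1)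
    - 2 * (∑ i ∈ Finset.range N, (starRingEnd ℂ (d (i + 1)) * (ta (i + 1) : ℂ)) *
        ∑ m ∈ Finset.range (i + 2), P m * d (i + 1 - m)).re

lemma Wb_one (N : ℕ) (la ta : ℕ → ℝ) (d : ℕ → ℂ) (hd : d 0 = 1)
    (h : ∀ k, ta k - ta (k + 1) = la k + la (k + 1)) (h1 : ta (N + 1) = 0) (h2 : la (N + 1) = 0)
    (hla : ∀ k, 0 ≤ la k) :
    Wb N la ta d (fun m => if m = 0 then 1 else 2) ≤ 0 := by
  set B : ℕ → ℂ := fun k => ∑ l ∈ Finset.range (k + 1), d l with hB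
  have hB0 : B 0 = 1 := by simp [hB, hd]
  have hBs : ∀ k, d (k + 1) = B (k + 1) - B k := by
    intro k; simp [hB, Finset.sum_range_succ _ (k + 1)]
  have hv : ∀ k, ∑ m ∈ Finset.range (k + 2), (if m = 0 then (1:ℂ) else 2) * d (k + 1 - m)
      = B (k + 1) + B k := by
    intro k
    rw [Finset.sum_range_succ']
    simp only [Nat.add_eq_zero_iff, one_ne_zero, and_false, if_false, if_true]
    have : ∑ m ∈ Finset.range (k + 1), (2:ℂ) * d (k + 1 - (m + 1)) = 2 * B k := by
      rw [← Finset.mul_sum, hB]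
      congr 1
      simp only
      rw [← Finset.sum_range_reflect]
      apply Finset.sum_congr rfl
      intro j hj
      have : j ≤ k := by simpa [Nat.lt_succ_iff] using hj
      congr 1
      omega
    rw [this]
    simp only [Nat.sub_zero, hBs k]
    ring
  unfold Wb
  simp only [hv]
  have key := abel_aux (fun k => ‖B k‖ ^ 2) la ta (by simp [hB0]) h N
  rw [h1, h2] at key
  simp only [add_zero, mul_zero, zero_add] at key
  have e1 : (∑ i ∈ Finset.range N, (starRingEnd ℂ (d (i + 1)) * (ta (i + 1) : ℂ)) *
      (B (i + 1) + B i)).re = ∑ i ∈ Finset.range N, (‖B (i + 1)‖ ^ 2 - ‖B i‖ ^ 2) * ta (i + 1) := by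
    rw [Complex.re_sum]
    apply Finset.sum_congr rfl
    intro i _
    rw [hBs]
    simp only [← Complex.normSq_eq_norm_sq, Complex.normSq_apply, Complex.mul_re, Complex.mul_im,
      Complex.add_re, Complex.add_im, Complex.conj_re, Complex.conj_im, Complex.sub_re,
      Complex.sub_im, Complex.ofReal_re, Complex.ofReal_im]
    ring
  rw [e1, key, Finset.mul_sum, ← Finset.sum_sub_distrib]
  apply Finset.sum_nonpos
  intro i _
  have e2 : (‖d (i + 1)‖ ^ 2 - 4) * la (i + 1) -
      2 * (la (i + 1) * (‖B (i + 1)‖ ^ 2 + ‖B i‖ ^ 2 - 2)) = - (la (i + 1) * ‖B (i + 1) + B i‖ ^ 2) := by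
    rw [hBs]
    simp only [← Complex.normSq_eq_norm_sq, Complex.normSq_apply,
      Complex.add_re, Complex.add_im, Complex.sub_re,
      Complex.sub_im]
    ring
  rw [e2]
  have := hla (i + 1)
  have : 0 ≤ la (i + 1) * ‖B (i + 1) + B i‖ ^ 2 := by positivity
  linarith

lemma Wb_kappa (N : ℕ) (la ta : ℕ → ℝ) (d : ℕ → ℂ) (hd : d 0 = 1)
    (h : ∀ k, ta k - ta (k + 1) = la k + la (k + 1)) (h1 : ta (N + 1) = 0) (h2 : la (N + 1) = 0)
    (hla : ∀ k, 0 ≤ la k) (κ : ℂ) (hκ : ‖κ‖ = 1) :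
    Wb N la ta d (fun m => if m = 0 then 1 else 2 * κ ^ m) ≤ 0 := by
  set c := starRingEnd ℂ κ with hc
  have hcc : c * κ = 1 := by
    rw [hc, mul_comm, Complex.mul_conj, Complex.normSq_eq_norm_sq, hκ]; simp
  have hcn : ‖c‖ = 1 := by rw [hc]; simpa using hκ
  have key := Wb_one N la ta (fun k => d k * c ^ k) (by simp [hd]) h h1 h2 hla
  convert key using 1
  unfold Wb
  congr 1
  · simp [norm_mul, norm_pow, hcn]
  congr 2
  apply Finset.sum_congr rfl
  intro i _
  have e1 : (starRingEnd ℂ) (d (i + 1) * c ^ (i + 1)) = starRingEnd ℂ (d (i + 1)) * κ ^ (i + 1) := by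
    rw [map_mul, map_pow, hc, Complex.conj_conj]
  rw [e1]
  have e2 : ∑ m ∈ Finset.range (i + 2), (if m = 0 then 1 else 2 * κ ^ m) * d (i + 1 - m)
     = κ ^ (i + 1) * ∑ m ∈ Finset.range (i + 2), (if m = 0 then 1 else 2) *
        (d (i + 1 - m) * c ^ (i + 1 - m)) := by
    rw [Finset.mul_sum]
    apply Finset.sum_congr rfl
    intro m hm
    have hm' : m ≤ i + 1 := by
      have := Finset.mem_range.1 hm; omega
    have e3 : κ ^ (i + 1) * c ^ (i + 1 - m) = κ ^ m := by
      conv_lhs => rw [← Nat.sub_add_cancel hm', pow_add]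
      rw [Nat.sub_add_cancel hm', mul_comm, ← mul_assoc, ← mul_pow, hcc]; simp
    by_cases h0 : m = 0
    · subst h0
      have e4 : κ ^ (i + 1) * c ^ (i + 1) = 1 := by simpa using e3
      simp only [if_true, Nat.sub_zero]
      linear_combination (- d (i + 1)) * e4
    · simp only [h0, if_false]
      linear_combination (- 2 * d (i + 1 - m)) * e3
  rw [e2]
  ring

end DB
end

section
open Polynomial

namespace DB

lemma avg_coeff {F : ℂ → ℂ} {r : ℝ} (hr : 0 < r) (hF : DiffContOnCl ℂ F (Metric.ball 0 r)) (m : ℕ) :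
    Real.circleAverage (fun z => F z * (r / z) ^ m) 0 r = r ^ m * cf m F := by
  rw [Real.circleAverage_eq_circleIntegral hr.ne']
  have h1 := hF.circleIntegral_one_div_sub_center_pow_smul hr m
  have h2 : (∮ z in C(0, r), (z - 0)⁻¹ • (F z * (r / z) ^ m)) =
      (r:ℂ) ^ m * ∮ z in C(0, r), (1 / (z - 0) ^ (m + 1)) • F z := by
    rw [← smul_eq_mul ((r:ℂ) ^ m), ← circleIntegral.integral_smul]
    congr 1
    ext z
    simp only [sub_zero, smul_eq_mul, div_pow, pow_succ]
    field_simp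
  rw [h2, h1, cf]
  have := Complex.two_pi_I_ne_zero
  have h3 : (m.factorial : ℂ) ≠ 0 := by exact_mod_cast m.factorial_ne_zero
  simp only [smul_eq_mul]
  field_simp

lemma herglotz_r {P : ℂ → ℂ} (hP : DifferentiableOn ℂ P (Metric.ball 0 1))
    (hre : ∀ z ∈ Metric.ball (0:ℂ) 1, 0 ≤ (P z).re) (h0 : P 0 = 1) (N : ℕ) (α : ℝ) (β : ℕ → ℂ)
    (hq : ∀ κ : ℂ, ‖κ‖ = 1 → α + 2 * (∑ m ∈ Finset.range N, β m * κ ^ (m + 1)).re ≤ 0)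
    {r : ℝ} (hr : 0 < r) (hr1 : r < 1) :
    α + (∑ m ∈ Finset.range N, β m * (r ^ (m + 1) * cf (m + 1) P)).re ≤ 0 := by
  have hPc : DiffContOnCl ℂ P (Metric.ball 0 r) := by
    apply DifferentiableOn.diffContOnCl
    rw [closure_ball _ hr.ne']
    exact hP.mono (Metric.closedBall_subset_ball hr1)
  have hcont : ContinuousOn P (Metric.sphere 0 r) :=
    hP.continuousOn.mono ((Metric.sphere_subset_closedBall).trans (Metric.closedBall_subset_ball hr1))
  have hz0 : ∀ z ∈ Metric.sphere (0:ℂ) r, z ≠ 0 := by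
    intro z hz h; rw [h] at hz; simp at hz; exact hr.ne hz
  set b : ℂ → ℂ := fun z => ∑ m ∈ Finset.range N, β m * (r / z) ^ (m + 1) with hb
  set bb : ℂ → ℂ := fun z => ∑ m ∈ Finset.range N, starRingEnd ℂ (β m) * (z / r) ^ (m + 1) with hbb
  have hconj : ∀ z ∈ Metric.sphere (0:ℂ) r, bb z = starRingEnd ℂ (b z) := by
    intro z hz
    have hz1 := hz0 z hz
    have hz2 : z * starRingEnd ℂ z = (r:ℂ) ^ 2 := by
      rw [Complex.mul_conj, Complex.normSq_eq_norm_sq]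
      simp at hz; rw [hz]; simp
    have hz3 : starRingEnd ℂ z ≠ 0 := by simpa using hz1
    have hr' : (r:ℂ) ≠ 0 := by exact_mod_cast hr.ne'
    simp only [hb, hbb, map_sum, map_mul, map_pow, map_div₀, Complex.conj_ofReal]
    have : z / r = r / starRingEnd ℂ z := by field_simp; linear_combination hz2
    rw [this]
  have c1 : ∀ m, ContinuousOn (fun z => P z * (r / z) ^ m) (Metric.sphere (0:ℂ) r) := by
    intro m
    apply hcont.mul
    exact (continuousOn_const.div continuousOn_id hz0).pow m
  have hbc : ContinuousOn b (Metric.sphere (0:ℂ) r) := by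
    rw [hb]
    apply continuousOn_finsetSum
    intro m _
    exact continuousOn_const.mul ((continuousOn_const.div continuousOn_id hz0).pow _)
  have hbbc : Differentiable ℂ bb := by rw [hbb]; fun_prop
  have i1 : CircleIntegrable (fun z => P z * b z) 0 r :=
    (hcont.mul hbc).circleIntegrable hr.le
  have i2 : CircleIntegrable (fun z => P z * bb z) 0 r :=
    (hcont.mul hbbc.continuous.continuousOn).circleIntegrable hr.le
  have i3 : CircleIntegrable (fun z => (α:ℂ) * P z) 0 r :=
    (continuousOn_const.mul hcont).circleIntegrable hr.le
  have a1 : Real.circleAverage (fun z => P z * b z) 0 r =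
      ∑ m ∈ Finset.range N, β m * (r ^ (m + 1) * cf (m + 1) P) := by
    have : (fun z => P z * b z) = fun z => ∑ m ∈ Finset.range N, β m • (P z * (r / z) ^ (m + 1)) := by
      ext z; rw [hb]; simp only [Finset.mul_sum, smul_eq_mul]
      apply Finset.sum_congr rfl; intro m _; ring
    rw [this, Real.circleAverage_fun_sum]
    · apply Finset.sum_congr rfl
      intro m _
      rw [Real.circleAverage_fun_smul, avg_coeff hr hPc]
      simp
    · intro m _
      exact ContinuousOn.circleIntegrable hr.le ((c1 (m + 1)).const_smul (β m))
  have a2 : Real.circleAverage (fun z => P z * bb z) 0 r = 0 := by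
    have : DiffContOnCl ℂ (fun z => P z * bb z) (Metric.ball 0 |r|) := by
      rw [abs_of_pos hr]
      exact hPc.smul hbbc.diffContOnCl
    rw [this.circleAverage, hbb]; simp
  have a3 : Real.circleAverage (fun z => (α:ℂ) * P z) 0 r = α := by
    have : DiffContOnCl ℂ (fun z => (α:ℂ) * P z) (Metric.ball 0 |r|) := by
      rw [abs_of_pos hr]
      exact (diffContOnCl_const (c := (α:ℂ))).smul hPc
    rw [this.circleAverage, h0]; simp
  have i4 : CircleIntegrable (fun z => (α:ℂ) * P z + P z * b z) 0 r := i3.add i1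
  have a4 : Real.circleAverage (fun z => ((α:ℂ) * P z + P z * b z) + P z * bb z) 0 r =
      α + ∑ m ∈ Finset.range N, β m * (r ^ (m + 1) * cf (m + 1) P) := by
    rw [Real.circleAverage_fun_add i4 i2, Real.circleAverage_fun_add i3 i1, a1, a2, a3]
    simp
  have i5 : CircleIntegrable (fun z => ((α:ℂ) * P z + P z * b z) + P z * bb z) 0 r := i4.add i2
  have a5 := Complex.reCLM.circleAverage_comp_comm i5
  rw [a4] at a5
  have i6 : CircleIntegrable (Complex.reCLM ∘ fun z => ((α:ℂ) * P z + P z * b z) + P z * bb z) 0 r := by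
    apply ContinuousOn.circleIntegrable hr.le
    apply Complex.reCLM.continuous.comp_continuousOn
    exact ((continuousOn_const.mul hcont).add (hcont.mul hbc)).add (hcont.mul hbbc.continuous.continuousOn)
  have a6 := Real.circleAverage_mono_on_of_le_circle (a := 0) i6 ?_
  · rw [a5] at a6
    simpa using a6
  · intro z hz
    rw [abs_of_pos hr] at hz
    have hzn : ‖z‖ = r := by simpa using hz
    have hk : ‖(r:ℂ) / z‖ = 1 := by
      rw [norm_div, hzn]; simp [abs_of_pos hr, hr.ne']
    have h1 := hq _ hk
    have h2 := hre z (by simp [hzn, hr1])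
    have h3 : (∑ m ∈ Finset.range N, β m * ((r:ℂ) / z) ^ (m + 1)) = b z := rfl
    rw [h3] at h1
    simp only [Function.comp_apply, Complex.reCLM_apply, hconj z hz, Complex.add_re, Complex.mul_re,
      Complex.conj_re, Complex.conj_im, Complex.ofReal_re, Complex.ofReal_im]
    nlinarith

lemma herglotz {P : ℂ → ℂ} (hP : DifferentiableOn ℂ P (Metric.ball 0 1))
    (hre : ∀ z ∈ Metric.ball (0:ℂ) 1, 0 ≤ (P z).re) (h0 : P 0 = 1) (N : ℕ) (α : ℝ) (β : ℕ → ℂ)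
    (hq : ∀ κ : ℂ, ‖κ‖ = 1 → α + 2 * (∑ m ∈ Finset.range N, β m * κ ^ (m + 1)).re ≤ 0) :
    α + (∑ m ∈ Finset.range N, β m * cf (m + 1) P).re ≤ 0 := by
  have hc : Continuous fun r : ℝ =>
      α + (∑ m ∈ Finset.range N, β m * ((r:ℂ) ^ (m + 1) * cf (m + 1) P)).re := by fun_prop
  have ht : Filter.Tendsto (fun r : ℝ =>
      α + (∑ m ∈ Finset.range N, β m * ((r:ℂ) ^ (m + 1) * cf (m + 1) P)).re) (nhdsWithin 1 (Set.Iio 1))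
      (nhds (α + (∑ m ∈ Finset.range N, β m * cf (m + 1) P).re)) := by
    have := (hc.tendsto 1).mono_left (nhdsWithin_le_nhds (s := Set.Iio 1))
    simpa using this
  refine le_of_tendsto ht ?_
  filter_upwards [Ioo_mem_nhdsLT (show (0:ℝ) < 1 by norm_num)] with r hr
  exact herglotz_r hP hre h0 N α β hq hr.1 hr.2

lemma Wb_lin (N : ℕ) (la ta : ℕ → ℝ) (d : ℕ → ℂ) :
    ∃ (α : ℝ) (β : ℕ → ℂ), ∀ P : ℕ → ℂ, P 0 = 1 →
      Wb N la ta d P = α + (∑ m ∈ Finset.range N, β m * P (m + 1)).re := by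
  set w : ℕ → ℂ := fun i => starRingEnd ℂ (d (i + 1)) * (ta (i + 1) : ℂ) with hw
  refine ⟨∑ i ∈ Finset.range N, (‖d (i + 1)‖ ^ 2 - 4) * la (i + 1)
    - 2 * (∑ i ∈ Finset.range N, w i * d (i + 1)).re,
    fun m => -2 * ∑ i ∈ Finset.range N, if m ≤ i then w i * d (i - m) else 0, ?_⟩
  intro P hP
  unfold Wb
  have e1 : ∑ i ∈ Finset.range N, w i * ∑ m ∈ Finset.range (i + 2), P m * d (i + 1 - m) =
     ∑ i ∈ Finset.range N, w i * d (i + 1) + ∑ m ∈ Finset.range N,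
      (∑ i ∈ Finset.range N, if m ≤ i then w i * d (i - m) else 0) * P (m + 1) := by
    simp only [Finset.sum_mul]
    rw [Finset.sum_comm (s := Finset.range N) (t := Finset.range N), ← Finset.sum_add_distrib]
    apply Finset.sum_congr rfl
    intro i hi
    rw [Finset.sum_range_succ', hP]
    have : ∑ m ∈ Finset.range N, (if m ≤ i then w i * d (i - m) else 0) * P (m + 1) =
      ∑ m ∈ Finset.range (i + 1), w i * d (i - m) * P (m + 1) := by
      have hsub : Finset.range (i + 1) ⊆ Finset.range N := by
        intro x hx; simp at *; omega
      rw [← Finset.sum_subset hsub]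
      · apply Finset.sum_congr rfl
        intro m hm
        rw [if_pos (by simpa [Nat.lt_succ_iff] using hm)]
      · intro x _ hx
        rw [if_neg (by simpa [Nat.lt_succ_iff] using hx)]; simp
    rw [this, mul_add, Finset.mul_sum, add_comm]
    congr 1
    · simp
    · apply Finset.sum_congr rfl
      intro m _
      rw [show i + 1 - (m + 1) = i - m by omega]
      ring
  simp only [hw] at e1 ⊢
  rw [e1]
  have e2 : ∀ x : ℕ → ℂ, ∑ m ∈ Finset.range N, (-2 * x m) * P (m + 1) =
     -2 * ∑ m ∈ Finset.range N, x m * P (m + 1) := by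
    intro x; rw [Finset.mul_sum]; apply Finset.sum_congr rfl; intro m _; ring
  rw [e2]
  simp only [Complex.add_re, Complex.mul_re, Complex.neg_re, Complex.neg_im, Complex.re_ofNat,
    Complex.im_ofNat]
  ring

lemma Wb_P (N : ℕ) (la ta : ℕ → ℝ) (d : ℕ → ℂ) (hd : d 0 = 1)
    (h : ∀ k, ta k - ta (k + 1) = la k + la (k + 1)) (h1 : ta (N + 1) = 0) (h2 : la (N + 1) = 0)
    (hla : ∀ k, 0 ≤ la k) {P : ℂ → ℂ} (hP : DifferentiableOn ℂ P (Metric.ball 0 1))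
    (hre : ∀ z ∈ Metric.ball (0:ℂ) 1, 0 ≤ (P z).re) (h0 : P 0 = 1) :
    Wb N la ta d (fun m => cf m P) ≤ 0 := by
  obtain ⟨α, β, hab⟩ := Wb_lin N la ta d
  rw [hab _ (by simp [cf_zero, h0])]
  apply herglotz hP hre h0
  intro κ hκ
  have := Wb_kappa N la ta d hd h h1 h2 hla κ hκ
  rw [hab _ (by simp)] at this
  convert this using 2
  have e : ∑ m ∈ Finset.range N, β m * (if m + 1 = 0 then (1:ℂ) else 2 * κ ^ (m + 1)) =
    2 * ∑ m ∈ Finset.range N, β m * κ ^ (m + 1) := by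
    rw [Finset.mul_sum]; apply Finset.sum_congr rfl; intro m _; simp; ring
  rw [e]; simp

end DB
end

section
open Polynomial

namespace DB

lemma harnack {p : ℂ → ℂ} (hp : DifferentiableOn ℂ p (Metric.ball 0 1))
    (hre : ∀ z ∈ Metric.ball (0:ℂ) 1, 0 ≤ (p z).re) {t : ℝ} (ht : 0 < t) (h0 : p 0 = t)
    {z : ℂ} (hz : ‖z‖ < 1) : ‖p z‖ ≤ t * ((1 + ‖z‖) / (1 - ‖z‖)) := by
  have hne : ∀ z ∈ Metric.ball (0:ℂ) 1, p z + t ≠ 0 := by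
    intro z hz h
    have := congrArg Complex.re h
    simp at this
    linarith [hre z hz]
  have hq : DifferentiableOn ℂ (fun z => (p z - t) / (p z + t)) (Metric.ball 0 1) :=
    (hp.sub_const _).div (hp.add_const _) hne
  have hm : Set.MapsTo (fun z => (p z - t) / (p z + t)) (Metric.ball 0 1) (Metric.closedBall 0 1) := by
    intro w hw
    simp only [mem_closedBall_zero_iff, norm_div]
    rw [div_le_one (norm_pos_iff.2 (hne w hw))]
    rw [← sq_le_sq₀ (norm_nonneg _) (norm_nonneg _), ← Complex.normSq_eq_norm_sq,
      ← Complex.normSq_eq_norm_sq, Complex.normSq_apply, Complex.normSq_apply]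
    simp
    nlinarith [hre w hw]
  have key := Complex.norm_le_norm_of_mapsTo_ball hq hm (by simp [h0]) hz
  have hz' : z ∈ Metric.ball (0:ℂ) 1 := by simpa using hz
  rw [norm_div, div_le_iff₀ (norm_pos_iff.2 (hne z hz'))] at key
  have h1 : ‖p z‖ - t ≤ ‖p z - t‖ := by
    have := norm_sub_norm_le (p z) (t:ℂ)
    simpa [abs_of_pos ht] using this
  have h2 : ‖p z + t‖ ≤ ‖p z‖ + t := by
    have := norm_add_le (p z) (t:ℂ)
    simpa [abs_of_pos ht] using this
  have h3 : ‖p z‖ - t ≤ ‖z‖ * (‖p z‖ + t) := by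
    nlinarith [norm_nonneg z]
  rw [← mul_div_assoc, le_div_iff₀ (by linarith)]
  nlinarith

lemma taylor2 {G : ℂ → ℂ} {R B : ℝ} (hR : 0 < R) (hG : DifferentiableOn ℂ G (Metric.ball 0 R))
    (hB : ∀ z ∈ Metric.ball (0:ℂ) R, ‖G z‖ ≤ B) {x : ℂ} (hx : ‖x‖ < R) :
    ‖G x - G 0 - x * deriv G 0‖ ≤ 4 * B * (‖x‖ / R) ^ 2 := by
  have h0 : (0:ℂ) ∈ Metric.ball (0:ℂ) R := by simpa using hR
  have hB0 : 0 ≤ B := (norm_nonneg _).trans (hB 0 h0)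
  have hd : DifferentiableAt ℂ G 0 := hG.differentiableAt (Metric.ball_mem_nhds 0 hR)
  have hder : ‖deriv G 0‖ ≤ 2 * B / R := by
    apply Complex.norm_deriv_le_div_of_mapsTo_ball hG _ hR
    intro w hw
    rw [mem_closedBall_iff_norm]
    have := norm_sub_le (G w) (G 0)
    linarith [hB w hw, hB 0 h0]
  have hH : DifferentiableOn ℂ (fun z => G z - z * deriv G 0) (Metric.ball 0 R) := by fun_prop
  have key := Complex.dist_le_mul_div_pow_of_mapsTo_ball_of_isLittleO (n := 1) (c := 0) (z := x)
    (R₂ := 4 * B) hH ?_ ?_ (by simpa using hx)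
  · simp only [dist_eq_norm, zero_mul, sub_zero] at key
    rw [show G x - G 0 - x * deriv G 0 = G x - x * deriv G 0 - G 0 by ring]
    exact key
  · intro w hw
    rw [mem_closedBall_iff_norm]
    have h1 : ‖w * deriv G 0‖ ≤ 2 * B := by
      rw [norm_mul]
      have hw' : ‖w‖ ≤ R := by simpa using (Metric.mem_ball.1 hw).le
      calc _ ≤ R * (2 * B / R) := by gcongr
        _ = _ := by field_simp
    calc _ = ‖(G w - G 0) - w * deriv G 0‖ := by congr 1; simp; ring
      _ ≤ ‖G w - G 0‖ + ‖w * deriv G 0‖ := norm_sub_le _ _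
      _ ≤ (‖G w‖ + ‖G 0‖) + ‖w * deriv G 0‖ := by gcongr; exact norm_sub_le _ _
      _ ≤ _ := by linarith [hB w hw, hB 0 h0]
  · have h1 := hd.hasDerivAt.isLittleO
    simp only [sub_zero, pow_one] at h1 ⊢
    have h2 : (fun x : ℂ => G x - G 0 - x • deriv G 0) =o[nhds 0] fun x => ‖x‖ := h1.norm_right
    refine h2.congr_left ?_
    intro x; simp; ring

noncomputable def TT (N k : ℕ) (σ : ℝ) : ℝ := (tau N k).eval (Real.exp (-σ))
noncomputable def La (N k : ℕ) (σ : ℝ) : ℝ := (e (N + 1) k).eval (Real.exp (-σ))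

lemma TT_deriv (N k : ℕ) (σ : ℝ) : HasDerivAt (TT N k) (-(k * La N k σ)) σ := by
  have h1 : HasDerivAt (fun σ : ℝ => Real.exp (-σ)) (- Real.exp (-σ)) σ := by
    have := (hasDerivAt_neg σ).exp
    simpa using this
  have h2 := ((tau N k).hasDerivAt (Real.exp (-σ))).comp σ h1
  have := congrArg (eval (Real.exp (-σ))) (tau_deriv N k)
  simp at this
  have h3 : -(k * La N k σ) = eval (Real.exp (-σ)) (derivative (tau N k)) * - Real.exp (-σ) := by
    unfold La
    rw [← this]; ring
  rw [h3]
  exact h2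

lemma TT_taylor (N k : ℕ) : ∃ C : ℝ, 0 ≤ C ∧ ∀ σ t : ℝ, 0 ≤ σ → 0 ≤ t →
    |TT N k σ - TT N k (σ + t) - t * (k * La N k (σ + t))| ≤ C * t ^ 2 := by
  obtain ⟨C1, hC1⟩ := (isCompact_Icc (a := (0:ℝ)) (b := 1)).exists_bound_of_continuousOn
    (f := fun s => (derivative (e (N + 1) k)).eval s) (by fun_prop)
  have hC10 : 0 ≤ C1 := (norm_nonneg _).trans (hC1 0 (by simp))
  have hLd : ∀ σ : ℝ, HasDerivAt (La N k)
      ((derivative (e (N + 1) k)).eval (Real.exp (-σ)) * (- Real.exp (-σ))) σ := by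
    intro σ
    have h1 : HasDerivAt (fun σ : ℝ => Real.exp (-σ)) (- Real.exp (-σ)) σ := by
      have := (hasDerivAt_neg σ).exp
      simpa using this
    exact ((e (N + 1) k).hasDerivAt (Real.exp (-σ))).comp σ h1
  have hLip : ∀ x y : ℝ, 0 ≤ x → 0 ≤ y → |La N k y - La N k x| ≤ C1 * |y - x| := by
    intro x y hx hy
    have := (convex_Ici (0:ℝ)).norm_image_sub_le_of_norm_hasDerivWithin_le (C := C1)
      (fun σ _ => (hLd σ).hasDerivWithinAt) ?_ hx hy
    · simpa using this
    · intro σ hσ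
      have h1 : Real.exp (-σ) ≤ 1 := by simpa using hσ
      have h2 := hC1 (Real.exp (-σ)) ⟨(Real.exp_pos _).le, h1⟩
      rw [norm_mul, norm_neg, Real.norm_of_nonneg (Real.exp_pos _).le]
      have := Real.exp_pos (-σ)
      calc _ ≤ C1 * 1 := by gcongr
        _ = _ := mul_one _
  refine ⟨k * C1, by positivity, ?_⟩
  intro σ t hσ ht
  have hg : ∀ x ∈ Set.Icc σ (σ + t), HasDerivWithinAt (fun x => TT N k x + x * (k * La N k (σ + t)))
      (-(k * La N k x) + k * La N k (σ + t)) (Set.Icc σ (σ + t)) x := by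
    intro x _
    have := (TT_deriv N k x).add ((hasDerivAt_id x).mul_const (k * La N k (σ + t)))
    rw [one_mul] at this
    exact this.hasDerivWithinAt
  have := (convex_Icc σ (σ + t)).norm_image_sub_le_of_norm_hasDerivWithin_le (C := k * C1 * t) hg ?_
    (x := σ + t) (y := σ) (by simp [ht]) (by simp [ht])
  · simp only [Real.norm_eq_abs] at this
    calc _ = |TT N k σ + σ * (k * La N k (σ + t)) - (TT N k (σ + t) + (σ + t) * (k * La N k (σ + t)))| := by
            congr 1; ring
      _ ≤ _ := this
      _ = _ := by rw [show σ - (σ + t) = -t by ring, abs_neg, abs_of_nonneg ht]; ring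
  · intro x hx
    have h1 := hLip x (σ + t) (hσ.trans hx.1) (by linarith)
    have h2 : |σ + t - x| ≤ t := by
      rw [abs_of_nonneg (by linarith [hx.2])]; linarith [hx.1]
    have h3 : -(k * La N k x) + k * La N k (σ + t) = k * (La N k (σ + t) - La N k x) := by ring
    rw [h3, Real.norm_eq_abs, abs_mul, Nat.abs_cast, mul_assoc]
    gcongr
    exact h1.trans (by gcongr)

lemma TT_nonneg (N k : ℕ) {σ : ℝ} (hσ : 0 ≤ σ) : 0 ≤ TT N k σ :=
  tau_nonneg N k _ (Real.exp_pos _).le (by simpa using hσ)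

lemma La_nonneg (N k : ℕ) {σ : ℝ} (hσ : 0 ≤ σ) : 0 ≤ La N k σ :=
  e_nonneg (N + 1) _ (Real.exp_pos _).le (by simpa using hσ) _

lemma TT_La_bdd (N k : ℕ) : ∃ C : ℝ, 0 ≤ C ∧ ∀ σ : ℝ, 0 ≤ σ → TT N k σ ≤ C ∧ La N k σ ≤ C := by
  obtain ⟨C1, hC1⟩ := (isCompact_Icc (a := (0:ℝ)) (b := 1)).exists_bound_of_continuousOn
    (f := fun s => (tau N k).eval s) (by fun_prop)
  obtain ⟨C2, hC2⟩ := (isCompact_Icc (a := (0:ℝ)) (b := 1)).exists_bound_of_continuousOn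
    (f := fun s => (e (N + 1) k).eval s) (by fun_prop)
  have hC10 : 0 ≤ C1 := (norm_nonneg _).trans (hC1 0 (by simp))
  refine ⟨max C1 C2, le_max_of_le_left hC10, fun σ hσ => ?_⟩
  have h1 : Real.exp (-σ) ∈ Set.Icc (0:ℝ) 1 := ⟨(Real.exp_pos _).le, by simpa using hσ⟩
  exact ⟨(le_abs_self _).trans ((hC1 _ h1).trans (le_max_left _ _)),
    (le_abs_self _).trans ((hC2 _ h1).trans (le_max_right _ _))⟩

noncomputable def Phi (N : ℕ) (σ : ℝ) (c : ℕ → ℂ) : ℝ :=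
  ∑ i ∈ Finset.range N, (((i:ℝ) + 1) * ‖c (i + 1)‖ ^ 2 - 4 / (i + 1)) * TT N (i + 1) σ

end DB
end

section
open Polynomial

namespace DB

/-- coefficients of one plus z times the derivative of L -/
noncomputable def dd (L : ℂ → ℂ) (k : ℕ) : ℂ := if k = 0 then 1 else k * cf k L

lemma step_R {L p : ℂ → ℂ} {B t : ℝ} (hL : DifferentiableOn ℂ L (Metric.ball 0 1))
    (hB : ∀ z ∈ Metric.ball (0:ℂ) (3/4), ‖L z‖ ≤ B)
    (hp : DifferentiableOn ℂ p (Metric.ball 0 1))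
    (hre : ∀ z ∈ Metric.ball (0:ℂ) 1, 0 ≤ (p z).re) (ht : 0 < t) (ht1 : t ≤ 1/24) (h0 : p 0 = t)
    {z : ℂ} (hz : ‖z‖ = 1/2) :
    ‖L (z * Complex.exp (- p z)) - L z + z * deriv L z * p z‖ ≤ 576 * B * t ^ 2 := by
  have hpz : ‖p z‖ ≤ 3 * t := by
    have := harnack hp hre ht h0 (z := z) (by rw [hz]; norm_num)
    rw [hz] at this
    norm_num at this; linarith
  have hin : ∀ x ∈ Metric.ball (0:ℂ) (1/4), z * Complex.exp (-x) ∈ Metric.ball (0:ℂ) (3/4) := by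
    intro x hx
    have hx' : ‖x‖ < 1/4 := by simpa using hx
    rw [mem_ball_zero_iff, norm_mul, hz, Complex.norm_exp]
    have h1 : (-x).re ≤ 1/4 := by
      have := Complex.re_le_norm (-x); rw [norm_neg] at this; linarith
    have h2 : Real.exp ((-x).re) ≤ Real.exp (1/4) := Real.exp_le_exp.2 h1
    have h3 : Real.exp (1/4) ≤ 4/3 := by
      have h4 := Real.add_one_le_exp (-(1/4:ℝ))
      have h5 : Real.exp (1/4) * Real.exp (-(1/4)) = 1 := by rw [← Real.exp_add]; simp
      nlinarith [Real.exp_pos (1/4:ℝ)]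
    linarith
  have hG : DifferentiableOn ℂ (fun x => L (z * Complex.exp (-x))) (Metric.ball 0 (1/4)) := by
    apply (hL.mono (Metric.ball_subset_ball (by norm_num : (3/4:ℝ) ≤ 1))).comp _ hin
    fun_prop
  have hzb : z ∈ Metric.ball (0:ℂ) 1 := by simp [hz]; norm_num
  have hLz : HasDerivAt L (deriv L z) (z * Complex.exp (-0)) := by
    simpa using (hL.differentiableAt (Metric.isOpen_ball.mem_nhds hzb)).hasDerivAt
  have hG' : deriv (fun x => L (z * Complex.exp (-x))) 0 = - (z * deriv L z) := by
    have h1 : HasDerivAt (fun x : ℂ => z * Complex.exp (-x)) (z * (Complex.exp (-0) * (-1))) 0 :=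
      ((hasDerivAt_neg (0:ℂ)).cexp).const_mul z
    have h2 := (HasDerivAt.comp (0:ℂ) hLz h1).deriv
    rw [show (fun x => L (z * Complex.exp (-x))) = L ∘ (fun x : ℂ => z * Complex.exp (-x)) from rfl, h2]
    simp; ring
  have key := taylor2 (by norm_num) hG (fun x hx => hB _ (hin x hx)) (x := p z)
    (lt_of_le_of_lt hpz (by linarith))
  rw [hG'] at key
  simp only [neg_zero, Complex.exp_zero, mul_one] at key
  have hB0 : 0 ≤ B := (norm_nonneg _).trans (hB 0 (by simp))
  calc _ = ‖L (z * Complex.exp (-p z)) - L z - p z * -(z * deriv L z)‖ := by congr 1; ring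
    _ ≤ _ := key
    _ ≤ 4 * B * (3 * t / (1/4)) ^ 2 := by gcongr
    _ = _ := by ring

lemma phi_maps {p : ℂ → ℂ} (hre : ∀ z ∈ Metric.ball (0:ℂ) 1, 0 ≤ (p z).re) :
    Set.MapsTo (fun z => z * Complex.exp (- p z)) (Metric.ball 0 1) (Metric.ball 0 1) := by
  intro z hz
  have hz' : ‖z‖ < 1 := by simpa using hz
  rw [mem_ball_zero_iff, norm_mul, Complex.norm_exp]
  have : Real.exp ((-p z).re) ≤ 1 := by
    apply Real.exp_le_one_iff.2; simpa using hre z hz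
  nlinarith [norm_nonneg z, Real.exp_pos (-p z).re]

lemma cf_dd {L : ℂ → ℂ} (hL : AnalyticAt ℂ L 0) (k : ℕ) :
    cf k (fun z => 1 + z * deriv L z) = dd L k := by
  have h1 : AnalyticAt ℂ (fun z => z * deriv L z) 0 := analyticAt_id.mul hL.deriv
  rw [cf_add analyticAt_const h1, cf_const, dd]
  rcases k with _ | k
  · simp [cf_zero]
  · rw [cf_id_mul hL.deriv, cf_deriv]; simp

lemma step_coeff {L p : ℂ → ℂ} {B t : ℝ} (hL : DifferentiableOn ℂ L (Metric.ball 0 1))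
    (hB : ∀ z ∈ Metric.ball (0:ℂ) (3/4), ‖L z‖ ≤ B)
    (hp : DifferentiableOn ℂ p (Metric.ball 0 1))
    (hre : ∀ z ∈ Metric.ball (0:ℂ) 1, 0 ≤ (p z).re) (ht : 0 < t) (ht1 : t ≤ 1/24) (h0 : p 0 = t)
    (k : ℕ) :
    ‖cf (k + 1) (fun z => L (z * Complex.exp (- p z)) + t - p z) - (cf (k + 1) L -
      t * ∑ m ∈ Finset.range (k + 2), cf m (fun z => p z / t) * dd L (k + 1 - m))‖
        ≤ 576 * B * t ^ 2 / (1/2) ^ (k + 1) := by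
  set R : ℂ → ℂ := fun z => L (z * Complex.exp (- p z)) - L z + z * deriv L z * p z with hR
  have hLd : DifferentiableOn ℂ (deriv L) (Metric.ball 0 1) := hL.deriv Metric.isOpen_ball
  have hLp : DifferentiableOn ℂ (fun z => L (z * Complex.exp (- p z))) (Metric.ball 0 1) := by
    apply hL.comp (by fun_prop) (phi_maps hre)
  have hRd : DifferentiableOn ℂ R (Metric.ball 0 1) := by
    exact (hLp.sub hL).add ((differentiableOn_id.mul hLd).mul hp)
  have hbd := cf_bound' (r := 1/2) (B := 576 * B * t ^ 2) (by norm_num) hRd (by norm_num)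
    (fun z hz => step_R hL hB hp hre ht ht1 h0 (by simpa using hz)) (k + 1)
  convert hbd using 2
  have aL := an_of_diff one_pos hL
  have ap := an_of_diff one_pos hp
  have aR := an_of_diff one_pos hRd
  have ht' : (t:ℂ) ≠ 0 := by exact_mod_cast ht.ne'
  have aP : AnalyticAt ℂ (fun z => p z / t) 0 := ap.div_const
  have ad : AnalyticAt ℂ (fun z => 1 + z * deriv L z) 0 :=
    analyticAt_const.add (analyticAt_id.mul aL.deriv)
  have e1 : (fun z => L (z * Complex.exp (- p z)) + t - p z) =
      fun z => (L z - t * ((p z / t) * (1 + z * deriv L z))) + (R z + t) := by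
    ext z; simp only [hR]; field_simp; ring
  have am : AnalyticAt ℂ (fun z => (p z / t) * (1 + z * deriv L z)) 0 := aP.mul ad
  have am' : AnalyticAt ℂ (fun z => (t:ℂ) * ((p z / t) * (1 + z * deriv L z))) 0 :=
    analyticAt_const.mul am
  rw [e1, cf_add (F := fun z => L z - t * ((p z / t) * (1 + z * deriv L z))) (G := fun z => R z + t)
    (aL.sub am') (aR.add analyticAt_const), cf_sub aL am', cf_const_mul am,
    cf_mul aP ad, cf_add (G := fun _ => (t:ℂ)) aR analyticAt_const, cf_const]
  simp only [cf_dd aL]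
  simp

lemma term_bound {c v c' : ℂ} {t M k T T' l K Q : ℝ} (ht : 0 < t) (ht1 : t ≤ 1) (hk1 : 1 ≤ k) (hkQ : k ≤ Q)
    (hc : ‖c‖ ≤ M) (hv : ‖v‖ ≤ M) (hc' : ‖c' - (c - t * v)‖ ≤ M * t ^ 2)
    (hT0 : 0 ≤ T) (hTK : T ≤ K) (hl0 : 0 ≤ l) (hlK : l ≤ Q * K)
    (hE : |T - T' - t * l| ≤ K * t ^ 2) :
    (k * ‖c'‖ ^ 2 - 4 / k) * T ≤ (k * ‖c‖ ^ 2 - 4 / k) * T' +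
      t * ((k * ‖c‖ ^ 2 - 4 / k) * l - 2 * (k * (starRingEnd ℂ c * v).re) * T') +
      ((Q * M ^ 2 + 4) * K + 2 * (Q * M ^ 2) * (Q * K) + 2 * (Q * M ^ 2) * K + 6 * Q * M ^ 2 * K) * t ^ 2 := by
  have hM : 0 ≤ M := (norm_nonneg _).trans hc
  have hK : 0 ≤ K := hT0.trans hTK
  have hQ : 0 ≤ Q := by linarith
  set y := (starRingEnd ℂ c * v).re with hy
  have hyb : |y| ≤ M ^ 2 := by
    calc |y| ≤ ‖starRingEnd ℂ c * v‖ := Complex.abs_re_le_norm _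
      _ = ‖c‖ * ‖v‖ := by simp
      _ ≤ M * M := by gcongr
      _ = _ := by ring
  have h1 : ‖c - t * v‖ ^ 2 = ‖c‖ ^ 2 - 2 * t * y + t ^ 2 * ‖v‖ ^ 2 := by
    rw [hy]
    simp only [← Complex.normSq_eq_norm_sq, Complex.normSq_apply, Complex.mul_re, Complex.mul_im,
      Complex.conj_re, Complex.conj_im, Complex.sub_re,
      Complex.sub_im, Complex.ofReal_re, Complex.ofReal_im]
    ring
  have h2 : ‖c - t * v‖ ≤ 2 * M := by
    calc _ ≤ ‖c‖ + ‖(t:ℂ) * v‖ := norm_sub_le _ _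
      _ = ‖c‖ + t * ‖v‖ := by rw [norm_mul]; simp [abs_of_pos ht]
      _ ≤ M + 1 * M := by gcongr
      _ = _ := by ring
  have h3 : ‖c'‖ ≤ ‖c - t * v‖ + M * t ^ 2 := by
    calc ‖c'‖ = ‖(c - t * v) + (c' - (c - t * v))‖ := by congr 1; ring
      _ ≤ _ := norm_add_le _ _
      _ ≤ _ := by gcongr
  have ht2 : t ^ 2 ≤ 1 := by nlinarith
  have h4 : ‖c'‖ ^ 2 ≤ ‖c‖ ^ 2 - 2 * t * y + 6 * M ^ 2 * t ^ 2 := by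
    have a1 : ‖c'‖ ^ 2 ≤ (‖c - t * v‖ + M * t ^ 2) ^ 2 := by gcongr
    have a2 : (‖c - t * v‖ + M * t ^ 2) ^ 2 = ‖c - t * v‖ ^ 2 + 2 * ‖c - t * v‖ * (M * t ^ 2)
       + M ^ 2 * t ^ 2 * t ^ 2 := by ring
    have a3 : 2 * ‖c - t * v‖ * (M * t ^ 2) ≤ 2 * (2 * M) * (M * t ^ 2) := by gcongr
    have a4 : M ^ 2 * t ^ 2 * t ^ 2 ≤ M ^ 2 * t ^ 2 * 1 := by gcongr
    have a5 : t ^ 2 * ‖v‖ ^ 2 ≤ t ^ 2 * M ^ 2 := by gcongr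
    rw [h1] at a2
    nlinarith
  set X := k * ‖c‖ ^ 2 - 4 / k with hX
  have hXb : |X| ≤ Q * M ^ 2 + 4 := by
    have b1 : 0 ≤ k * ‖c‖ ^ 2 := by positivity
    have b2 : k * ‖c‖ ^ 2 ≤ Q * M ^ 2 := by gcongr
    have b3 : 0 ≤ 4 / k := by positivity
    have b4 : 4 / k ≤ 4 := by rw [div_le_iff₀ (by linarith)]; linarith
    rw [abs_le]; constructor <;> nlinarith
  have h5 : (k * ‖c'‖ ^ 2 - 4 / k) ≤ X - 2 * t * (k * y) + 6 * Q * M ^ 2 * t ^ 2 := by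
    have b1 : k * ‖c'‖ ^ 2 ≤ k * (‖c‖ ^ 2 - 2 * t * y + 6 * M ^ 2 * t ^ 2) := by gcongr
    have b2 : k * (6 * M ^ 2 * t ^ 2) ≤ Q * (6 * M ^ 2 * t ^ 2) := by gcongr
    rw [hX]; nlinarith
  set E := T - T' - t * l with hEd
  have h6 : (k * ‖c'‖ ^ 2 - 4 / k) * T ≤ (X - 2 * t * (k * y) + 6 * Q * M ^ 2 * t ^ 2) * T := by gcongr
  have hyk : |k * y| ≤ Q * M ^ 2 := by
    rw [abs_mul, abs_of_nonneg (by linarith : 0 ≤ k)]; gcongr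
  have g1 : X * E ≤ (Q * M ^ 2 + 4) * (K * t ^ 2) := by
    calc X * E ≤ |X * E| := le_abs_self _
      _ = |X| * |E| := abs_mul _ _
      _ ≤ _ := by gcongr
  have g2 : -(2 * t ^ 2 * (k * y) * l) ≤ 2 * t ^ 2 * (Q * M ^ 2) * (Q * K) := by
    calc _ ≤ 2 * t ^ 2 * |k * y| * l := by
            have := neg_abs_le (k * y)
            have : 0 ≤ 2 * t ^ 2 * l := by positivity
            nlinarith
      _ ≤ _ := by gcongr
  have g3 : -(2 * t * (k * y) * E) ≤ 2 * 1 * (Q * M ^ 2) * (K * t ^ 2) := by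
    calc _ ≤ |-(2 * t * (k * y) * E)| := le_abs_self _
      _ = 2 * t * |k * y| * |E| := by
        rw [abs_neg, abs_mul, abs_mul (2 * t), abs_of_nonneg (by positivity : 0 ≤ 2 * t)]
      _ ≤ _ := by gcongr
  have g4 : 6 * Q * M ^ 2 * t ^ 2 * T ≤ 6 * Q * M ^ 2 * t ^ 2 * K := by gcongr
  have hTe : T = T' + t * l + E := by rw [hEd]; ring
  have h7 : (X - 2 * t * (k * y) + 6 * Q * M ^ 2 * t ^ 2) * T =
     X * T' + t * (X * l - 2 * (k * y) * T') + X * E + -(2 * t ^ 2 * (k * y) * l)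
       + -(2 * t * (k * y) * E) + 6 * Q * M ^ 2 * t ^ 2 * T := by
    have : (X - 2 * t * (k * y)) * T = (X - 2 * t * (k * y)) * (T' + t * l + E) := by rw [← hTe]
    linear_combination this
  rw [h7] at h6
  linarith

theorem one_step (N : ℕ) (B : ℝ) : ∃ C : ℝ, 0 ≤ C ∧ ∀ (L p : ℂ → ℂ) (t σ : ℝ),
    DifferentiableOn ℂ L (Metric.ball 0 1) → (∀ z ∈ Metric.ball (0:ℂ) (3/4), ‖L z‖ ≤ B) →
    DifferentiableOn ℂ p (Metric.ball 0 1) → (∀ z ∈ Metric.ball (0:ℂ) 1, 0 ≤ (p z).re) →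
    0 < t → t ≤ 1/24 → p 0 = t → 0 ≤ σ →
    Phi N σ (fun k => cf k (fun z => L (z * Complex.exp (- p z)) + t - p z)) ≤
      Phi N (σ + t) (fun k => cf k L) + C * t ^ 2 := by
  by_cases hB0 : 0 ≤ B
  swap
  · refine ⟨0, le_rfl, ?_⟩
    intro L p t σ _ hB
    exact absurd ((norm_nonneg _).trans (hB 0 (by simp))) hB0
  choose K1 hK10 hK1 using TT_taylor N
  choose K2 hK20 hK2 using TT_La_bdd N
  set K := ∑ i ∈ Finset.range N, (K1 (i + 1) + K2 (i + 1)) with hK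
  set M := 600 * (B + 1) * 4 ^ N * ((N:ℝ) + 1) ^ 2 with hM
  set Q := (N:ℝ) with hQ
  set C0 := ((Q * M ^ 2 + 4) * K + 2 * (Q * M ^ 2) * (Q * K) + 2 * (Q * M ^ 2) * K + 6 * Q * M ^ 2 * K) with hC0
  have hK0 : 0 ≤ K := Finset.sum_nonneg fun i _ => add_nonneg (hK10 _) (hK20 _)
  refine ⟨N * C0, by positivity, ?_⟩
  intro L p t σ hL hB hp hre ht ht1 h0 hσ
  have ht' : (t:ℂ) ≠ 0 := by exact_mod_cast ht.ne'
  have hPd : DifferentiableOn ℂ (fun z => p z / t) (Metric.ball 0 1) := by fun_prop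
  set v : ℕ → ℂ := fun i => ∑ m ∈ Finset.range (i + 2), cf m (fun z => p z / t) * dd L (i + 1 - m) with hv
  have hW : Wb N (fun k => La N k (σ + t)) (fun k => TT N k (σ + t)) (dd L)
      (fun m => cf m (fun z => p z / t)) ≤ 0 := by
    apply Wb_P
    · simp [dd]
    · intro k
      have := congrArg (eval (Real.exp (-(σ + t)))) (tau_sub N k)
      simpa [TT, La] using this
    · simp [TT, tau_top N (N + 1) (by omega)]
    · simp only [La]
      rw [e_zero (N + 1) _ (le_abs_self _)]; simp
    · intro k; exact La_nonneg N k (by linarith)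
    · exact hPd
    · intro z hz
      rw [Complex.div_ofReal_re]
      exact div_nonneg (hre z hz) ht.le
    · simp [h0, ht']
  have hcL : ∀ k ≤ N, ‖cf k L‖ ≤ B * 2 ^ N := by
    intro k hk
    have := cf_bound' (r := 1/2) (B := B) (by norm_num) hL (by norm_num)
      (fun z hz => hB z (by
        have : ‖z‖ = 1/2 := by simpa using hz
        simp [this]; norm_num)) k
    refine this.trans ?_
    rw [one_div, inv_pow, div_inv_eq_mul]
    gcongr
    norm_num
  have hcP : ∀ k ≤ N, ‖cf k (fun z => p z / t)‖ ≤ 3 * 2 ^ N := by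
    intro k hk
    have := cf_bound' (r := 1/2) (B := 3) (by norm_num) hPd (by norm_num)
      (fun z hz => by
        have hz' : ‖z‖ = 1/2 := by simpa using hz
        have := harnack hp hre ht h0 (z := z) (by rw [hz']; norm_num)
        rw [hz'] at this
        norm_num at this
        rw [norm_div, Complex.norm_real, Real.norm_of_nonneg ht.le, div_le_iff₀ ht]; linarith) k
    refine this.trans ?_
    rw [one_div, inv_pow, div_inv_eq_mul]
    gcongr
    norm_num
  have hdd : ∀ k ≤ N, ‖dd L k‖ ≤ (N + 1) * ((B + 1) * 2 ^ N) := by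
    intro k hk
    have h2 : (1:ℝ) ≤ 2 ^ N := one_le_pow₀ (by norm_num)
    unfold dd
    split_ifs with h
    · simp only [norm_one]
      have : (1:ℝ) ≤ (B + 1) * 2 ^ N := by nlinarith
      have : (0:ℝ) ≤ N := by positivity
      nlinarith
    · rw [norm_mul, Complex.norm_natCast]
      have hkN : (k:ℝ) ≤ N := by exact_mod_cast hk
      calc (k:ℝ) * ‖cf k L‖ ≤ (N + 1) * (B * 2 ^ N) := by
            gcongr
            · linarith
            · exact hcL k hk
        _ ≤ _ := by gcongr; linarith
  have h2N : (2:ℝ) ^ N * 2 ^ N = 4 ^ N := by rw [← mul_pow]; norm_num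
  have h2N1 : (1:ℝ) ≤ 2 ^ N := one_le_pow₀ (by norm_num)
  have h24 : (2:ℝ) ^ N ≤ 4 ^ N := by nlinarith
  have hN1 : (1:ℝ) ≤ ((N:ℝ) + 1) ^ 2 := by
    have : (0:ℝ) ≤ N := by positivity
    nlinarith
  have hM0 : 0 ≤ M := by positivity
  have hMb : ∀ x : ℝ, x ≤ 576 * (B * 2 ^ N) → x ≤ M := by
    intro x hx
    calc x ≤ 576 * (B * 2 ^ N) := hx
      _ ≤ 600 * ((B + 1) * 4 ^ N) := by gcongr <;> linarith
      _ = 600 * (B + 1) * 4 ^ N * 1 := by ring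
      _ ≤ _ := by rw [hM]; gcongr
  have hcM : ∀ i ∈ Finset.range N, ‖cf (i + 1) L‖ ≤ M := by
    intro i hi
    have hi' : i + 1 ≤ N := by simpa using hi
    apply hMb
    have := hcL _ hi'
    have : 0 ≤ B * 2 ^ N := by positivity
    linarith
  have hvM : ∀ i ∈ Finset.range N, ‖v i‖ ≤ M := by
    intro i hi
    have hi' : i + 1 ≤ N := by simpa using hi
    calc ‖v i‖ ≤ ∑ m ∈ Finset.range (i + 2), ‖cf m (fun z => p z / t) * dd L (i + 1 - m)‖ := norm_sum_le _ _
      _ ≤ ∑ m ∈ Finset.range (i + 2), (3 * 2 ^ N) * ((N + 1) * ((B + 1) * 2 ^ N)) := by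
          apply Finset.sum_le_sum
          intro m hm
          have := Finset.mem_range.1 hm
          rw [norm_mul]
          gcongr
          · exact hcP m (by omega)
          · exact hdd _ (by omega)
      _ = ((i:ℝ) + 2) * ((3 * 2 ^ N) * ((N + 1) * ((B + 1) * 2 ^ N))) := by simp
      _ ≤ ((N:ℝ) + 1) * ((3 * 2 ^ N) * ((N + 1) * ((B + 1) * 2 ^ N))) := by
          have : (i:ℝ) + 1 ≤ N := by exact_mod_cast hi'
          have : (i:ℝ) + 2 ≤ N + 1 := by linarith
          gcongr
      _ = 3 * (B + 1) * (2 ^ N * 2 ^ N) * ((N:ℝ) + 1) ^ 2 := by ring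
      _ ≤ M := by rw [h2N, hM]; gcongr; norm_num
  have hterm : ∀ i ∈ Finset.range N, (((i:ℝ) + 1) * ‖cf (i + 1) (fun z => L (z * Complex.exp (- p z)) + t - p z)‖ ^ 2
        - 4 / (i + 1)) * TT N (i + 1) σ ≤
      (((i:ℝ) + 1) * ‖cf (i + 1) L‖ ^ 2 - 4 / (i + 1)) * TT N (i + 1) (σ + t) +
      t * ((((i:ℝ) + 1) * ‖cf (i + 1) L‖ ^ 2 - 4 / (i + 1)) * (((i:ℝ) + 1) * La N (i + 1) (σ + t)) -
        2 * (((i:ℝ) + 1) * (starRingEnd ℂ (cf (i + 1) L) * v i).re) * TT N (i + 1) (σ + t)) + C0 * t ^ 2 := by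
    intro i hi
    have hi' : i + 1 ≤ N := by simpa using hi
    have hiQ : (i:ℝ) + 1 ≤ Q := by rw [hQ]; exact_mod_cast hi'
    have hKi : K1 (i + 1) + K2 (i + 1) ≤ K := by
      rw [hK]
      exact Finset.single_le_sum (f := fun i => K1 (i + 1) + K2 (i + 1))
        (fun i _ => add_nonneg (hK10 _) (hK20 _)) hi
    have hK1i : K1 (i + 1) ≤ K := by linarith [hK20 (i + 1)]
    have hK2i : K2 (i + 1) ≤ K := by linarith [hK10 (i + 1)]
    apply term_bound (M := M) (K := K) (Q := Q) ht (by linarith) (by simp) hiQ (hcM i hi) (hvM i hi)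
    · have := step_coeff hL hB hp hre ht ht1 h0 i
      refine this.trans ?_
      have h3 : 576 * B * t ^ 2 / (1/2) ^ (i + 1) = (576 * (B * 2 ^ (i + 1))) * t ^ 2 := by
        rw [one_div, inv_pow, div_inv_eq_mul]; ring
      rw [h3]
      gcongr
      apply hMb
      gcongr
      norm_num
    · exact TT_nonneg N _ hσ
    · exact (hK2 (i + 1) σ hσ).1.trans hK2i
    · have := La_nonneg N (i + 1) (σ := σ + t) (by linarith)
      positivity
    · have h4 := (hK2 (i + 1) (σ + t) (by linarith)).2.trans hK2i
      have := La_nonneg N (i + 1) (σ := σ + t) (by linarith)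
      gcongr
    · have h5 := hK1 (i + 1) σ t hσ ht.le
      push_cast at h5
      exact h5.trans (by gcongr)
  have hsum := Finset.sum_le_sum hterm
  rw [Finset.sum_add_distrib, Finset.sum_add_distrib, ← Finset.mul_sum] at hsum
  have hWe : ∑ i ∈ Finset.range N, ((((i:ℝ) + 1) * ‖cf (i + 1) L‖ ^ 2 - 4 / (i + 1)) * (((i:ℝ) + 1) * La N (i + 1) (σ + t)) -
        2 * (((i:ℝ) + 1) * (starRingEnd ℂ (cf (i + 1) L) * v i).re) * TT N (i + 1) (σ + t)) =
      Wb N (fun k => La N k (σ + t)) (fun k => TT N k (σ + t)) (dd L)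
      (fun m => cf m (fun z => p z / t)) := by
    unfold Wb
    rw [Complex.re_sum, Finset.mul_sum, ← Finset.sum_sub_distrib]
    apply Finset.sum_congr rfl
    intro i _
    have hdi : dd L (i + 1) = ((i:ℂ) + 1) * cf (i + 1) L := by simp [dd]
    congr 1
    · rw [hdi, norm_mul, show ((i:ℂ) + 1) = ((i + 1 : ℕ) : ℂ) by push_cast; ring, Complex.norm_natCast]
      push_cast
      field_simp
    · rw [hdi]
      have : (starRingEnd ℂ (((i:ℂ) + 1) * cf (i + 1) L) * ((TT N (i + 1) (σ + t) : ℝ) : ℂ)) *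
        ∑ m ∈ Finset.range (i + 2), cf m (fun z => p z / t) * dd L (i + 1 - m) =
        ((((i:ℝ) + 1) * TT N (i + 1) (σ + t) : ℝ) : ℂ) * (starRingEnd ℂ (cf (i + 1) L) * v i) := by
        rw [map_mul, map_add, map_one, Complex.conj_natCast]
        push_cast
        ring
      rw [this, Complex.re_ofReal_mul]
      ring
  rw [hWe] at hsum
  have hfin : ∑ i ∈ Finset.range N, C0 * t ^ 2 = N * C0 * t ^ 2 := by simp; ring
  rw [hfin] at hsum
  unfold Phi
  have := mul_nonpos_of_nonneg_of_nonpos ht.le hW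
  linarith

end DB
end

section
open Polynomial
namespace DB

lemma exists_log {F : ℂ → ℂ} (hF : DifferentiableOn ℂ F (Metric.ball 0 1))
    (hne : ∀ z ∈ Metric.ball (0:ℂ) 1, F z ≠ 0) {l : ℂ} (hl : Complex.exp l = F 0) :
    ∃ L : ℂ → ℂ, DifferentiableOn ℂ L (Metric.ball 0 1) ∧ L 0 = l ∧
      ∀ z ∈ Metric.ball (0:ℂ) 1, Complex.exp (L z) = F z := by
  have hd : DifferentiableOn ℂ (fun z => deriv F z / F z) (Metric.ball 0 1) :=
    (hF.deriv Metric.isOpen_ball).div hF hne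
  obtain ⟨g, hg⟩ := hd.isExactOn_ball
  have h0 : (0:ℂ) ∈ Metric.ball (0:ℂ) 1 := by simp
  have hc : ∀ z ∈ Metric.ball (0:ℂ) 1,
      HasDerivAt (fun z => F z * Complex.exp (-(g z - g 0 + l))) 0 z := by
    intro z hz
    have h1 := (hF.differentiableAt (Metric.isOpen_ball.mem_nhds hz)).hasDerivAt
    have h2 := (((hg z hz).sub_const (g 0)).add_const l).neg.cexp
    have h3 := h1.mul h2
    have : deriv F z * Complex.exp (-(g z - g 0 + l)) +
      F z * (Complex.exp (-(g z - g 0 + l)) * -(deriv F z / F z)) = 0 := by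
      field_simp [hne z hz]; ring
    exact h3.congr_deriv this
  have hconst : ∀ z ∈ Metric.ball (0:ℂ) 1, F z * Complex.exp (-(g z - g 0 + l)) = 1 := by
    intro z hz
    have := (convex_ball (0:ℂ) 1).is_const_of_fderivWithin_eq_zero (𝕜 := ℂ)
      (f := fun z => F z * Complex.exp (-(g z - g 0 + l)))
      (fun z hz => (hc z hz).differentiableAt.differentiableWithinAt)
      (fun z hz => by
        rw [fderivWithin_of_isOpen Metric.isOpen_ball hz]
        have := (hc z hz).hasFDerivAt.fderiv
        rw [this]; ext; simp) hz h0
    rw [this]; simp [← hl, ← Complex.exp_add]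
  refine ⟨fun z => g z - g 0 + l, fun z hz => ?_, by simp, fun z hz => ?_⟩
  · exact (((hg z hz).sub_const (g 0)).add_const l).differentiableAt.differentiableWithinAt
  · have := hconst z hz
    rw [Complex.exp_neg] at this
    have h := Complex.exp_ne_zero (g z - g 0 + l)
    field_simp at this
    exact this.symm

lemma mob_lt {x y : ℂ} (hx : ‖x‖ < 1) (hy : ‖y‖ < 1) : ‖x - y‖ < ‖1 - (starRingEnd ℂ) y * x‖ := by
  have h : ‖1 - (starRingEnd ℂ) y * x‖ ^ 2 - ‖x - y‖ ^ 2 = (1 - ‖x‖ ^ 2) * (1 - ‖y‖ ^ 2) := by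
    simp only [Complex.sq_norm, Complex.normSq_apply]
    simp
    ring
  have h1 : 0 < (1 - ‖x‖ ^ 2) * (1 - ‖y‖ ^ 2) := by
    apply mul_pos <;> nlinarith [norm_nonneg x, norm_nonneg y]
  exact lt_of_pow_lt_pow_left₀ 2 (norm_nonneg _) (by linarith)

lemma mob_ne {x y : ℂ} (hx : ‖x‖ < 1) (hy : ‖y‖ < 1) : 1 - (starRingEnd ℂ) y * x ≠ 0 := by
  intro h
  have := mob_lt hx hy
  rw [h, norm_zero] at this
  exact absurd this (not_lt.2 (norm_nonneg _))

lemma mob_div {x y : ℂ} (hx : ‖x‖ < 1) (hy : ‖y‖ < 1) :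
    ‖(x - y) / (1 - (starRingEnd ℂ) y * x)‖ < 1 := by
  rw [norm_div, div_lt_one (norm_pos_iff.2 (mob_ne hx hy))]
  exact mob_lt hx hy

/-- bounded univalent functions fixing the origin with derivative `ρ` there. -/
structure Uni (H : ℂ → ℂ) (ρ : ℝ) : Prop where
  diff : DifferentiableOn ℂ H (Metric.ball 0 1)
  inj : Set.InjOn H (Metric.ball 0 1)
  lt : ∀ z ∈ Metric.ball (0:ℂ) 1, ‖H z‖ < 1
  zero : H 0 = 0
  der : HasDerivAt H ρ 0
  pos : 0 < ρ

lemma Uni.le_one {H : ℂ → ℂ} {ρ : ℝ} (h : Uni H ρ) : ρ ≤ 1 := by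
  have := Complex.norm_deriv_le_one_of_mapsTo_ball (f := H) (c := 0) (R := 1)
    h.diff (fun z hz => by
      have := h.lt z hz
      simpa [h.zero] using this.le) (by norm_num)
  rw [h.der.deriv] at this
  simpa [abs_of_pos h.pos] using this

lemma algK {s b b' G H t κ : ℂ} (hs : s ≠ 0) (hs2 : 1 + s ^ 2 ≠ 0) (hs3 : 1 - s ^ 2 ≠ 0) (hb : b * b' = s ^ 2)
    (h1 : 1 - b' * G ≠ 0) (h2 : 1 + b' * G ≠ 0)
    (hm : H + b ^ 2 = G ^ 2 * (1 + b' ^ 2 * H))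
    (ht : t = (b / s) * ((G - b) / (1 - b' * G))) (hκ : κ = (b' / s) ^ 2) :
    1 + 2 * s / (1 + s ^ 2) * κ * t ≠ 0 ∧
    H = t * (2 * s / (1 + s ^ 2) + κ * t) / (1 + 2 * s / (1 + s ^ 2) * κ * t) := by
  have hkt : κ * t = (b' / s) * ((G - b) / (1 - b' * G)) := by
    rw [hκ, ht]
    field_simp
    linear_combination (b' * (G - b)) * hb
  have hD : 1 + 2 * s / (1 + s ^ 2) * κ * t =
      (1 - s ^ 2) * (1 + b' * G) / ((1 + s ^ 2) * (1 - b' * G)) := by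
    rw [mul_assoc, hkt]
    field_simp
    linear_combination (-2) * hb
  have hN : 2 * s / (1 + s ^ 2) + κ * t =
      (1 - s ^ 2) * (s ^ 2 + b' * G) / ((1 + s ^ 2) * s * (1 - b' * G)) := by
    rw [hkt]
    field_simp
    linear_combination (-(1 + s ^ 2)) * hb
  have hD0 : 1 + 2 * s / (1 + s ^ 2) * κ * t ≠ 0 := by
    rw [hD]
    exact div_ne_zero (mul_ne_zero hs3 h2) (mul_ne_zero hs2 h1)
  refine ⟨hD0, ?_⟩
  rw [eq_div_iff hD0, hD, hN, ht]
  field_simp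
  have hm' : H * ((1 + b' * G) * (1 - b' * G)) = G ^ 2 - b ^ 2 := by linear_combination hm
  rw [mul_assoc] at *
  linear_combination (s ^ 2) * hm' - (G - b) * (G) * hb


lemma koebe_step {H : ℂ → ℂ} {ρ : ℝ} (h : Uni H ρ) {s : ℝ} (hs0 : 0 < s) (hs1 : s < 1)
    {w : ℂ} (hw : ‖w‖ = s ^ 2) (hom : ∀ z ∈ Metric.ball (0:ℂ) 1, H z ≠ w) :
    ∃ (t : ℂ → ℂ) (κ : ℂ), ‖κ‖ = 1 ∧ Uni t (ρ / (2 * s / (1 + s ^ 2))) ∧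
      ∀ z ∈ Metric.ball (0:ℂ) 1,
        1 + (2 * s / (1 + s ^ 2) : ℝ) * κ * t z ≠ 0 ∧
        H z = t z * ((2 * s / (1 + s ^ 2) : ℝ) + κ * t z) / (1 + (2 * s / (1 + s ^ 2) : ℝ) * κ * t z) := by
  have hw1 : ‖w‖ < 1 := by rw [hw]; nlinarith
  have h0 : (0:ℂ) ∈ Metric.ball (0:ℂ) 1 := by simp
  set m : ℂ → ℂ := fun z => (H z - w) / (1 - (starRingEnd ℂ) w * H z) with hm
  have hmd : DifferentiableOn ℂ m (Metric.ball 0 1) :=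
    (h.diff.sub_const w).div ((h.diff.const_mul _).const_sub 1) (fun z hz => mob_ne (h.lt z hz) hw1)
  have hmne : ∀ z ∈ Metric.ball (0:ℂ) 1, m z ≠ 0 := fun z hz =>
    div_ne_zero (sub_ne_zero.2 (hom z hz)) (mob_ne (h.lt z hz) hw1)
  have hm1 : ∀ z ∈ Metric.ball (0:ℂ) 1, ‖m z‖ < 1 := fun z hz => mob_div (h.lt z hz) hw1
  obtain ⟨L, hLd, -, hLe⟩ := exists_log hmd hmne (Complex.exp_log (hmne 0 h0))
  set G : ℂ → ℂ := fun z => Complex.exp (L z / 2) with hG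
  have hGd : DifferentiableOn ℂ G (Metric.ball 0 1) := (hLd.div_const 2).cexp
  have hG2 : ∀ z ∈ Metric.ball (0:ℂ) 1, G z ^ 2 = m z := by
    intro z hz
    rw [← hLe z hz, hG]
    simp only [← Complex.exp_nat_mul]
    congr 1; push_cast; ring
  have hG1 : ∀ z ∈ Metric.ball (0:ℂ) 1, ‖G z‖ < 1 := by
    intro z hz
    have := hm1 z hz
    rw [← hG2 z hz, norm_pow] at this
    nlinarith [norm_nonneg (G z)]
  set b := G 0 with hb
  have hbw : b ^ 2 = - w := by
    rw [hb, hG2 0 h0, hm]; simp [h.zero]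
  have hbs : ‖b‖ = s := by
    have : ‖b‖ ^ 2 = s ^ 2 := by rw [← norm_pow, hbw, norm_neg, hw]
    exact (pow_left_inj₀ (norm_nonneg _) hs0.le two_ne_zero).1 this
  have hb1 : ‖b‖ < 1 := by rw [hbs]; exact hs1
  have hbb : b * (starRingEnd ℂ) b = (s:ℂ) ^ 2 := by
    rw [Complex.mul_conj, Complex.normSq_eq_norm_sq, hbs]; push_cast; rfl
  set t : ℂ → ℂ := fun z => (b / s) * ((G z - b) / (1 - (starRingEnd ℂ) b * G z)) with ht
  have htd : DifferentiableOn ℂ t (Metric.ball 0 1) :=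
    ((hGd.sub_const b).div ((hGd.const_mul _).const_sub 1)
      (fun z hz => mob_ne (hG1 z hz) hb1)).const_mul _
  have hsne : (s:ℂ) ≠ 0 := by exact_mod_cast hs0.ne'
  have hs2 : (1:ℂ) + (s:ℂ) ^ 2 ≠ 0 := by
    have : (1:ℝ) + s ^ 2 ≠ 0 := by positivity
    exact_mod_cast this
  have hs3 : (1:ℂ) - (s:ℂ) ^ 2 ≠ 0 := by
    have : (1:ℝ) - s ^ 2 ≠ 0 := by nlinarith
    exact_mod_cast this
  set κ : ℂ := ((starRingEnd ℂ) b / s) ^ 2 with hκ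
  have hκ1 : ‖κ‖ = 1 := by
    rw [hκ, norm_pow, norm_div, Complex.norm_conj, hbs, Complex.norm_real, Real.norm_eq_abs,
      abs_of_pos hs0, div_self hs0.ne', one_pow]
  have key : ∀ z ∈ Metric.ball (0:ℂ) 1,
        1 + (2 * s / (1 + s ^ 2) : ℝ) * κ * t z ≠ 0 ∧
        H z = t z * ((2 * s / (1 + s ^ 2) : ℝ) + κ * t z) / (1 + (2 * s / (1 + s ^ 2) : ℝ) * κ * t z) := by
    intro z hz
    push_cast
    refine algK (G := G z) hsne hs2 hs3 hbb (mob_ne (hG1 z hz) hb1) ?_ ?_ rfl rfl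
    · have := mob_ne (x := - G z) (y := b) (by simpa using hG1 z hz) hb1
      simpa using this
    · have := hG2 z hz
      rw [hm] at this
      rw [this]
      have hw' : (starRingEnd ℂ) w = - (starRingEnd ℂ) b ^ 2 := by
        rw [← map_pow, hbw]; simp
      have hne := mob_ne (h.lt z hz) hw1
      simp only
      rw [hw'] at hne ⊢
      rw [hbw]
      have e1 : 1 + (starRingEnd ℂ) b ^ 2 * H z = 1 - -(starRingEnd ℂ) b ^ 2 * H z := by ring
      rw [e1, div_mul_cancel₀ _ hne]
      ring
  have ht0 : t 0 = 0 := by simp [ht, hb]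
  set a : ℝ := 2 * s / (1 + s ^ 2) with ha
  have ha0 : 0 < a := by positivity
  have hder : HasDerivAt t ((ρ / a : ℝ) : ℂ) 0 := by
    have hdt := htd.differentiableAt (Metric.isOpen_ball.mem_nhds h0)
    have h1 := hdt.hasDerivAt
    have h2 : DifferentiableAt ℂ (fun z => ((a:ℂ) + κ * t z) / (1 + a * κ * t z)) 0 :=
      ((hdt.const_mul κ).const_add _).div ((hdt.const_mul _).const_add 1) (key 0 h0).1
    have h3 := h1.mul h2.hasDerivAt
    have h4 : HasDerivAt H (deriv t 0 * a) 0 := by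
      have h5 := h3.congr_of_eventuallyEq (f₁ := H) (by
        filter_upwards [Metric.isOpen_ball.mem_nhds h0] with z hz
        rw [(key z hz).2, mul_div_assoc]; rfl)
      refine h5.congr_deriv ?_
      simp [ht0]
    have h6 := h4.unique h.der
    have : deriv t 0 = ((ρ / a : ℝ) : ℂ) := by
      push_cast
      rw [eq_div_iff (by exact_mod_cast ha0.ne'), h6]
    rw [← this]; exact h1
  refine ⟨t, κ, hκ1, ⟨htd, ?_, ?_, ht0, hder, div_pos h.pos ha0⟩, key⟩
  · intro x hx y hy hxy
    apply h.inj hx hy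
    rw [(key x hx).2, (key y hy).2, hxy]
  · intro z hz
    rw [ht]
    simp only
    rw [norm_mul, norm_div, hbs, Complex.norm_real, Real.norm_eq_abs,
      abs_of_pos hs0, div_self hs0.ne', one_mul]
    exact mob_div (hG1 z hz) hb1

lemma full_circle {H : ℂ → ℂ} {ρ : ℝ} (h : Uni H ρ) {q : ℝ} (hq : 0 < q)
    (hcov : ∀ w : ℂ, ‖w‖ = q → ∃ z ∈ Metric.ball (0:ℂ) 1, H z = w) : q ≤ ρ := by
  have h0 : (0:ℂ) ∈ Metric.ball (0:ℂ) 1 := by simp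
  have hop : ∀ r : ℝ, r ≤ 1 → IsOpen (H '' Metric.ball 0 r) := by
    intro r hr
    have hA : AnalyticOnNhd ℂ H (Metric.ball 0 1) := h.diff.analyticOnNhd Metric.isOpen_ball
    rcases hA.is_constant_or_isOpen (convex_ball (0:ℂ) 1).isPreconnected with ⟨w, hw⟩ | ho
    · exfalso
      have h1 : (1/2 : ℂ) ∈ Metric.ball (0:ℂ) 1 := by simp; norm_num
      have := h.inj h1 h0 (by rw [hw _ h1, hw _ h0])
      norm_num at this
    · exact ho _ (Metric.ball_subset_ball hr) Metric.isOpen_ball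
  obtain ⟨r, hr0, hr1, hr⟩ : ∃ r : ℝ, 0 < r ∧ r < 1 ∧ Metric.sphere (0:ℂ) q ⊆ H '' Metric.ball 0 r := by
    have hc := isCompact_sphere (0:ℂ) q
    have hdir : Directed (· ⊆ ·) (fun n : ℕ => H '' Metric.ball (0:ℂ) (1 - 1 / ((n:ℝ) + 2))) := by
      apply Monotone.directed_le
      intro m n hmn
      apply Set.image_mono
      apply Metric.ball_subset_ball
      have : (m:ℝ) ≤ n := by exact_mod_cast hmn
      gcongr
    obtain ⟨n, hn⟩ := hc.elim_directed_cover _ (fun n => hop _ (by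
        have : (0:ℝ) < 1 / ((n:ℝ) + 2) := by positivity
        linarith)) (by
        intro w hw
        obtain ⟨z, hz, rfl⟩ := hcov w (by simpa using hw)
        rw [Set.mem_iUnion]
        have hz' : 0 < 1 - ‖z‖ := by simpa using hz
        obtain ⟨n, hn⟩ := exists_nat_one_div_lt hz'
        refine ⟨n, z, ?_, rfl⟩
        simp only [Metric.mem_ball, dist_zero_right]
        have : 1 / ((n:ℝ) + 2) ≤ 1 / ((n:ℝ) + 1) := by gcongr; norm_num
        linarith) hdir
    refine ⟨1 - 1 / ((n:ℝ) + 2), ?_, ?_, hn⟩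
    · have : 1 / ((n:ℝ) + 2) ≤ 1 / 2 := by gcongr; linarith [Nat.cast_nonneg (α := ℝ) n]
      linarith
    · have : (0:ℝ) < 1 / ((n:ℝ) + 2) := by positivity
      linarith
  obtain ⟨r', hrr, hr'1⟩ := exists_between hr1
  have hr'0 : 0 < r' := hr0.trans hrr
  have hsub : Metric.closedBall (0:ℂ) r' ⊆ Metric.ball 0 1 := Metric.closedBall_subset_ball hr'1
  have hne : ∀ z ∈ Metric.sphere (0:ℂ) r', ‖H z‖ ≠ q := by
    intro z hz he
    obtain ⟨y, hy, hyz⟩ := hr (show H z ∈ Metric.sphere (0:ℂ) q by simpa using he)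
    have := h.inj (Metric.ball_subset_ball hr1.le hy) (hsub (Metric.sphere_subset_closedBall hz)) hyz
    subst this
    simp at hy hz
    linarith
  have hgt : ∀ z ∈ Metric.sphere (0:ℂ) r', q < ‖H z‖ := by
    by_contra hcon
    push Not at hcon
    obtain ⟨z0, hz0, hz0q⟩ := hcon
    have hlt0 : ‖H z0‖ < q := lt_of_le_of_ne hz0q (hne z0 hz0)
    have hpre : IsPreconnected (Metric.sphere (0:ℂ) r') :=
      isPreconnected_sphere (by rw [Complex.rank_real_complex]; exact Nat.one_lt_ofNat) 0 r'
    have hcont : ContinuousOn (fun z => ‖H z‖) (Metric.sphere (0:ℂ) r') :=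
      (h.diff.continuousOn.mono (Metric.sphere_subset_closedBall.trans hsub)).norm
    have hall : ∀ z ∈ Metric.sphere (0:ℂ) r', ‖H z‖ ≤ q := by
      intro z hz
      by_contra hzq
      push Not at hzq
      obtain ⟨x, hx, hxq⟩ := hpre.intermediate_value hz0 hz hcont ⟨hlt0.le, hzq.le⟩
      exact hne x hx hxq
    obtain ⟨zm, hzm, hmax⟩ := (isCompact_sphere (0:ℂ) r').exists_isMaxOn ⟨z0, hz0⟩ hcont
    have hmq : ‖H zm‖ < q := lt_of_le_of_ne (hall zm hzm) (hne zm hzm)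
    obtain ⟨y, hy, hyq⟩ := hr (show (q:ℂ) ∈ Metric.sphere (0:ℂ) q by simp [abs_of_pos hq])
    have := Complex.norm_le_of_forall_mem_frontier_norm_le (f := H) (U := Metric.ball (0:ℂ) r') (C := ‖H zm‖)
      Metric.isBounded_ball (by
        apply DifferentiableOn.diffContOnCl
        rw [closure_ball _ hr'0.ne']
        exact h.diff.mono hsub) (by
        intro z hz
        rw [frontier_ball _ hr'0.ne'] at hz
        exact hmax hz) (z := y) (subset_closure (Metric.ball_subset_ball hrr.le hy))
    rw [hyq] at this
    simp [abs_of_pos hq] at this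
    linarith
  set D : ℂ → ℂ := dslope H 0 with hD
  have hDd : DifferentiableOn ℂ D (Metric.ball 0 1) :=
    (Complex.differentiableOn_dslope (Metric.isOpen_ball.mem_nhds h0)).2 h.diff
  have hD0 : D 0 = ρ := by rw [hD, dslope_same, h.der.deriv]
  have hDz : ∀ z : ℂ, z ≠ 0 → D z = H z / z := by
    intro z hz
    rw [hD, dslope_of_ne _ hz, slope_def_field]
    simp [h.zero]
  have hDne : ∀ z ∈ Metric.ball (0:ℂ) 1, D z ≠ 0 := by
    intro z hz
    by_cases hz0 : z = 0
    · rw [hz0, hD0]; exact_mod_cast h.pos.ne'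
    · rw [hDz z hz0]
      refine div_ne_zero (fun hh => hz0 (h.inj hz h0 (by rw [hh, h.zero]))) hz0
  have := Complex.norm_le_of_forall_mem_frontier_norm_le (f := fun z => (D z)⁻¹)
      (U := Metric.ball (0:ℂ) r') (C := 1 / q)
      Metric.isBounded_ball (by
        apply DifferentiableOn.diffContOnCl
        rw [closure_ball _ hr'0.ne']
        exact (hDd.inv hDne).mono hsub) (by
        intro z hz
        rw [frontier_ball _ hr'0.ne'] at hz
        have hzr : ‖z‖ = r' := by simpa using hz
        have hz0 : z ≠ 0 := by rw [← norm_pos_iff, hzr]; exact hr'0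
        rw [hDz z hz0, norm_inv, norm_div, inv_div, hzr]
        have := hgt z hz
        gcongr) (z := 0) (subset_closure (by simp [hr'0]))
  simp only [hD0, norm_inv, Complex.norm_real, Real.norm_eq_abs, abs_of_pos h.pos] at this
  rw [one_div] at this
  exact (inv_le_inv₀ h.pos hq).1 this

end DB
end

section
open Polynomial
namespace DB

lemma exists_p {F : ℂ → ℂ} (hF : DifferentiableOn ℂ F (Metric.ball 0 1))
    (hne : ∀ z ∈ Metric.ball (0:ℂ) 1, F z ≠ 0) (hle : ∀ z ∈ Metric.ball (0:ℂ) 1, ‖F z‖ ≤ 1)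
    {t : ℝ} (ht : F 0 = (Real.exp (-t) : ℝ)) :
    ∃ p : ℂ → ℂ, DifferentiableOn ℂ p (Metric.ball 0 1) ∧ p 0 = t ∧
      (∀ z ∈ Metric.ball (0:ℂ) 1, 0 ≤ (p z).re) ∧
      ∀ z ∈ Metric.ball (0:ℂ) 1, Complex.exp (- p z) = F z := by
  obtain ⟨L, h1, h2, h3⟩ := exists_log hF hne (l := -(t:ℂ)) (by rw [ht]; push_cast; rfl)
  refine ⟨fun z => - L z, h1.neg, by simp [h2], fun z hz => ?_, fun z hz => by simpa using h3 z hz⟩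
  have := hle z hz
  rw [← h3 z hz, Complex.norm_exp, Real.exp_le_one_iff] at this
  simpa using this

lemma Phi_zero (N : ℕ) {σ : ℝ} (hσ : 0 ≤ σ) : Phi N σ (fun _ => 0) ≤ 0 := by
  unfold Phi
  apply Finset.sum_nonpos
  intro i _
  apply mul_nonpos_of_nonpos_of_nonneg _ (TT_nonneg N _ hσ)
  simp
  positivity

/-- state of the iterated square root construction after `j` steps. -/
def St (N : ℕ) (C τ : ℝ) (H : ℂ → ℂ) (ρ : ℝ) (j : ℕ) (t L : ℂ → ℂ) : Prop :=
  Uni t (ρ / Real.exp (-τ) ^ j) ∧ DifferentiableOn ℂ L (Metric.ball 0 1) ∧ L 0 = 0 ∧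
  (∀ z ∈ Metric.ball (0:ℂ) 1, (L z).re ≤ j * τ) ∧
  (∀ z ∈ Metric.ball (0:ℂ) 1, ‖t z‖ < Real.exp (-τ) →
    H z = (Real.exp (-τ) : ℝ) ^ j * t z * Complex.exp (L (t z / (Real.exp (-τ) : ℝ)))) ∧
  ∀ σ : ℝ, 0 ≤ σ → Phi N σ (fun k => cf k L) ≤ j * (C * τ ^ 2)

lemma St.jle {N : ℕ} {C τ : ℝ} {H : ℂ → ℂ} {ρ : ℝ} {j : ℕ} {t L : ℂ → ℂ} (h : St N C τ H ρ j t L)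
    (hρ : 0 < ρ) : j * τ ≤ - Real.log ρ := by
  have h1 := h.1.le_one
  rw [div_le_one (by positivity), ← Real.exp_nat_mul] at h1
  have := Real.log_le_log hρ h1
  rw [Real.log_exp] at this
  linarith

lemma St.bound {N : ℕ} {C τ : ℝ} {H : ℂ → ℂ} {ρ : ℝ} {j : ℕ} {t L : ℂ → ℂ} (h : St N C τ H ρ j t L)
    (hρ : 0 < ρ) (hτ : 0 < τ) : ∀ z ∈ Metric.ball (0:ℂ) (3/4), ‖L z‖ ≤ 8 * (1 - Real.log ρ) := by
  intro z hz
  have hj := h.jle hρ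
  have hjt : 0 ≤ j * τ := by positivity
  have hz' : ‖z‖ < 3/4 := by simpa using hz
  have := harnack (p := fun z => ((j * τ + 1 : ℝ) : ℂ) - L z) (h.2.1.const_sub _)
    (fun z hz => by
      have := h.2.2.2.1 z hz
      simp only [Complex.sub_re, Complex.ofReal_re]
      linarith) (t := j * τ + 1) (by positivity) (by simp [h.2.2.1]) (z := z) (by linarith)
  have h7 : (1 + ‖z‖) / (1 - ‖z‖) ≤ 7 := by
    rw [div_le_iff₀ (by linarith)]; linarith
  have h8 : ‖((j * τ + 1 : ℝ) : ℂ) - L z‖ ≤ (j * τ + 1) * 7 := this.trans (by gcongr)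
  have h9 : ‖L z‖ ≤ ‖((j * τ + 1 : ℝ) : ℂ)‖ + ‖((j * τ + 1 : ℝ) : ℂ) - L z‖ := by
    have := norm_sub_le ((j * τ + 1 : ℝ) : ℂ) (((j * τ + 1 : ℝ) : ℂ) - L z)
    simpa using this
  rw [Complex.norm_real, Real.norm_eq_abs, abs_of_pos (by positivity)] at h9
  linarith

lemma St_step {N : ℕ} {C τ : ℝ} {H : ℂ → ℂ} {ρ : ℝ} {j : ℕ} {t L : ℂ → ℂ} (h : St N C τ H ρ j t L)
    (hρ : 0 < ρ) (hτ : 0 < τ) (hτ2 : τ ≤ 1 / 24)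
    (hC : ∀ (L p : ℂ → ℂ) (t σ : ℝ),
    DifferentiableOn ℂ L (Metric.ball 0 1) → (∀ z ∈ Metric.ball (0:ℂ) (3/4), ‖L z‖ ≤ 8 * (1 - Real.log ρ)) →
    DifferentiableOn ℂ p (Metric.ball 0 1) → (∀ z ∈ Metric.ball (0:ℂ) 1, 0 ≤ (p z).re) →
    0 < t → t ≤ 1/24 → p 0 = t → 0 ≤ σ →
    Phi N σ (fun k => cf k (fun z => L (z * Complex.exp (- p z)) + t - p z)) ≤
      Phi N (σ + t) (fun k => cf k L) + C * t ^ 2)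
    {s : ℝ} (hs0 : 0 < s) (hs1 : s < 1) (hsa : 2 * s / (1 + s ^ 2) = Real.exp (-τ))
    {w : ℂ} (hw : ‖w‖ = s ^ 2) (hom : ∀ z ∈ Metric.ball (0:ℂ) 1, t z ≠ w) :
    ∃ t' L', St N C τ H ρ (j + 1) t' L' := by
  obtain ⟨t', κ, hκ, hU, hK⟩ := koebe_step h.1 hs0 hs1 hw hom
  rw [hsa] at hU hK
  set a := Real.exp (-τ) with ha
  have ha0 : 0 < a := Real.exp_pos _
  have ha1 : a < 1 := by rw [ha, Real.exp_lt_one_iff]; linarith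
  have hane : (a:ℂ) ≠ 0 := by exact_mod_cast ha0.ne'
  have hac : ‖(a:ℂ)‖ < 1 := by simpa [abs_of_pos ha0] using ha1
  have hkz : ∀ z ∈ Metric.ball (0:ℂ) 1, ‖κ * z‖ < 1 := by
    intro z hz; rw [norm_mul, hκ, one_mul]; simpa using hz
  have hxz : ∀ z ∈ Metric.ball (0:ℂ) 1, ‖-(a * (κ * z))‖ < 1 := by
    intro z hz; rw [norm_neg, norm_mul]
    exact mul_lt_one_of_nonneg_of_lt_one_left (norm_nonneg _) hac (hkz z hz).le
  have hden : ∀ z ∈ Metric.ball (0:ℂ) 1, (1:ℂ) + a ^ 2 * (κ * z) ≠ 0 := by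
    intro z hz
    have := mob_ne (hxz z hz) hac
    simp only [Complex.conj_ofReal] at this
    intro hh; apply this; linear_combination hh
  obtain ⟨q, hqd, hq0, hqre, hqe⟩ := exists_p (F := fun z => a * (1 + κ * z) / (1 + a ^ 2 * (κ * z)))
    (t := τ)
    (DifferentiableOn.div (by fun_prop) (by fun_prop) hden)
    (fun z hz => by
      refine div_ne_zero (mul_ne_zero hane ?_) (hden z hz)
      intro hh
      have := hkz z hz
      rw [show κ * z = -1 by linear_combination hh] at this
      simp at this)
    (fun z hz => by
      have := mob_div (hxz z hz) hac
      simp only [Complex.conj_ofReal] at this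
      rw [← norm_neg] at this
      refine le_of_eq_of_le ?_ this.le
      congr 1
      rw [← neg_div]
      congr 1 <;> ring)
    (by simp [ha])
  have hphi := phi_maps hqre
  refine ⟨t', fun z => L (z * Complex.exp (- q z)) + τ - q z, ?_, ?_, ?_, ?_, ?_, ?_⟩
  · rw [pow_succ, ← div_div]; exact hU
  · refine ((h.2.1.comp ?_ hphi).add_const _).sub hqd
    exact differentiableOn_id.mul hqd.neg.cexp
  · simp [h.2.2.1, hq0]
  · intro z hz
    have h1 := h.2.2.2.1 _ (hphi hz)
    have h2 := hqre z hz
    simp only [Complex.sub_re, Complex.add_re, Complex.ofReal_re]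
    push_cast
    simp only at h1
    linarith
  · intro z hz hlt
    set x : ℂ := t' z / a with hx
    have hxt : t' z = a * x := by rw [hx]; field_simp
    have hxb : x ∈ Metric.ball (0:ℂ) 1 := by
      simp only [hx, Metric.mem_ball, dist_zero_right, norm_div, Complex.norm_real, Real.norm_eq_abs,
        abs_of_pos ha0]
      rwa [div_lt_one ha0]
    have htz : t z = a * (x * Complex.exp (- q x)) := by
      rw [(hK z hz).2, hqe x hxb, hxt]
      have e2 : 1 + (a:ℂ) * κ * (a * x) = 1 + a ^ 2 * (κ * x) := by ring
      rw [e2]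
      have := hden x hxb
      field_simp
    have h5 := h.2.2.2.2.1 z hz (by
      rw [htz, norm_mul, Complex.norm_real, Real.norm_eq_abs, abs_of_pos ha0]
      have := hphi hxb
      simp only [Metric.mem_ball, dist_zero_right] at this
      nlinarith)
    change H z = (a:ℂ) ^ (j + 1) * t' z * Complex.exp (L (x * Complex.exp (- q x)) + τ - q x)
    rw [← ha] at h5
    rw [h5, htz]
    have e3 : (a:ℂ) * (x * Complex.exp (- q x)) / a = x * Complex.exp (- q x) := by field_simp
    rw [e3, hxt]
    have e4 : Complex.exp (L (x * Complex.exp (- q x)) + τ - q x) =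
      Complex.exp (L (x * Complex.exp (- q x))) * Complex.exp (- q x) * (a:ℂ)⁻¹ := by
      rw [ha]
      push_cast
      rw [← Complex.exp_neg, ← Complex.exp_add, ← Complex.exp_add]
      congr 1; ring
    rw [e4, pow_succ]
    field_simp
  · intro σ hσ
    have h1 := hC L q τ σ h.2.1 (h.bound hρ hτ) hqd hqre hτ hτ2 hq0 hσ
    have h2 := h.2.2.2.2.2 (σ + τ) (by linarith)
    push_cast
    linarith

lemma St_exists {N : ℕ} {C τ : ℝ} {H : ℂ → ℂ} {ρ : ℝ} (hH : Uni H ρ)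
    (hτ : 0 < τ) (hτ2 : τ ≤ 1 / 24)
    (hC : ∀ (L p : ℂ → ℂ) (t σ : ℝ),
    DifferentiableOn ℂ L (Metric.ball 0 1) → (∀ z ∈ Metric.ball (0:ℂ) (3/4), ‖L z‖ ≤ 8 * (1 - Real.log ρ)) →
    DifferentiableOn ℂ p (Metric.ball 0 1) → (∀ z ∈ Metric.ball (0:ℂ) 1, 0 ≤ (p z).re) →
    0 < t → t ≤ 1/24 → p 0 = t → 0 ≤ σ →
    Phi N σ (fun k => cf k (fun z => L (z * Complex.exp (- p z)) + t - p z)) ≤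
      Phi N (σ + t) (fun k => cf k L) + C * t ^ 2)
    {s : ℝ} (hs0 : 0 < s) (hs1 : s < 1) (hsa : 2 * s / (1 + s ^ 2) = Real.exp (-τ)) :
    ∃ j t L, St N C τ H ρ j t L ∧ s ^ 2 ≤ ρ / Real.exp (-τ) ^ j := by
  by_contra hcon
  push Not at hcon
  have hall : ∀ j, ∃ t L, St N C τ H ρ j t L := by
    intro j
    induction j with
    | zero =>
      refine ⟨H, fun _ => 0, by simpa using hH, by fun_prop, rfl, by simp, by simp, ?_⟩
      intro σ hσ
      have : (fun k => cf k (fun _ : ℂ => (0:ℂ))) = fun _ => 0 := by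
        funext k; simp [cf]
      rw [this]
      simpa using Phi_zero N hσ
    | succ j ih =>
      obtain ⟨t, L, h⟩ := ih
      have h1 := hcon j t L h
      have : ∃ w : ℂ, ‖w‖ = s ^ 2 ∧ ∀ z ∈ Metric.ball (0:ℂ) 1, t z ≠ w := by
        by_contra h2
        push Not at h2
        have := full_circle h.1 (q := s ^ 2) (by positivity) h2
        linarith
      obtain ⟨w, hw, hom⟩ := this
      exact St_step h hH.pos hτ hτ2 hC hs0 hs1 hsa hw hom
  obtain ⟨j, hj⟩ := exists_nat_gt ((- Real.log ρ) / τ)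
  obtain ⟨t, L, h⟩ := hall j
  have := h.jle hH.pos
  rw [div_lt_iff₀ hτ] at hj
  linarith

end DB
end

section
open Polynomial
namespace DB

lemma Uni.dslope_props {H : ℂ → ℂ} {ρ : ℝ} (h : Uni H ρ) :
    DifferentiableOn ℂ (dslope H 0) (Metric.ball 0 1) ∧ dslope H 0 0 = ρ ∧
    (∀ z ∈ Metric.ball (0:ℂ) 1, dslope H 0 z ≠ 0) ∧ (∀ z ∈ Metric.ball (0:ℂ) 1, ‖dslope H 0 z‖ ≤ 1) ∧
    ∀ z, H z = z * dslope H 0 z := by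
  have h0 : (0:ℂ) ∈ Metric.ball (0:ℂ) 1 := by simp
  have hDz : ∀ z : ℂ, H z = z * dslope H 0 z := by
    intro z
    have := sub_smul_dslope H 0 z
    simp [h.zero] at this
    exact this.symm
  have hD0 : dslope H 0 0 = ρ := by rw [dslope_same, h.der.deriv]
  refine ⟨(Complex.differentiableOn_dslope (Metric.isOpen_ball.mem_nhds h0)).2 h.diff,
    hD0, ?_, ?_, hDz⟩
  · intro z hz hh
    by_cases hz0 : z = 0
    · rw [hz0, hD0] at hh; exact h.pos.ne' (by exact_mod_cast hh)
    · have := hDz z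
      rw [hh, mul_zero] at this
      exact hz0 (h.inj hz h0 (by rw [this, h.zero]))
  · intro z hz
    have := Complex.norm_dslope_le_div_of_mapsTo_ball (f := H) (c := 0) (R₁ := 1) (R₂ := 1) h.diff
      (fun z hz => by
      have := h.lt z hz
      simpa [h.zero] using this.le) hz
    simpa using this

lemma eq_of_exp_eq {u v : ℂ → ℂ} (hu : ContinuousAt u 0) (hv : ContinuousAt v 0) (hu0 : u 0 = 0)
    (hv0 : v 0 = 0) (he : ∀ᶠ z in nhds (0:ℂ), Complex.exp (u z) = Complex.exp (v z)) :
    u =ᶠ[nhds 0] v := by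
  have key : ∀ w : ℂ → ℂ, ContinuousAt w 0 → w 0 = 0 →
      ∀ᶠ z in nhds (0:ℂ), Complex.log (Complex.exp (w z)) = w z := by
    intro w hw hw0
    have : ∀ᶠ z in nhds (0:ℂ), ‖w z‖ < 1 := by
      have := hw.norm
      exact this.eventually_lt_const (by simp [hw0])
    filter_upwards [this] with z hz
    have h1 := Complex.abs_im_le_norm (w z)
    have h2 := abs_lt.1 (h1.trans_lt hz)
    have h3 := Real.pi_gt_three
    exact Complex.log_exp (by linarith) (by linarith)
  filter_upwards [he, key u hu hu0, key v hv hv0] with z h1 h2 h3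
  rw [← h2, ← h3, h1]

lemma final_step {N : ℕ} {C τ : ℝ} {H : ℂ → ℂ} {ρ : ℝ} {j : ℕ} {t L : ℂ → ℂ} (h : St N C τ H ρ j t L)
    (hρ : 0 < ρ) (hτ : 0 < τ)
    (hC0 : 0 ≤ C)
    (hC : ∀ (L p : ℂ → ℂ) (t σ : ℝ),
    DifferentiableOn ℂ L (Metric.ball 0 1) → (∀ z ∈ Metric.ball (0:ℂ) (3/4), ‖L z‖ ≤ 8 * (1 - Real.log ρ)) →
    DifferentiableOn ℂ p (Metric.ball 0 1) → (∀ z ∈ Metric.ball (0:ℂ) 1, 0 ≤ (p z).re) →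
    0 < t → t ≤ 1/24 → p 0 = t → 0 ≤ σ →
    Phi N σ (fun k => cf k (fun z => L (z * Complex.exp (- p z)) + t - p z)) ≤
      Phi N (σ + t) (fun k => cf k L) + C * t ^ 2)
    {η : ℝ} (hη : Real.exp (-η) ≤ ρ / Real.exp (-τ) ^ j) (hsmall : η + τ ≤ 1 / 24)
    {l : ℂ → ℂ} (hl : DifferentiableOn ℂ l (Metric.ball 0 1)) (hl0 : l 0 = 0)
    (hlH : ∀ z ∈ Metric.ball (0:ℂ) 1, H z = ρ * z * Complex.exp (l z)) :
    Phi N 0 (fun k => (((Real.exp (-τ)) ^ 2 : ℝ) : ℂ) ^ k * cf k l) ≤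
      (- Real.log ρ) * (C * τ) + C * (η + τ) ^ 2 := by
  obtain ⟨hD, hD0, hDne, hD1, hDz⟩ := h.1.dslope_props
  set a := Real.exp (-τ) with ha
  have ha0 : 0 < a := Real.exp_pos _
  have ha1 : a < 1 := by rw [ha, Real.exp_lt_one_iff]; linarith
  have hane : (a:ℂ) ≠ 0 := by exact_mod_cast ha0.ne'
  set r := ρ / a ^ j with hr
  have hr0 : 0 < r := h.1.pos
  have hr1 : r ≤ 1 := h.1.le_one
  set t0 := - Real.log r with ht0
  have ht00 : 0 ≤ t0 := by have := Real.log_nonpos hr0.le hr1; linarith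
  have ht0r : Real.exp (-t0) = r := by rw [ht0, neg_neg, Real.exp_log hr0]
  have ht0η : t0 ≤ η := by
    have := Real.log_le_log (Real.exp_pos _) hη
    rw [Real.log_exp] at this; linarith
  obtain ⟨p, hpd, hp0, hpre, hpe⟩ := exists_p hD hDne hD1 (t := t0) (by rw [hD0, ht0r])
  have ha2 : ∀ z ∈ Metric.ball (0:ℂ) 1, (a:ℂ) ^ 2 * z ∈ Metric.ball (0:ℂ) 1 := by
    intro z hz
    simp only [Metric.mem_ball, dist_zero_right, norm_mul, norm_pow, Complex.norm_real,
      Real.norm_eq_abs, abs_of_pos ha0] at hz ⊢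
    have : a ^ 2 ≤ 1 := by nlinarith
    nlinarith [norm_nonneg z]
  set q : ℂ → ℂ := fun z => p (a ^ 2 * z) + τ with hq
  have hqd : DifferentiableOn ℂ q (Metric.ball 0 1) :=
    (hpd.comp (by fun_prop) ha2).add_const _
  have hqre : ∀ z ∈ Metric.ball (0:ℂ) 1, 0 ≤ (q z).re := by
    intro z hz
    have := hpre _ (ha2 z hz)
    simp only [hq, Complex.add_re, Complex.ofReal_re]
    linarith
  have hq0 : q 0 = ((t0 + τ : ℝ) : ℂ) := by simp [hq, hp0]
  have hmain := hC L q (t0 + τ) 0 h.2.1 (h.bound hρ hτ) hqd hqre (by linarith) (by linarith) hq0 le_rfl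
  have hphi := phi_maps hqre
  have hLfd : DifferentiableOn ℂ (fun z => L (z * Complex.exp (- q z)) + ((t0 + τ : ℝ) : ℂ) - q z) (Metric.ball 0 1) := by
    refine ((h.2.1.comp ?_ hphi).add_const _).sub hqd
    exact differentiableOn_id.mul hqd.neg.cexp
  have h0 : (0:ℂ) ∈ Metric.ball (0:ℂ) 1 := by simp
  have hnh := Metric.isOpen_ball.mem_nhds h0
  have heq : (fun z => L (z * Complex.exp (- q z)) + ((t0 + τ : ℝ) : ℂ) - q z) =ᶠ[nhds 0]
      fun z => l (((a ^ 2 : ℝ) : ℂ) * z) := by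
    have hl' : DifferentiableOn ℂ (fun z => l (((a ^ 2 : ℝ) : ℂ) * z)) (Metric.ball 0 1) :=
      hl.comp (by fun_prop) (fun z hz => by push_cast; exact ha2 z hz)
    apply eq_of_exp_eq
    · exact (hLfd.differentiableAt hnh).continuousAt
    · exact (hl'.differentiableAt hnh).continuousAt
    · simp [h.2.2.1, hq0]
    · simp [hl0]
    · filter_upwards [hnh] with z hz
      by_cases hz0 : z = 0
      · subst hz0; simp [h.2.2.1, hq0, hl0]
      have e1 := hlH _ (ha2 z hz)
      have e2 : t (a ^ 2 * z) = a ^ 2 * z * Complex.exp (- p (a ^ 2 * z)) := by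
        rw [hpe _ (ha2 z hz)]; exact hDz _
      have e3 : t (a ^ 2 * z) / a = z * Complex.exp (- q z) := by
        rw [e2, hq]
        simp only [neg_add, Complex.exp_add]
        have : Complex.exp (-(τ:ℂ)) = a := by rw [ha]; push_cast; rfl
        rw [this]; field_simp
      have hlt : ‖t (a ^ 2 * z)‖ < a := by
        have : ‖t (a ^ 2 * z) / a‖ < 1 := by
          rw [e3]; simpa using hphi hz
        rw [norm_div, Complex.norm_real, Real.norm_eq_abs, abs_of_pos ha0, div_lt_one ha0] at this
        exact this
      have e4 := h.2.2.2.2.1 _ (ha2 z hz) hlt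
      rw [← ha, e3, e1, e2] at e4
      have hexp : Complex.exp (L (z * Complex.exp (- q z)) + ((t0 + τ : ℝ) : ℂ) - q z) =
          Complex.exp (L (z * Complex.exp (- q z))) * Complex.exp (- p (a ^ 2 * z)) * (r:ℂ)⁻¹ := by
        rw [← ht0r]
        push_cast
        rw [← Complex.exp_neg, ← Complex.exp_add, ← Complex.exp_add, hq]
        congr 1; ring
      rw [hexp]
      push_cast
      have hrc : (r:ℂ) = ρ / a ^ j := by rw [hr]; push_cast; rfl
      have hρc : (ρ:ℂ) ≠ 0 := by exact_mod_cast hρ.ne'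
      rw [hrc, inv_div]
      have haz : (a:ℂ) ^ 2 * z ≠ 0 := mul_ne_zero (pow_ne_zero 2 hane) hz0
      have e5 : (ρ:ℂ) * Complex.exp (l (a ^ 2 * z)) =
        a ^ j * Complex.exp (- p (a ^ 2 * z)) * Complex.exp (L (z * Complex.exp (- q z))) := by
        apply mul_left_cancel₀ haz
        linear_combination e4
      apply mul_left_cancel₀ hρc
      rw [e5]
      generalize Complex.exp (- p (a ^ 2 * z)) = X
      generalize Complex.exp (L (z * Complex.exp (- q z))) = Y
      field_simp
  have hcf : (fun k => cf k (fun z => L (z * Complex.exp (- q z)) + ((t0 + τ : ℝ) : ℂ) - q z)) =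
      fun k => (((a ^ 2 : ℝ) : ℂ)) ^ k * cf k l := by
    funext k
    rw [cf_congr heq k, cf_scale]
    exact an_of_diff one_pos hl
  rw [hcf] at hmain
  have h6 := h.2.2.2.2.2 (0 + (t0 + τ)) (by linarith)
  have h7 := h.jle hρ
  have h8 : (j:ℝ) * (C * τ ^ 2) ≤ - Real.log ρ * (C * τ) := by
    have : (j:ℝ) * (C * τ ^ 2) = (j * τ) * (C * τ) := by ring
    rw [this]; gcongr
  have h9 : C * (t0 + τ) ^ 2 ≤ C * (η + τ) ^ 2 := by
    gcongr
  linarith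

theorem milin_ineq (N : ℕ) {H : ℂ → ℂ} {ρ : ℝ} (hH : Uni H ρ) 
    {l : ℂ → ℂ} (hl : DifferentiableOn ℂ l (Metric.ball 0 1)) (hl0 : l 0 = 0)
    (hlH : ∀ z ∈ Metric.ball (0:ℂ) 1, H z = ρ * z * Complex.exp (l z)) :
    Phi N 0 (fun k => cf k l) ≤ 0 := by
  obtain ⟨C, hC0, hC⟩ := one_step N (8 * (1 - Real.log ρ))
  set A : ℝ → ℝ := fun s => 2 * s / (1 + s ^ 2) with hA
  have hAc : Filter.Tendsto A (nhdsWithin 1 (Set.Iio 1)) (nhds 1) := by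
    have : ContinuousAt A 1 := by
      apply ContinuousAt.div (by fun_prop) (by fun_prop); norm_num
    have h1 : A 1 = 1 := by simp [hA]; norm_num
    rw [ContinuousAt, h1] at this
    exact this.mono_left nhdsWithin_le_nhds
  have hT : Filter.Tendsto (fun s => - Real.log (A s)) (nhdsWithin 1 (Set.Iio 1)) (nhds 0) := by
    have := (hAc.log one_ne_zero).neg
    simpa using this
  have hE : Filter.Tendsto (fun s : ℝ => - Real.log (s ^ 2)) (nhdsWithin 1 (Set.Iio 1)) (nhds 0) := by
    have h1 : Filter.Tendsto (fun s : ℝ => s ^ 2) (nhdsWithin 1 (Set.Iio 1)) (nhds 1) := by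
      have : ContinuousAt (fun s : ℝ => s ^ 2) 1 := by fun_prop
      rw [ContinuousAt, one_pow] at this
      exact this.mono_left nhdsWithin_le_nhds
    have := (h1.log one_ne_zero).neg
    simpa using this
  have hsum : Filter.Tendsto (fun s : ℝ => - Real.log (s ^ 2) + - Real.log (A s))
      (nhdsWithin 1 (Set.Iio 1)) (nhds 0) := by simpa using hE.add hT
  have hR : Filter.Tendsto (fun s : ℝ => (- Real.log ρ) * (C * (- Real.log (A s))) +
      C * (- Real.log (s ^ 2) + - Real.log (A s)) ^ 2) (nhdsWithin 1 (Set.Iio 1)) (nhds 0) := by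
    have := ((hT.const_mul C).const_mul (- Real.log ρ)).add ((hsum.pow 2).const_mul C)
    simpa using this
  have hLt : Filter.Tendsto (fun s : ℝ => Phi N 0 (fun k => (((A s) ^ 2 : ℝ) : ℂ) ^ k * cf k l))
      (nhdsWithin 1 (Set.Iio 1)) (nhds (Phi N 0 (fun k => cf k l))) := by
    unfold Phi
    apply tendsto_finsetSum
    intro i _
    refine Filter.Tendsto.mul_const _ (Filter.Tendsto.sub_const (Filter.Tendsto.const_mul _ (Filter.Tendsto.pow (Filter.Tendsto.norm ?_) 2)) _)
    have h1 : Filter.Tendsto (fun s : ℝ => (((A s) ^ 2 : ℝ) : ℂ)) (nhdsWithin 1 (Set.Iio 1)) (nhds 1) := by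
      have := (Complex.continuous_ofReal.tendsto _).comp (hAc.pow 2)
      simpa [Function.comp_def] using this
    have := (h1.pow (i + 1)).mul_const (cf (i + 1) l)
    simpa using this
  refine le_of_tendsto_of_tendsto hLt hR ?_
  have hpos : ∀ᶠ s : ℝ in nhdsWithin 1 (Set.Iio 1), 0 < s :=
    nhdsWithin_le_nhds (lt_mem_nhds one_pos)
  filter_upwards [self_mem_nhdsWithin, hpos, hsum.eventually_le_const (show (0:ℝ) < 1 / 24 by norm_num)]
    with s hs1 hs0 hsm
  have hs1 : s < 1 := hs1
  have hA0 : 0 < A s := by simp only [hA]; positivity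
  have hA1 : A s < 1 := by
    simp only [hA]
    rw [div_lt_one (by positivity)]
    nlinarith [mul_pos (sub_pos.2 hs1) (sub_pos.2 hs1)]
  set τ := - Real.log (A s) with hτd
  have hτ : 0 < τ := by have := Real.log_neg hA0 hA1; linarith
  have hexp : Real.exp (-τ) = A s := by rw [hτd, neg_neg, Real.exp_log hA0]
  have hη0 : 0 ≤ - Real.log (s ^ 2) := by
    have := Real.log_nonpos (x := s ^ 2) (by positivity) (by nlinarith); linarith
  obtain ⟨j, t, L, hSt, hj⟩ := St_exists hH hτ (by linarith) hC hs0 hs1 (by rw [hexp])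
  have := final_step hSt hH.pos hτ hC0 hC (η := - Real.log (s ^ 2))
    (by rw [neg_neg, Real.exp_log (by positivity)]; exact hj) hsm hl hl0 hlH
  rw [hexp] at this
  exact this

lemma Phi_zero_eq (N : ℕ) (c : ℕ → ℂ) : Phi N 0 c =
    ∑ v ∈ Finset.range N, ((N:ℝ) - v) * (((v:ℝ) + 1) * ‖c (v + 1)‖ ^ 2 - 4 / (v + 1)) := by
  unfold Phi
  apply Finset.sum_congr rfl
  intro i hi
  rw [Finset.mem_range] at hi
  have : TT N (i + 1) 0 = (N:ℝ) - i := by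
    unfold TT
    rw [neg_zero, Real.exp_zero, tau_one N (i + 1) (by omega)]
    push_cast; ring
  rw [this]; ring

lemma Uni_coeff {H : ℂ → ℂ} {ρ : ℝ} (hH : Uni H ρ) (n : ℕ) : ‖cf (n + 1) H‖ ≤ ρ * (n + 1) := by
  obtain ⟨hD, hD0, hDne, -, hDz⟩ := hH.dslope_props
  have hρ : (ρ:ℂ) ≠ 0 := by exact_mod_cast hH.pos.ne'
  obtain ⟨l, hl, hl0, hle⟩ := exists_log (F := fun z => dslope H 0 z / ρ) (hD.div_const _)
    (fun z hz => div_ne_zero (hDne z hz) hρ) (l := 0) (by simp [hH.der.deriv, hρ])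
  have hlH : ∀ z ∈ Metric.ball (0:ℂ) 1, H z = ρ * z * Complex.exp (l z) := by
    intro z hz
    rw [hle z hz, hDz z]
    field_simp
  have hm := milin_ineq n hH hl hl0 hlH
  rw [Phi_zero_eq] at hm
  have hla : AnalyticAt ℂ l 0 := an_of_diff one_pos hl
  have h1 := coeff_of_milin hla hl0 n hm
  have h2 : cf (n + 1) H = ρ * cf (n + 1) (fun z => z * Complex.exp (l z)) := by
    rw [← cf_const_mul (F := fun z => z * Complex.exp (l z))]
    · apply cf_congr
      filter_upwards [Metric.isOpen_ball.mem_nhds (show (0:ℂ) ∈ Metric.ball (0:ℂ) 1 by simp)] with z hz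
      rw [hlH z hz]; ring
    · exact analyticAt_id.mul hla.cexp
  rw [h2, norm_mul, Complex.norm_real, Real.norm_eq_abs, abs_of_pos hH.pos]
  exact mul_le_mul_of_nonneg_left h1 hH.pos.le

theorem deBranges {h : ℂ → ℂ} (hd : DifferentiableOn ℂ h (Metric.ball 0 1))
    (hi : Set.InjOn h (Metric.ball 0 1)) (h0 : h 0 = 0) (h1 : HasDerivAt h 1 0) (n : ℕ) :
    ‖cf (n + 1) h‖ ≤ n + 1 := by
  have ha : AnalyticAt ℂ h 0 := an_of_diff one_pos hd
  have key : ∀ r : ℝ, 0 < r → r < 1 → r ^ (n + 1) * ‖cf (n + 1) h‖ ≤ r * (n + 1) := by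
    intro r hr0 hr1
    have hmaps : Set.MapsTo (fun z : ℂ => (r:ℂ) * z) (Metric.ball 0 1) (Metric.ball 0 1) := by
      intro z hz
      simp only [Metric.mem_ball, dist_zero_right, norm_mul, Complex.norm_real,
        Real.norm_eq_abs, abs_of_pos hr0] at hz ⊢
      nlinarith [norm_nonneg z]
    obtain ⟨M, hM⟩ := (isCompact_closedBall (0:ℂ) r).exists_bound_of_continuousOn
      (hd.continuousOn.mono (Metric.closedBall_subset_ball hr1))
    set M' := |M| + 1 with hM'
    have hM'0 : 0 < M' := by positivity
    have hMc : (M':ℂ) ≠ 0 := by exact_mod_cast hM'0.ne'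
    have hrc : (r:ℂ) ≠ 0 := by exact_mod_cast hr0.ne'
    have hU : Uni (fun z => (M':ℂ)⁻¹ * h (r * z)) (r / M') := by
      refine ⟨(hd.comp (by fun_prop) hmaps).const_mul _, ?_, ?_, by simp [h0], ?_, by positivity⟩
      · intro x hx y hy hxy
        have := mul_left_cancel₀ (inv_ne_zero hMc) hxy
        exact mul_left_cancel₀ hrc (hi (hmaps hx) (hmaps hy) this)
      · intro z hz
        have hz' : ‖z‖ < 1 := by simpa using hz
        have := hM (r * z) (by
          simp only [Metric.mem_closedBall, dist_zero_right, norm_mul, Complex.norm_real,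
            Real.norm_eq_abs, abs_of_pos hr0]
          nlinarith)
        rw [norm_mul, norm_inv, Complex.norm_real, Real.norm_eq_abs, abs_of_pos hM'0,
          inv_mul_lt_iff₀ hM'0]
        have := le_abs_self M
        linarith
      · have e1 : HasDerivAt (fun z : ℂ => (r:ℂ) * z) (r:ℂ) 0 := by
          simpa using (hasDerivAt_id (0:ℂ)).const_mul (r:ℂ)
        have e2 : HasDerivAt h 1 ((r:ℂ) * 0) := by simpa using h1
        have e3 := (e2.comp (0:ℂ) e1).const_mul ((M':ℂ)⁻¹)
        refine e3.congr_deriv ?_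
        push_cast; field_simp
    have h3 := Uni_coeff hU n
    have hra : AnalyticAt ℂ (fun z => h (r * z)) 0 := an_of_diff one_pos (hd.comp (by fun_prop) hmaps)
    rw [cf_const_mul (F := fun z => h (r * z)) hra, cf_scale ha, norm_mul, norm_mul, norm_inv, norm_pow,
      Complex.norm_real, Complex.norm_real, Real.norm_eq_abs, Real.norm_eq_abs, abs_of_pos hM'0,
      abs_of_pos hr0, inv_mul_le_iff₀ hM'0] at h3
    calc _ ≤ _ := h3
      _ = _ := by field_simp
  have hl : Filter.Tendsto (fun r : ℝ => r ^ (n + 1) * ‖cf (n + 1) h‖) (nhdsWithin 1 (Set.Iio 1))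
      (nhds (‖cf (n + 1) h‖)) := by
    have : ContinuousAt (fun r : ℝ => r ^ (n + 1) * ‖cf (n + 1) h‖) 1 := by fun_prop
    rw [ContinuousAt] at this
    simp only [one_pow, one_mul] at this
    exact this.mono_left nhdsWithin_le_nhds
  have hr : Filter.Tendsto (fun r : ℝ => r * ((n:ℝ) + 1)) (nhdsWithin 1 (Set.Iio 1))
      (nhds ((n:ℝ) + 1)) := by
    have : ContinuousAt (fun r : ℝ => r * ((n:ℝ) + 1)) 1 := by fun_prop
    rw [ContinuousAt] at this
    simp only [one_mul] at this
    exact this.mono_left nhdsWithin_le_nhds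
  refine le_of_tendsto_of_tendsto hl hr ?_
  have hpos : ∀ᶠ s : ℝ in nhdsWithin 1 (Set.Iio 1), 0 < s :=
    nhdsWithin_le_nhds (lt_mem_nhds one_pos)
  filter_upwards [self_mem_nhdsWithin, hpos] with s hs1 hs0
  exact key s hs0 hs1

end DB
end

section
open Polynomial
namespace DB

lemma loc_inv {F : ℂ → ℂ} {x : ℂ} (hF : AnalyticAt ℂ F x) (hF' : deriv F x ≠ 0) :
    ∃ G : ℂ → ℂ, AnalyticAt ℂ G (F x) ∧ G (F x) = x ∧ HasDerivAt G (deriv F x)⁻¹ (F x) ∧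
      (∀ᶠ y in nhds x, G (F y) = y) ∧ (∀ᶠ y in nhds (F x), F (G y) = y) := by
  refine ⟨hF.hasStrictDerivAt.localInverse _ _ _ hF', hF.analyticAt_localInverse hF',
    ?_, (hF.hasStrictDerivAt.to_localInverse hF').hasDerivAt,
    hF.hasStrictDerivAt.eventually_left_inverse hF',
    hF.hasStrictDerivAt.eventually_right_inverse hF'⟩
  exact (hF.hasStrictDerivAt.eventually_left_inverse hF').self_of_nhds

lemma reverse_eval (P : ℂ[X]) {u : ℂ} (hu : u ≠ 0) :
    P.reverse.eval u = u ^ P.natDegree * P.eval (1/u) := by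
  let _ : Invertible (1/u) := invertibleOfNonzero (one_div_ne_zero hu)
  have := eval₂_reverse_mul_pow (RingHom.id ℂ) (1/u) P
  rw [invOf_eq_inv] at this
  simp only [one_div, inv_inv, eval₂_id, inv_pow] at this
  rw [one_div, ← this]
  have : u ^ P.natDegree ≠ 0 := pow_ne_zero _ hu
  field_simp

lemma loc_Q {P : ℂ[X]} (hP : P.Monic) (hN : 0 < P.natDegree) :
    ∃ Q : ℂ → ℂ, AnalyticAt ℂ Q 0 ∧ Q 0 = 1 ∧
      ∀ᶠ u in nhds 0, Q u ^ P.natDegree * P.reverse.eval u = 1 := by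
  have h1 : P.reverse.eval 0 = 1 := by
    rw [← coeff_zero_eq_eval_zero, coeff_zero_reverse]; exact hP
  have hsl : P.reverse.eval 0 ∈ Complex.slitPlane := by rw [h1]; simp
  have han : AnalyticAt ℂ (fun u => P.reverse.eval u) 0 :=
    (P.reverse.differentiable).analyticAt 0
  refine ⟨fun u => Complex.exp (-(Complex.log (P.reverse.eval u)) / P.natDegree), ?_, ?_, ?_⟩
  · exact (((han.clog hsl).neg).div_const).cexp
  · simp [h1]
  · have : ∀ᶠ u in nhds (0:ℂ), P.reverse.eval u ≠ 0 :=
      han.continuousAt.eventually_ne (by rw [h1]; exact one_ne_zero)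
    filter_upwards [this] with u hu
    have hN' : (P.natDegree : ℂ) ≠ 0 := by exact_mod_cast hN.ne'
    rw [← Complex.exp_nat_mul, mul_div_cancel₀ _ hN', Complex.exp_neg, Complex.exp_log hu,
      inv_mul_cancel₀ hu]

lemma loc_h {P : ℂ[X]} (hP : P.Monic) (hN : 0 < P.natDegree) :
    ∃ (h : ℂ → ℂ) (r : ℝ), 0 < r ∧ DifferentiableOn ℂ h (Metric.ball 0 r) ∧
      Set.InjOn h (Metric.ball 0 r) ∧ h 0 = 0 ∧ HasDerivAt h 1 0 ∧
      ∀ ζ ∈ Metric.ball (0:ℂ) r, ζ ≠ 0 → h ζ ≠ 0 ∧ ζ ^ P.natDegree * P.eval (1 / h ζ) = 1 := by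
  obtain ⟨Q, hQ, hQ0, hQe⟩ := loc_Q hP hN
  have hZ : AnalyticAt ℂ (fun u => u * Q u) 0 := analyticAt_id.mul hQ
  have hZd : HasDerivAt (fun u => u * Q u) 1 0 := by
    have := (hasDerivAt_id (0:ℂ)).mul hQ.differentiableAt.hasDerivAt
    simp only [id, hQ0, one_mul, zero_mul, add_zero] at this
    exact this
  obtain ⟨h, h1, h2, h3, h4, h5⟩ := loc_inv hZ (by rw [hZd.deriv]; exact one_ne_zero)
  rw [hZd.deriv, inv_one] at h3
  simp only [zero_mul] at h1 h2 h3 h5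
  have h6 : ∀ᶠ y in nhds (0:ℂ), Q (h y) ^ P.natDegree * P.reverse.eval (h y) = 1 := by
    have := h1.continuousAt.tendsto
    rw [h2] at this
    exact this.eventually hQe
  obtain ⟨r, hr, hball⟩ := Metric.eventually_nhds_iff_ball.1 (h5.and (h6.and h1.eventually_analyticAt))
  refine ⟨h, r, hr, fun y hy => (hball y hy).2.2.differentiableAt.differentiableWithinAt, ?_, h2, h3, ?_⟩
  · intro x hx y hy hxy
    rw [← (hball x hx).1, ← (hball y hy).1, hxy]
  · intro ζ hζ h0
    have e1 := (hball ζ hζ).1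
    have hne : h ζ ≠ 0 := by
      intro h; rw [h, zero_mul] at e1; exact h0 e1.symm
    refine ⟨hne, ?_⟩
    have e2 := (hball ζ hζ).2.1
    rw [reverse_eval _ hne] at e2
    calc ζ ^ P.natDegree * P.eval (1 / h ζ)
        = (h ζ * Q (h ζ)) ^ P.natDegree * P.eval (1 / h ζ) := by rw [e1]
      _ = Q (h ζ) ^ P.natDegree * (h ζ ^ P.natDegree * eval (1 / h ζ) P) := by
        rw [mul_pow]; ring
      _ = 1 := e2
end DB
end

section
open Polynomial
namespace DB

lemma deriv_eval_eq (P : ℂ[X]) (x : ℂ) : deriv (fun y => P.eval y) x = P.derivative.eval x :=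
  P.deriv

lemma lift_unique_loc {P : ℂ[X]} {F G : ℂ → ℂ} {s : ℂ} (hF : ContinuousAt F s)
    (hG : ContinuousAt G s) (he : ∀ᶠ y in nhds s, P.eval (F y) = P.eval (G y)) (h1 : F s = G s)
    (hne : P.derivative.eval (F s) ≠ 0) : F =ᶠ[nhds s] G := by
  obtain ⟨J, -, -, -, hJ, -⟩ := loc_inv (P.differentiable.analyticAt (F s))
    (by rw [deriv_eval_eq]; exact hne)
  have hJG := hJ
  rw [h1] at hJG
  filter_upwards [he, hF.tendsto.eventually hJ, hG.tendsto.eventually hJG] with y e1 e2 e3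
  rw [← e2, ← e3, e1]

lemma lift_diff {P : ℂ[X]} {F E : ℂ → ℂ} {s : ℂ} (hF : ContinuousAt F s)
    (he : ∀ᶠ y in nhds s, P.eval (F y) = E y) (hE : DifferentiableAt ℂ E s)
    (hne : P.derivative.eval (F s) ≠ 0) : DifferentiableAt ℂ F s := by
  obtain ⟨J, hJa, -, -, hJ, -⟩ := loc_inv (P.differentiable.analyticAt (F s))
    (by rw [deriv_eval_eq]; exact hne)
  rw [he.self_of_nhds] at hJa
  have : DifferentiableAt ℂ (fun y => J (E y)) s := hJa.differentiableAt.comp s hE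
  refine this.congr_of_eventuallyEq ?_
  filter_upwards [he, hF.tendsto.eventually hJ] with y e1 e2
  rw [← e1, e2]

/-- right half plane -/
def HP (L : ℝ) : Set ℂ := {s | L < s.re}

lemma HP_open (L : ℝ) : IsOpen (HP L) := isOpen_lt continuous_const Complex.continuous_re
lemma HP_convex (L : ℝ) : Convex ℝ (HP L) := convex_halfSpace_re_gt L

lemma norm_exp_N (N : ℕ) {L : ℝ} {s : ℂ} (hs : s ∈ HP L) (hN : 0 < N) :
    Real.exp (N * L) < ‖Complex.exp (N * s)‖ := by
  rw [Complex.norm_exp]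
  simp only [Complex.mul_re, Complex.natCast_re, Complex.natCast_im, zero_mul, sub_zero]
  have : (0:ℝ) < N := by exact_mod_cast hN
  exact Real.exp_lt_exp.2 (mul_lt_mul_of_pos_left hs this)

lemma lift_ne {P : ℂ[X]} {L : ℝ} (hN : 0 < P.natDegree)
    (hc : ∀ x, P.derivative.eval x = 0 → ‖P.eval x‖ ≤ Real.exp (P.natDegree * L))
    {s x : ℂ} (hs : s ∈ HP L) (hx : P.eval x = Complex.exp (P.natDegree * s)) :
    P.derivative.eval x ≠ 0 := by
  intro h
  have := hc x h
  rw [hx] at this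
  exact absurd (norm_exp_N _ hs hN) (not_lt.2 this)

lemma lift_exists {P : ℂ[X]} {L : ℝ} (hN : 0 < P.natDegree)
    (hc : ∀ x, P.derivative.eval x = 0 → ‖P.eval x‖ ≤ Real.exp (P.natDegree * L))
    {s0 e0 : ℂ} (hs0 : s0 ∈ HP L) (he0 : P.eval e0 = Complex.exp (P.natDegree * s0)) :
    ∃ Ψ : ℂ → ℂ, DifferentiableOn ℂ Ψ (HP L) ∧ Ψ s0 = e0 ∧
      ∀ s ∈ HP L, P.eval (Ψ s) = Complex.exp (P.natDegree * s) := by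
  classical
  have hcs : ContractibleSpace (HP L) := (HP_convex L).contractibleSpace ⟨s0, hs0⟩
  have hlp : LocallyPathConnectedSpace (HP L) := (HP_open L).locallyPathConnectedSpace
  obtain ⟨F, ⟨hF0, hF⟩, -⟩ := (P.isCoveringMapOn_eval).existsUnique_continuousMap_lifts
    (A := HP L) ⟨fun s : HP L => Complex.exp (P.natDegree * (s:ℂ)), by fun_prop⟩
    (a₀ := ⟨s0, hs0⟩) (e₀ := e0) he0 (by
      rintro ⟨s, hs⟩ ⟨x, hx, hxe⟩
      exact lift_ne hN hc hs hxe hx)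
  obtain ⟨Ψ, hΨ⟩ : ∃ Ψ : ℂ → ℂ, ∀ s : HP L, Ψ s = F s :=
    ⟨fun z ↦ if hz : z ∈ HP L then F ⟨z, hz⟩ else 0, by simp⟩
  have hcont : ContinuousOn Ψ (HP L) := by
    rw [continuousOn_iff_continuous_domRestrict]
    convert! map_continuous F
    ext z
    exact hΨ z
  have hev : ∀ s ∈ HP L, P.eval (Ψ s) = Complex.exp (P.natDegree * s) := by
    intro s hs
    have := congrFun hF ⟨s, hs⟩
    simp only [Function.comp_apply] at this
    rw [hΨ ⟨s, hs⟩, this]; rfl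
  refine ⟨Ψ, fun s hs => ?_, by rw [hΨ ⟨s0, hs0⟩, hF0], hev⟩
  refine (lift_diff (P := P) (E := fun s => Complex.exp (P.natDegree * s))
    (hcont.continuousAt ((HP_open L).mem_nhds hs)) ?_ (by fun_prop)
    (lift_ne hN hc hs (hev s hs))).differentiableWithinAt
  filter_upwards [(HP_open L).mem_nhds hs] with y hy using hev y hy

lemma lift_unique {P : ℂ[X]} {L : ℝ} (hN : 0 < P.natDegree)
    (hc : ∀ x, P.derivative.eval x = 0 → ‖P.eval x‖ ≤ Real.exp (P.natDegree * L))
    {F G : ℂ → ℂ} (hF : DifferentiableOn ℂ F (HP L)) (hG : DifferentiableOn ℂ G (HP L))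
    (hFe : ∀ s ∈ HP L, P.eval (F s) = Complex.exp (P.natDegree * s))
    (hGe : ∀ s ∈ HP L, P.eval (G s) = Complex.exp (P.natDegree * s))
    {s0 : ℂ} (hs0 : s0 ∈ HP L) (h0 : F s0 = G s0) : Set.EqOn F G (HP L) := by
  have h1 := (HP_open L).mem_nhds hs0
  refine (hF.analyticOnNhd (HP_open L)).eqOn_of_preconnected_of_eventuallyEq
    (hG.analyticOnNhd (HP_open L)) (HP_convex L).isPreconnected hs0
    (lift_unique_loc (P := P) (hF.differentiableAt h1).continuousAt
      (hG.differentiableAt h1).continuousAt ?_ h0 (lift_ne hN hc hs0 (hFe _ hs0)))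
  filter_upwards [h1] with y hy
  rw [hFe y hy, hGe y hy]

lemma HP_neg_log {ζ : ℂ} {L : ℝ} (h0 : ζ ≠ 0) (h : ζ ∈ Metric.ball (0:ℂ) (Real.exp (-L))) :
    -Complex.log ζ ∈ HP L := by
  have : 0 < ‖ζ‖ := norm_pos_iff.2 h0
  rw [mem_ball_zero_iff] at h
  have h2 := (Real.log_lt_iff_lt_exp this).2 h
  simp only [HP, Set.mem_setOf_eq, Complex.neg_re, Complex.log_re]
  linarith

lemma exp_neg_mem {s : ℂ} {L : ℝ} (h : s ∈ HP L) :
    Complex.exp (-s) ∈ Metric.ball (0:ℂ) (Real.exp (-L)) := by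
  rw [mem_ball_zero_iff, Complex.norm_exp]
  simp only [HP, Set.mem_setOf_eq] at h
  apply Real.exp_lt_exp.2
  simp; exact h

theorem lemniscate {P : ℂ[X]} (hP : P.Monic) {L : ℝ} (hN : 0 < P.natDegree)
    (hc : ∀ x, P.derivative.eval x = 0 → ‖P.eval x‖ ≤ Real.exp (P.natDegree * L))
    (hP0 : ‖P.eval 0‖ ≤ Real.exp (P.natDegree * L)) :
    ∃ k : ℂ → ℂ, DifferentiableOn ℂ k (Metric.ball 0 (Real.exp (-L))) ∧
      Set.InjOn k (Metric.ball 0 (Real.exp (-L))) ∧ k 0 = 0 ∧ HasDerivAt k 1 0 ∧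
      ∀ ζ ∈ Metric.ball (0:ℂ) (Real.exp (-L)), ζ ≠ 0 →
        k ζ ≠ 0 ∧ ζ ^ P.natDegree * P.eval (1 / k ζ) = 1 := by
  classical
  obtain ⟨h, r, hr, hd, hi, h0, h1, hh⟩ := loc_h hP hN
  set N := P.natDegree with hNdef
  have hNc : (N:ℂ) ≠ 0 := by exact_mod_cast hN.ne'
  set L' := max L (-Real.log r) with hL'
  have hLL : L ≤ L' := le_max_left _ _
  have hHP : HP L' ⊆ HP L := fun s hs => lt_of_le_of_lt hLL hs
  have hexr : Real.exp (-L') ≤ r := by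
    rw [← Real.exp_log hr]
    apply Real.exp_le_exp.2
    have := le_max_right L (-Real.log r)
    linarith
  have hballr : Metric.ball (0:ℂ) (Real.exp (-L')) ⊆ Metric.ball 0 r := Metric.ball_subset_ball hexr
  have hex : ∀ s ∈ HP L', Complex.exp (-s) ∈ Metric.ball (0:ℂ) r := fun s hs =>
    hballr (exp_neg_mem hs)
  have hGe : ∀ s ∈ HP L', P.eval (1 / h (Complex.exp (-s))) = Complex.exp (N * s) := by
    intro s hs
    have := (hh _ (hex s hs) (Complex.exp_ne_zero _)).2
    rw [← Complex.exp_nat_mul] at this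
    rw [← mul_right_inj' (Complex.exp_ne_zero (N * -s)), this, ← Complex.exp_add]
    simp
  have hGd : DifferentiableOn ℂ (fun s => 1 / h (Complex.exp (-s))) (HP L') := by
    intro s hs
    have e1 := hd.differentiableAt (Metric.isOpen_ball.mem_nhds (hex s hs))
    have e2 : DifferentiableAt ℂ (fun s => h (Complex.exp (-s))) s :=
      e1.comp s (by fun_prop)
    have e3 : h (Complex.exp (-s)) ≠ 0 := (hh _ (hex s hs) (Complex.exp_ne_zero _)).1
    exact ((differentiableAt_const 1).div e2 e3).differentiableWithinAt
  set s0 : ℂ := ((L' + 1 : ℝ) : ℂ) with hs0def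
  have hs0 : s0 ∈ HP L' := by simp [HP, hs0def]
  obtain ⟨Ψ, hΨd, hΨ0, hΨe⟩ := lift_exists hN hc (hHP hs0) (hGe s0 hs0)
  have hc' : ∀ x, P.derivative.eval x = 0 → ‖P.eval x‖ ≤ Real.exp (P.natDegree * L') := by
    intro x hx
    refine (hc x hx).trans (Real.exp_le_exp.2 ?_)
    gcongr
  have hΨG : Set.EqOn Ψ (fun s => 1 / h (Complex.exp (-s))) (HP L') :=
    lift_unique hN hc' (hΨd.mono hHP) hGd (fun s hs => hΨe s (hHP hs)) hGe hs0 hΨ0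
  have hΨne : ∀ s ∈ HP L, Ψ s ≠ 0 := by
    intro s hs he
    have := hΨe s hs
    rw [he] at this
    rw [this] at hP0
    exact absurd (norm_exp_N _ hs hN) (not_lt.2 hP0)
  -- translations
  have htr : ∀ m : ℤ, ∀ s1 ∈ HP L, Ψ (s1 + 2 * Real.pi * Complex.I * m / N) = Ψ s1 →
      ∀ s ∈ HP L, Ψ (s + 2 * Real.pi * Complex.I * m / N) = Ψ s := by
    intro m s1 hs1 he
    have hmem : ∀ s ∈ HP L, s + 2 * Real.pi * Complex.I * m / N ∈ HP L := by
      intro s hs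
      have : (2 * Real.pi * Complex.I * m / N : ℂ).re = 0 := by
        have : (2 * Real.pi * Complex.I * m / N : ℂ) = ((2 * Real.pi * m / N : ℝ) : ℂ) * Complex.I := by
          push_cast; ring
        rw [this]; simp
      simp only [HP, Set.mem_setOf_eq, Complex.add_re, this, add_zero]
      exact hs
    refine lift_unique hN hc (F := fun s => Ψ (s + 2 * Real.pi * Complex.I * m / N)) ?_ hΨd ?_ hΨe hs1 he
    · exact hΨd.comp (by fun_prop) hmem
    · intro s hs
      rw [hΨe _ (hmem s hs), Complex.exp_eq_exp_iff_exists_int]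
      exact ⟨m, by rw [← hNdef]; field_simp⟩
  have hper : ∀ n : ℤ, ∀ s ∈ HP L, Ψ (s + 2 * Real.pi * Complex.I * n) = Ψ s := by
    intro n s hs
    have := htr (n * N) s0 (hHP hs0) (by
      have e : (2 * Real.pi * Complex.I * ((n * N : ℤ) : ℂ) / N : ℂ) = 2 * Real.pi * Complex.I * n := by
        push_cast; field_simp
      rw [e]
      have hm : s0 + 2 * Real.pi * Complex.I * n ∈ HP L' := by
        simp only [HP, Set.mem_setOf_eq] at hs0 ⊢
        simpa using hs0
      rw [hΨG hm, hΨG hs0]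
      simp only
      congr 2
      rw [Complex.exp_eq_exp_iff_exists_int]
      exact ⟨-n, by push_cast; ring⟩) s hs
    have e : (2 * Real.pi * Complex.I * ((n * N : ℤ) : ℂ) / N : ℂ) = 2 * Real.pi * Complex.I * n := by
      push_cast; field_simp
    rwa [e] at this
  obtain ⟨k, hk0, hk⟩ : ∃ k : ℂ → ℂ, k 0 = 0 ∧ ∀ ζ, ζ ≠ 0 → k ζ = 1 / Ψ (-Complex.log ζ) :=
    ⟨fun ζ => if ζ = 0 then 0 else 1 / Ψ (-Complex.log ζ), by simp, fun ζ h => by simp [h]⟩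
  have hkexp : ∀ s ∈ HP L, k (Complex.exp (-s)) = 1 / Ψ s := by
    intro s hs
    rw [hk _ (Complex.exp_ne_zero _)]
    congr 1
    have : Complex.exp (Complex.log (Complex.exp (-s))) = Complex.exp (-s) :=
      Complex.exp_log (Complex.exp_ne_zero _)
    obtain ⟨n, hn⟩ := Complex.exp_eq_exp_iff_exists_int.1 this
    rw [hn, ← hper (-n) s hs]
    congr 1; push_cast; ring
  have hkh : ∀ ζ ∈ Metric.ball (0:ℂ) (Real.exp (-L')), k ζ = h ζ := by
    intro ζ hζ
    by_cases hz : ζ = 0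
    · rw [hz, hk0, h0]
    · rw [hk ζ hz, hΨG (HP_neg_log hz hζ)]
      simp [Complex.exp_log hz]
  have hkh' : k =ᶠ[nhds 0] h := by
    filter_upwards [Metric.ball_mem_nhds (0:ℂ) (Real.exp_pos (-L'))] with ζ hζ using hkh ζ hζ
  refine ⟨k, ?_, ?_, hk0, h1.congr_of_eventuallyEq hkh', ?_⟩
  · intro ζ hζ
    by_cases hz : ζ = 0
    · rw [hz]; exact (h1.congr_of_eventuallyEq hkh').differentiableAt.differentiableWithinAt
    · set s1 := -Complex.log ζ with hs1
      have hs1m : s1 ∈ HP L := HP_neg_log hz hζ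
      have hbd : DifferentiableAt ℂ (fun y => s1 - Complex.log (y / ζ)) ζ := by
        refine (differentiableAt_const _).sub ?_
        exact (differentiableAt_id.div_const _).clog (by simp [hz])
      have hb1 : s1 - Complex.log (ζ / ζ) = s1 := by simp [hz]
      have hmem : ∀ᶠ y in nhds ζ, s1 - Complex.log (y / ζ) ∈ HP L := by
        apply hbd.continuousAt.tendsto.eventually_mem
        rw [hb1]; exact (HP_open L).mem_nhds hs1m
      have hΨat : DifferentiableAt ℂ Ψ (s1 - Complex.log (ζ / ζ)) := by
        rw [hb1]; exact hΨd.differentiableAt ((HP_open L).mem_nhds hs1m)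
      have hcomp : DifferentiableAt ℂ (fun y => Ψ (s1 - Complex.log (y / ζ))) ζ :=
        DifferentiableAt.comp (g := Ψ) ζ hΨat hbd
      have hd2 : DifferentiableAt ℂ (fun y => 1 / Ψ (s1 - Complex.log (y / ζ))) ζ :=
        (differentiableAt_const 1).div hcomp (by rw [hb1]; exact hΨne s1 hs1m)
      refine (hd2.congr_of_eventuallyEq ?_).differentiableWithinAt
      filter_upwards [hmem, eventually_ne_nhds hz] with y hy hy0
      rw [← hkexp _ hy]
      congr 1
      rw [neg_sub, Complex.exp_sub, Complex.exp_log (div_ne_zero hy0 hz), hs1, Complex.exp_neg,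
        Complex.exp_log hz]
      field_simp
  · intro ζ1 hζ1 ζ2 hζ2 he
    have hne : ∀ ζ ∈ Metric.ball (0:ℂ) (Real.exp (-L)), ζ ≠ 0 → k ζ ≠ 0 := by
      intro ζ hζ hz
      rw [hk ζ hz]
      exact one_div_ne_zero (hΨne _ (HP_neg_log hz hζ))
    by_cases hz1 : ζ1 = 0
    · by_contra hz2
      exact hne ζ2 hζ2 (fun h => hz2 (by rw [hz1, h])) (by rw [← he, hz1, hk0])
    by_cases hz2 : ζ2 = 0
    · exact absurd (by rw [he, hz2, hk0]) (hne ζ1 hζ1 hz1)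
    set s1 := -Complex.log ζ1 with hs1
    set s2 := -Complex.log ζ2 with hs2
    have m1 : s1 ∈ HP L := HP_neg_log hz1 hζ1
    have m2 : s2 ∈ HP L := HP_neg_log hz2 hζ2
    rw [hk _ hz1, hk _ hz2, ← hs1, ← hs2, one_div, one_div, inv_inj] at he
    have e1 : Complex.exp (N * s1) = Complex.exp (N * s2) := by
      rw [hNdef, ← hΨe _ m1, ← hΨe _ m2, he]
    obtain ⟨m, hm⟩ := Complex.exp_eq_exp_iff_exists_int.1 e1
    have hm' : s1 = s2 + 2 * Real.pi * Complex.I * m / N := by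
      field_simp
      linear_combination hm
    have e2 := htr m s2 m2 (by rw [← hm', he]) s0 (hHP hs0)
    have hm0 : s0 + 2 * Real.pi * Complex.I * m / N ∈ HP L' := by
      have : (2 * Real.pi * Complex.I * m / N : ℂ).re = 0 := by
        have : (2 * Real.pi * Complex.I * m / N : ℂ) = ((2 * Real.pi * m / N : ℝ) : ℂ) * Complex.I := by
          push_cast; ring
        rw [this]; simp
      simp only [HP, Set.mem_setOf_eq, Complex.add_re, this, add_zero]
      exact hs0
    rw [hΨG hm0, hΨG hs0] at e2
    simp only [one_div, inv_inj] at e2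
    have e3 := hi (hex _ hm0) (hex _ hs0) e2
    have e4 : Complex.exp (-s1) = Complex.exp (-s2) := by
      rw [hm', neg_add, Complex.exp_add]
      rw [neg_add, Complex.exp_add] at e3
      have : Complex.exp (-(2 * Real.pi * Complex.I * m / N)) = 1 :=
        mul_left_cancel₀ (Complex.exp_ne_zero (-s0)) (by rw [e3, mul_one])
      rw [this, mul_one]
    rw [hs1, hs2, neg_neg, neg_neg, Complex.exp_log hz1, Complex.exp_log hz2] at e4
    exact e4
  · intro ζ hζ hz
    have hm := HP_neg_log hz hζ
    rw [hk ζ hz]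
    refine ⟨one_div_ne_zero (hΨne _ hm), ?_⟩
    rw [one_div_one_div, hΨe _ hm, mul_neg, Complex.exp_neg, Complex.exp_nat_mul, Complex.exp_log hz]
    exact mul_inv_cancel₀ (pow_ne_zero _ hz)
end DB
end

section
open Polynomial
namespace DB

lemma cf_pow_mul {G : ℂ → ℂ} (hG : AnalyticAt ℂ G 0) (n m : ℕ) :
    cf (n + m) (fun z => z ^ n * G z) = cf m G := by
  induction n with
  | zero => simp
  | succ n ih =>
    have h : AnalyticAt ℂ (fun z => z ^ n * G z) 0 := (analyticAt_id.pow n).mul hG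
    have := cf_id_mul (F := fun z => z ^ n * G z) h (n + m)
    rw [← ih, ← this, show n + 1 + m = n + m + 1 by ring]
    congr 1; ext z; ring

lemma cf_pow_mul_lt {G : ℂ → ℂ} (hG : AnalyticAt ℂ G 0) (n : ℕ) :
    cf n (fun z => z ^ (n + 1) * G z) = 0 := by
  have h : AnalyticAt ℂ (fun z => z * G z) 0 := analyticAt_id.mul hG
  have := cf_pow_mul h n 0
  rw [add_zero, cf_zero] at this
  rw [zero_mul] at this
  rw [← this]
  congr 1; ext z; ring

lemma residue_zero {F H : ℂ → ℂ} (hF : AnalyticAt ℂ F 0) (m : ℕ)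
    (hH : ∀ᶠ ζ in nhdsWithin (0:ℂ) {0}ᶜ, HasDerivAt H (F ζ / ζ ^ (m + 1)) ζ) : cf m F = 0 := by
  rw [eventually_nhdsWithin_iff] at hH
  obtain ⟨r, hr, hb⟩ := Metric.eventually_nhds_iff_ball.1 (hH.and hF.eventually_analyticAt)
  have hr2 : 0 < r / 2 := by linarith
  have hcb : Metric.closedBall (0:ℂ) (r/2) ⊆ Metric.ball 0 r :=
    Metric.closedBall_subset_ball (by linarith)
  have h1 : DifferentiableOn ℂ F (Metric.closedBall 0 (r/2)) := fun z hz =>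
    (hb z (hcb hz)).2.differentiableAt.differentiableWithinAt
  have h2 := h1.circleIntegral_one_div_sub_center_pow_smul hr2 m
  have h3 : ∮ z in C(0, r/2), (1 / (z - 0) ^ (m + 1)) • F z = 0 := by
    apply circleIntegral.integral_eq_zero_of_hasDerivWithinAt (f := H) hr2.le
    intro z hz
    have hz0 : z ≠ 0 := by
      intro h; rw [h] at hz; simp at hz; linarith
    have := (hb z (hcb (Metric.sphere_subset_closedBall hz))).1 hz0
    refine (this.congr_deriv ?_).hasDerivWithinAt
    simp; ring
  rw [h3] at h2
  have hne : (2 * (Real.pi:ℂ) * Complex.I / (m.factorial : ℂ)) ≠ 0 := by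
    have := Nat.factorial_ne_zero m
    simp [Real.pi_ne_zero, this]
  have := (smul_eq_zero.1 h2.symm).resolve_left hne
  rw [cf, this, zero_div]

lemma an_dslope {F : ℂ → ℂ} (hF : AnalyticAt ℂ F 0) : AnalyticAt ℂ (dslope F 0) 0 := by
  obtain ⟨r, hr, hb⟩ := Metric.eventually_nhds_iff_ball.1 hF.eventually_analyticAt
  refine an_of_diff hr ((Complex.differentiableOn_dslope (Metric.ball_mem_nhds _ hr)).2 ?_)
  exact fun z hz => (hb z hz).differentiableAt.differentiableWithinAt

lemma dslope_eq (F : ℂ → ℂ) (z : ℂ) : F z = F 0 + z * dslope F 0 z := by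
  have := sub_smul_dslope F 0 z
  rw [sub_zero, smul_eq_mul] at this
  rw [this]; ring

lemma exists_E {f R : ℂ[X]} (hf : f.Monic) (hR : R.Monic) (hN : 0 < R.natDegree)
    (hd : 0 < f.natDegree)
    {k : ℂ → ℂ} (hk : AnalyticAt ℂ k 0) (hk0 : k 0 = 0) (hk1 : HasDerivAt k 1 0)
    (hke : ∀ᶠ ζ in nhds (0:ℂ), ζ ≠ 0 → k ζ ≠ 0 ∧
      ζ ^ (f.natDegree * R.natDegree) * R.eval (f.eval (1 / k ζ)) = 1) :
    ∃ E : ℂ → ℂ, AnalyticAt ℂ E 0 ∧ ∀ᶠ ζ in nhds (0:ℂ), ζ ≠ 0 →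
      f.eval (1 / k ζ) = 1 / ζ ^ f.natDegree + E ζ := by
  obtain ⟨Q, hQ, hQ0, hQe⟩ := loc_Q hR hN
  set d := f.natDegree with hd'
  set N := R.natDegree with hN'
  set w := dslope k 0 with hw
  have hwa : AnalyticAt ℂ w 0 := an_dslope hk
  have hw0 : w 0 = 1 := by rw [hw, dslope_same, hk1.deriv]
  have hkw : ∀ z, k z = z * w z := fun z => by rw [dslope_eq k z, hk0, zero_add]
  have hrev0 : f.reverse.eval 0 = 1 := by
    rw [← coeff_zero_eq_eval_zero, coeff_zero_reverse]; exact hf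
  have hra : AnalyticAt ℂ (fun z => f.reverse.eval (k z)) 0 :=
    ((f.reverse.differentiable).analyticAt _).comp hk
  have hr0 : f.reverse.eval (k 0) = 1 := by rw [hk0, hrev0]
  have hr0' : f.reverse.eval (k 0) ≠ 0 := by rw [hr0]; exact one_ne_zero
  set v : ℂ → ℂ := fun z => w z ^ d / f.reverse.eval (k z) with hv
  have hva : AnalyticAt ℂ v 0 := (hwa.pow d).div hra hr0'
  have hv0 : v 0 = 1 := by simp [hv, hw0, hr0]
  set u : ℂ → ℂ := fun z => z ^ d * v z with hu
  have hua : AnalyticAt ℂ u 0 := (analyticAt_id.pow d).mul hva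
  have hu0 : u 0 = 0 := by simp [hu, hd.ne']
  have hQu : AnalyticAt ℂ (fun z => Q (u z)) 0 := by
    have : AnalyticAt ℂ Q (u 0) := by rw [hu0]; exact hQ
    exact this.comp hua
  -- basic punctured facts
  have hbase : ∀ᶠ ζ in nhds (0:ℂ), ζ ≠ 0 → v ζ ≠ 0 ∧ f.eval (1 / k ζ) = 1 / u ζ ∧
      ζ ^ (d * N) * R.eval (1 / u ζ) = 1 := by
    filter_upwards [hke, hra.continuousAt.eventually_ne hr0',
      hva.continuousAt.eventually_ne (by rw [hv0]; exact one_ne_zero)] with ζ h1 h2 h3 h0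
    obtain ⟨h4, h5⟩ := h1 h0
    have h6 := reverse_eval f h4
    have h7 : f.eval (1 / k ζ) = 1 / u ζ := by
      have : u ζ = k ζ ^ d / f.reverse.eval (k ζ) := by
        simp only [hu, hv]; rw [hkw ζ, mul_pow]; ring
      rw [this, one_div_div, h6, mul_div_cancel_left₀ _ (pow_ne_zero _ h4)]
    exact ⟨h3, h7, h7 ▸ h5⟩
  have hkey : (fun z => Q (u z) * v z) =ᶠ[nhds 0] fun _ => 1 := by
    have hNc : (N:ℂ) ≠ 0 := by exact_mod_cast hN.ne'
    refine lift_unique_loc (P := X ^ N) (hQu.mul hva).continuousAt continuousAt_const ?_ ?_ ?_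
    · have hQe' : ∀ᶠ z in nhds (0:ℂ), Q (u z) ^ N * R.reverse.eval (u z) = 1 := by
        have := hua.continuousAt.tendsto
        rw [hu0] at this
        exact this.eventually hQe
      filter_upwards [hQe', hbase] with z h1 h2
      by_cases hz : z = 0
      · rw [hz, hu0, hQ0, hv0]; simp
      · obtain ⟨h3, h4, h5⟩ := h2 hz
        have hune : u z ≠ 0 := mul_ne_zero (pow_ne_zero _ hz) h3
        rw [reverse_eval R hune] at h1
        simp only [eval_pow, eval_X, one_pow]
        have e : u z ^ N = z ^ (d * N) * v z ^ N := by simp only [hu]; rw [mul_pow, pow_mul]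
        rw [← hN', e] at h1
        rw [mul_pow]
        linear_combination h1 - Q (u z) ^ N * v z ^ N * h5
    · simp only [hu0, hQ0, hv0, mul_one]
    · simp only [hu0, hQ0, hv0, mul_one, derivative_X_pow]; simpa using hN.ne'
  set q := dslope Q 0 with hq
  refine ⟨fun z => v z * q (u z), ?_, ?_⟩
  · have : AnalyticAt ℂ q (u 0) := by rw [hu0]; exact an_dslope hQ
    exact hva.mul (this.comp hua)
  · filter_upwards [hbase, hkey] with z h1 h2 h0
    obtain ⟨h3, h4, h5⟩ := h1 h0
    have e1 := dslope_eq Q (u z)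
    rw [hQ0, ← hq] at e1
    have hzd : z ^ d ≠ 0 := pow_ne_zero _ h0
    have e2 : Q (u z) = 1 / v z := by field_simp; exact h2
    rw [h4, show u z = z ^ d * v z from rfl]
    rw [e2, show u z = z ^ d * v z from rfl] at e1
    change _ = 1 / z ^ d + v z * q (z ^ d * v z)
    generalize q (z ^ d * v z) = Y at *
    generalize v z = V at *
    field_simp
    field_simp at e1
    linear_combination e1

theorem coeff_formula {f : ℂ[X]} (hd : 1 < f.natDegree)
    {k : ℂ → ℂ} (hk : AnalyticAt ℂ k 0) (hk0 : k 0 = 0) (hk1 : HasDerivAt k 1 0)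
    {E : ℂ → ℂ} (hE : AnalyticAt ℂ E 0) (hEe : ∀ᶠ ζ in nhds (0:ℂ), ζ ≠ 0 →
      f.eval (1 / k ζ) = 1 / ζ ^ f.natDegree + E ζ) :
    f.derivative.eval 0 = f.natDegree * cf f.natDegree k := by
  obtain ⟨m, hm⟩ : ∃ m, f.natDegree = m + 1 := ⟨f.natDegree - 1, by omega⟩
  set w := dslope k 0 with hw
  have hwa : AnalyticAt ℂ w 0 := an_dslope hk
  have hw0 : w 0 = 1 := by rw [hw, dslope_same, hk1.deriv]
  have hkw : ∀ z, k z = z * w z := fun z => by rw [dslope_eq k z, hk0, zero_add]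
  have hka : AnalyticAt ℂ (deriv k) 0 := hk.deriv
  have hGa : AnalyticAt ℂ (fun z => f.coeff 1 * (deriv k z / w z)) 0 :=
    analyticAt_const.mul (hka.div hwa (by rw [hw0]; exact one_ne_zero))
  have hEa : AnalyticAt ℂ (fun z => E z * deriv k z) 0 := hE.mul hka
  have hA1 : AnalyticAt ℂ (fun z => z ^ (m+1) * (E z * deriv k z)) 0 := (analyticAt_id.pow _).mul hEa
  have hA2 : AnalyticAt ℂ (fun z => z ^ m * (f.coeff 1 * (deriv k z / w z))) 0 :=
    (analyticAt_id.pow _).mul hGa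
  have h12 : AnalyticAt ℂ (fun z => deriv k z + z ^ (m+1) * (E z * deriv k z)) 0 := hka.add hA1
  set F : ℂ → ℂ := fun z => deriv k z + z ^ (m+1) * (E z * deriv k z)
    - z ^ m * (f.coeff 1 * (deriv k z / w z)) with hF
  have hFa : AnalyticAt ℂ F 0 := h12.sub hA2
  set H : ℂ → ℂ := fun z => ∑ i ∈ Finset.range (f.natDegree + 1),
    if i = 1 then 0 else f.coeff i * (k z ^ (1 - (i:ℤ)) / (1 - (i:ℂ))) with hH
  have hres := residue_zero (F := F) (H := H) hFa m ?_
  · have c1 : cf m (fun z => deriv k z + z ^ (m+1) * (E z * deriv k z)) = (m+1) * cf (m+1) k := by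
      rw [cf_add hka hA1, cf_deriv, cf_pow_mul_lt hEa, add_zero]
    have c2 : cf m (fun z => z ^ m * (f.coeff 1 * (deriv k z / w z))) = f.coeff 1 := by
      have := cf_pow_mul hGa m 0
      rw [add_zero, cf_zero, hw0, hk1.deriv] at this
      rw [this]; ring
    have c3 : cf m F = (m+1) * cf (m+1) k - f.coeff 1 := by
      rw [← c1, ← c2, ← cf_sub h12 hA2]
    rw [c3] at hres
    have : f.derivative.eval 0 = f.coeff 1 := by
      rw [← coeff_zero_eq_eval_zero, coeff_derivative]; simp
    rw [this, hm]
    push_cast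
    linear_combination -hres
  · rw [eventually_nhdsWithin_iff]
    filter_upwards [hEe, hk.eventually_analyticAt,
      hwa.continuousAt.eventually_ne (by rw [hw0]; exact one_ne_zero)] with z h1 h2 h3 h0
    have h0' : z ≠ 0 := h0
    have e1 := h1 h0'
    have hkne : k z ≠ 0 := by rw [hkw]; exact mul_ne_zero h0' h3
    have hderiv : HasDerivAt H (∑ i ∈ Finset.range (f.natDegree + 1),
        if i = 1 then 0 else f.coeff i * (k z ^ (-(i:ℤ)) * deriv k z)) z := by
      simp only [hH]
      apply HasDerivAt.fun_sum
      intro i _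
      by_cases hi : i = 1
      · simp only [hi, if_true]; exact hasDerivAt_const _ _
      · simp only [hi, if_false]
        have hi' : (1 - (i:ℂ)) ≠ 0 := by
          intro h; apply hi; have : (i:ℂ) = 1 := by linear_combination -h
          exact_mod_cast this
        have g1 := (hasDerivAt_zpow (1 - (i:ℤ)) (k z) (Or.inl hkne)).comp z h2.differentiableAt.hasDerivAt
        have g2 := (g1.div_const (1 - (i:ℂ))).const_mul (f.coeff i)
        refine g2.congr_deriv ?_
        rw [show (1 - (i:ℤ) - 1) = -(i:ℤ) by ring]
        push_cast
        field_simp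
    refine hderiv.congr_deriv ?_
    have s1 : (∑ i ∈ Finset.range (f.natDegree + 1),
        if i = 1 then 0 else f.coeff i * (k z ^ (-(i:ℤ)) * deriv k z))
        = f.eval (1 / k z) * deriv k z - f.coeff 1 * (k z)⁻¹ * deriv k z := by
      rw [eval_eq_sum_range, Finset.sum_mul, eq_sub_iff_add_eq]
      rw [← Finset.sum_erase_add _ _ (show 1 ∈ Finset.range (f.natDegree + 1) by simp; omega)]
      conv_rhs => rw [← Finset.sum_erase_add _ _ (show 1 ∈ Finset.range (f.natDegree + 1) by simp; omega)]
      simp only [if_true, add_zero]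
      congr 1
      · apply Finset.sum_congr rfl
        intro i hi
        rw [if_neg (Finset.ne_of_mem_erase hi), zpow_neg, zpow_natCast, one_div, inv_pow]
        ring
      · simp
    rw [s1, e1, hF, hm, hkw z]
    simp only
    field_simp
    ring
end DB
end

section
open Polynomial
namespace DB

lemma DB_scaled {k : ℂ → ℂ} {L : ℝ} (hd : DifferentiableOn ℂ k (Metric.ball 0 (Real.exp (-L))))
    (hi : Set.InjOn k (Metric.ball 0 (Real.exp (-L)))) (h0 : k 0 = 0) (h1 : HasDerivAt k 1 0) (n : ℕ) :
    ‖cf (n + 1) k‖ ≤ (n + 1) * Real.exp (n * L) := by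
  set c : ℂ := ((Real.exp (-L) : ℝ) : ℂ) with hc
  have hcn : ‖c‖ = Real.exp (-L) := by rw [hc, Complex.norm_real, Real.norm_of_nonneg (Real.exp_pos _).le]
  have hc0 : c ≠ 0 := by rw [← norm_pos_iff, hcn]; exact Real.exp_pos _
  have hmaps : ∀ z ∈ Metric.ball (0:ℂ) 1, c * z ∈ Metric.ball (0:ℂ) (Real.exp (-L)) := by
    intro z hz
    rw [mem_ball_zero_iff] at hz ⊢
    rw [norm_mul, hcn]
    have := Real.exp_pos (-L)
    nlinarith
  have hka : AnalyticAt ℂ k 0 := an_of_diff (Real.exp_pos _) hd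
  have hka' : AnalyticAt ℂ (fun z => k (c * z)) 0 := by
    have : AnalyticAt ℂ k (c * 0) := by rw [mul_zero]; exact hka
    exact AnalyticAt.comp (g := k) this (analyticAt_const.mul analyticAt_id)
  have key := deBranges (h := fun z => c⁻¹ * k (c * z)) ?_ ?_ ?_ ?_ n
  · rw [cf_const_mul hka', cf_scale hka, norm_mul, norm_mul, norm_inv, norm_pow, hcn] at key
    have e : (Real.exp (-L))⁻¹ * (Real.exp (-L) ^ (n+1) * ‖cf (n+1) k‖) =
        Real.exp (-(n * L)) * ‖cf (n+1) k‖ := by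
      rw [pow_succ, ← Real.exp_nat_mul]
      have := Real.exp_pos (-L)
      field_simp
    rw [e, Real.exp_neg, inv_mul_le_iff₀ (Real.exp_pos _)] at key
    linarith
  · refine (DifferentiableOn.comp hd (by fun_prop) hmaps).const_mul _
  · intro x hx y hy hxy
    have := hi (hmaps x hx) (hmaps y hy) (mul_left_cancel₀ (inv_ne_zero hc0) hxy)
    exact mul_left_cancel₀ hc0 this
  · simp [h0]
  · have e1 : HasDerivAt k 1 (c * 0) := by rw [mul_zero]; exact h1
    have e2 : HasDerivAt (fun z : ℂ => c * z) (c * 1) 0 := (hasDerivAt_id (0:ℂ)).const_mul c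
    have e3 := (HasDerivAt.comp (h₂ := k) (0:ℂ) e1 e2).const_mul c⁻¹
    refine e3.congr_deriv ?_
    field_simp

theorem lem_step {f R : ℂ[X]} (hf : f.Monic) (hR : R.Monic) (hN : 0 < R.natDegree)
    (hd : 1 < f.natDegree) {L : ℝ}
    (hc : ∀ x, (R.comp f).derivative.eval x = 0 →
      ‖(R.comp f).eval x‖ ≤ Real.exp ((R.comp f).natDegree * L))
    (hP0 : ‖(R.comp f).eval 0‖ ≤ Real.exp ((R.comp f).natDegree * L)) :
    ∃ k : ℂ → ℂ, DifferentiableOn ℂ k (Metric.ball 0 (Real.exp (-L))) ∧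
      Set.InjOn k (Metric.ball 0 (Real.exp (-L))) ∧ k 0 = 0 ∧ HasDerivAt k 1 0 ∧
      f.derivative.eval 0 = f.natDegree * cf f.natDegree k ∧
      ∀ ζ ∈ Metric.ball (0:ℂ) (Real.exp (-L)), ζ ≠ 0 →
        k ζ ≠ 0 ∧ Real.exp ((R.comp f).natDegree * L) < ‖(R.comp f).eval (1 / k ζ)‖ := by
  have hdeg : (R.comp f).natDegree = R.natDegree * f.natDegree := natDegree_comp
  have hPm : (R.comp f).Monic := hR.comp hf (by omega)
  have hPN : 0 < (R.comp f).natDegree := by rw [hdeg]; exact Nat.mul_pos hN (by omega)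
  obtain ⟨k, k1, k2, k3, k4, k5⟩ := lemniscate hPm hPN hc hP0
  have hka : AnalyticAt ℂ k 0 := an_of_diff (Real.exp_pos _) k1
  obtain ⟨E, hE, hEe⟩ := exists_E hf hR hN (by omega) hka k3 k4 (by
    filter_upwards [Metric.ball_mem_nhds (0:ℂ) (Real.exp_pos (-L))] with ζ hζ h0
    obtain ⟨a, b⟩ := k5 ζ hζ h0
    refine ⟨a, ?_⟩
    rw [hdeg, eval_comp, mul_comm R.natDegree] at b
    exact b)
  refine ⟨k, k1, k2, k3, k4, coeff_formula hd hka k3 k4 hE hEe, fun ζ hζ h0 => ?_⟩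
  obtain ⟨a, b⟩ := k5 ζ hζ h0
  refine ⟨a, ?_⟩
  have hb := congrArg norm b
  rw [norm_mul, norm_pow, norm_one] at hb
  have hz : 0 < ‖ζ‖ := norm_pos_iff.2 h0
  rw [mem_ball_zero_iff] at hζ
  set M := (R.comp f).natDegree
  have h1 : ‖ζ‖ ^ M < Real.exp (-L) ^ M := pow_lt_pow_left₀ hζ hz.le hPN.ne'
  have h2 : Real.exp (-L) ^ M = (Real.exp (M * L))⁻¹ := by
    rw [← Real.exp_nat_mul, ← Real.exp_neg]; ring_nf
  rw [h2] at h1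
  have h3 : ‖(R.comp f).eval (1 / k ζ)‖ = (‖ζ‖ ^ M)⁻¹ := eq_inv_of_mul_eq_one_right hb
  rw [h3]
  exact (lt_inv_comm₀ (Real.exp_pos _) (pow_pos hz _)).2 h1

/-- log plus -/
noncomputable def lp (z : ℂ) : ℝ := Real.log (max 1 ‖z‖)

lemma lp_nonneg (z : ℂ) : 0 ≤ lp z := Real.log_nonneg (le_max_left _ _)

lemma norm_le_exp_lp (z : ℂ) : ‖z‖ ≤ Real.exp (lp z) := by
  rw [lp, Real.exp_log (by positivity)]; exact le_max_right _ _

lemma poly_bound (Q : ℂ[X]) {m : ℕ} (hm : Q.natDegree ≤ m) (z : ℂ) :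
    ‖Q.eval z‖ ≤ (∑ i ∈ Finset.range (m + 1), ‖Q.coeff i‖) * max 1 ‖z‖ ^ m := by
  rw [eval_eq_sum_range' (Nat.lt_succ_of_le hm), Finset.sum_mul]
  refine (norm_sum_le _ _).trans (Finset.sum_le_sum fun i hi => ?_)
  rw [norm_mul, norm_pow]
  have hi' : i ≤ m := Nat.lt_succ_iff.1 (Finset.mem_range.1 hi)
  have : ‖z‖ ^ i ≤ max 1 ‖z‖ ^ m :=
    (pow_le_pow_left₀ (norm_nonneg _) (le_max_right _ _) i).trans
      (pow_le_pow_right₀ (le_max_left _ _) hi')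
  gcongr

lemma lp_bound {f : ℂ[X]} (hf : f.Monic) (hd : 0 < f.natDegree) :
    ∃ C : ℝ, 0 ≤ C ∧ ∀ z, |lp (f.eval z) - f.natDegree * lp z| ≤ C := by
  obtain ⟨m, hm⟩ : ∃ m, f.natDegree = m + 1 := ⟨f.natDegree - 1, by omega⟩
  set S := ∑ i ∈ Finset.range (f.natDegree + 1), ‖f.coeff i‖ with hS
  set T := ∑ i ∈ Finset.range (m + 1), ‖f.eraseLead.coeff i‖ with hT
  have hS0 : 0 ≤ S := Finset.sum_nonneg fun _ _ => norm_nonneg _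
  have hT0 : 0 ≤ T := Finset.sum_nonneg fun _ _ => norm_nonneg _
  set K := 1 + S + 2 + (2 * T) ^ (m+1) with hK
  have hK1 : 1 ≤ K := by have : 0 ≤ (2 * T) ^ (m+1) := by positivity
                         linarith
  refine ⟨Real.log K, Real.log_nonneg hK1, fun z => ?_⟩
  set M := max 1 ‖z‖ with hM
  have hM1 : 1 ≤ M := le_max_left _ _
  have up : max 1 ‖f.eval z‖ ≤ K * M ^ (m+1) := by
    have h1 := poly_bound f le_rfl z
    rw [← hS, ← hM, hm] at h1
    have h2 : 1 ≤ M ^ (m+1) := one_le_pow₀ hM1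
    have h3 : 0 ≤ (2 * T) ^ (m+1) := by positivity
    apply max_le
    · nlinarith
    · nlinarith
  have low : M ^ (m+1) ≤ K * max 1 ‖f.eval z‖ := by
    have h3 : 0 ≤ (2 * T) ^ (m+1) := by positivity
    have hm1 : (1:ℝ) ≤ max 1 ‖f.eval z‖ := le_max_left _ _
    have hm2 : ‖f.eval z‖ ≤ max 1 ‖f.eval z‖ := le_max_right _ _
    rcases le_total ‖z‖ 1 with hz | hz
    · have : M = 1 := max_eq_left hz
      rw [this, one_pow]; nlinarith
    · have hMz : M = ‖z‖ := max_eq_right hz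
      rcases le_total M (2 * T) with h | h
      · have : M ^ (m+1) ≤ (2 * T) ^ (m+1) := pow_le_pow_left₀ (by linarith) h _
        nlinarith
      · have h1 := poly_bound f.eraseLead (m := m)
          ((eraseLead_natDegree_le f).trans (by omega)) z
        rw [← hT, ← hM] at h1
        have h2 : f.eval z = f.eraseLead.eval z + z ^ (m+1) := by
          conv_lhs => rw [← eraseLead_add_C_mul_X_pow f]
          rw [hf.leadingCoeff, hm]; simp
        have h4 : ‖z‖ ^ (m+1) ≤ ‖f.eval z‖ + T * M ^ m := by
          have : z ^ (m+1) = f.eval z - f.eraseLead.eval z := by rw [h2]; ring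
          rw [← norm_pow, this]
          exact (norm_sub_le _ _).trans (by linarith)
        rw [← hMz] at h4
        have h5 : 2 * (T * M ^ m) ≤ M ^ (m+1) := by
          rw [pow_succ]; have : 0 ≤ M ^ m := by positivity
          nlinarith
        nlinarith
  have hKp : 0 < K := by linarith
  have a1 : lp (f.eval z) ≤ Real.log K + f.natDegree * lp z := by
    have := Real.log_le_log (by positivity) up
    rw [Real.log_mul hKp.ne' (by positivity), Real.log_pow] at this
    rw [hm]; exact this
  have a2 : f.natDegree * lp z ≤ Real.log K + lp (f.eval z) := by
    have := Real.log_le_log (by positivity) low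
    rw [Real.log_mul hKp.ne' (by positivity), Real.log_pow] at this
    rw [hm]; exact this
  rw [abs_le]; constructor <;> linarith

/-- iterates as polynomials -/
noncomputable def itr (f : ℂ[X]) : ℕ → ℂ[X]
  | 0 => X
  | n + 1 => (itr f n).comp f

lemma itr_eval (f : ℂ[X]) (n : ℕ) (x : ℂ) : (itr f n).eval x = (fun w => f.eval w)^[n] x := by
  induction n generalizing x with
  | zero => simp [itr]
  | succ n ih => rw [itr, eval_comp, ih, Function.iterate_succ_apply]

lemma itr_natDegree (f : ℂ[X]) (n : ℕ) : (itr f n).natDegree = f.natDegree ^ n := by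
  induction n with
  | zero => simp [itr]
  | succ n ih => rw [itr, natDegree_comp, ih, pow_succ]

lemma itr_monic {f : ℂ[X]} (hf : f.Monic) (hd : 0 < f.natDegree) (n : ℕ) : (itr f n).Monic := by
  induction n with
  | zero => exact monic_X
  | succ n ih => exact ih.comp hf (by omega)

section dyn
variable {f : ℂ[X]} {g : ℂ → ℝ}

lemma g_nonneg (hg : ∀ z : ℂ, Filter.Tendsto
      (fun n : ℕ => lp ((fun w : ℂ => f.eval w)^[n] z) / (f.natDegree : ℝ) ^ n)
      Filter.atTop (nhds (g z))) (z : ℂ) : 0 ≤ g z :=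
  ge_of_tendsto' (hg z) fun n => div_nonneg (lp_nonneg _) (by positivity)

lemma g_f (hd : 0 < f.natDegree) (hg : ∀ z : ℂ, Filter.Tendsto
      (fun n : ℕ => lp ((fun w : ℂ => f.eval w)^[n] z) / (f.natDegree : ℝ) ^ n)
      Filter.atTop (nhds (g z))) (z : ℂ) : g (f.eval z) = f.natDegree * g z := by
  have h1 := hg (f.eval z)
  have h2 := ((Filter.tendsto_add_atTop_iff_nat 1).2 (hg z)).const_mul (f.natDegree : ℝ)
  refine tendsto_nhds_unique h1 (h2.congr fun n => ?_)
  have : (f.natDegree : ℝ) ≠ 0 := by exact_mod_cast hd.ne'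
  rw [Function.iterate_succ_apply]
  field_simp
  ring

lemma g_iter (hd : 0 < f.natDegree) (hg : ∀ z : ℂ, Filter.Tendsto
      (fun n : ℕ => lp ((fun w : ℂ => f.eval w)^[n] z) / (f.natDegree : ℝ) ^ n)
      Filter.atTop (nhds (g z))) (n : ℕ) (z : ℂ) :
    g ((itr f n).eval z) = f.natDegree ^ n * g z := by
  induction n generalizing z with
  | zero => simp [itr]
  | succ n ih => rw [itr, eval_comp, ih, g_f hd hg]; ring

lemma g_close (hd : 1 < f.natDegree) {C : ℝ} (hC0 : 0 ≤ C)
    (hC : ∀ z, |lp (f.eval z) - f.natDegree * lp z| ≤ C)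
    (hg : ∀ z : ℂ, Filter.Tendsto
      (fun n : ℕ => lp ((fun w : ℂ => f.eval w)^[n] z) / (f.natDegree : ℝ) ^ n)
      Filter.atTop (nhds (g z))) (z : ℂ) : |g z - lp z| ≤ C := by
  have hdp : (2:ℝ) ≤ f.natDegree := by exact_mod_cast hd
  have key : ∀ n : ℕ, |lp ((fun w : ℂ => f.eval w)^[n] z) / (f.natDegree : ℝ) ^ n - lp z| ≤
      C * (1 - 1 / (f.natDegree : ℝ) ^ n) := by
    intro n
    induction n with
    | zero => simp
    | succ n ih =>
      set y := (fun w : ℂ => f.eval w)^[n] z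
      rw [Function.iterate_succ_apply']
      set D : ℝ := (f.natDegree : ℝ)
      have hDn : 0 < D ^ n := by positivity
      have e : lp (f.eval y) / D ^ (n+1) - lp z =
          (lp (f.eval y) - D * lp y) / D ^ (n+1) + (lp y / D ^ n - lp z) := by
        rw [pow_succ]; field_simp; ring
      rw [e]
      refine (abs_add_le _ _).trans ?_
      rw [abs_div, abs_of_pos (show 0 < D ^ (n+1) by positivity)]
      have h1 : |lp (f.eval y) - D * lp y| / D ^ (n+1) ≤ C / D ^ (n+1) := by
        gcongr; exact hC y
      have h2 : 2 * (C / D ^ (n+1)) ≤ C / D ^ n := by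
        rw [pow_succ]
        have : C / (D ^ n * D) = C / D ^ n * (1 / D) := by field_simp
        rw [this]
        have h3 : 1 / D ≤ 1 / 2 := one_div_le_one_div_of_le (by norm_num) hdp
        have : 0 ≤ C / D ^ n := by positivity
        nlinarith
      have e2 : C * (1 - 1 / D ^ (n+1)) = C - C / D ^ (n+1) := by ring
      have e3 : C * (1 - 1 / D ^ n) = C - C / D ^ n := by ring
      rw [e2]; rw [e3] at ih
      linarith
  refine le_of_tendsto' ((hg z).sub_const (lp z)).abs fun n => (key n).trans ?_
  have : 0 ≤ 1 / (f.natDegree : ℝ) ^ n := by positivity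
  nlinarith

lemma crit_g (hd : 1 < f.natDegree)
    (hg : ∀ z : ℂ, Filter.Tendsto
      (fun n : ℕ => lp ((fun w : ℂ => f.eval w)^[n] z) / (f.natDegree : ℝ) ^ n)
      Filter.atTop (nhds (g z))) {G : ℝ} (hG : 0 ≤ G)
    (hz : ∀ c : ℂ, f.derivative.eval c = 0 → g c ≤ G) (n : ℕ) (x : ℂ)
    (hx : (itr f n).derivative.eval x = 0) : g x ≤ G := by
  induction n generalizing x with
  | zero => simp [itr] at hx
  | succ n ih =>
    rw [itr, derivative_comp, eval_mul, eval_comp] at hx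
    rcases mul_eq_zero.1 hx with h | h
    · exact hz x h
    · have h1 := ih _ h
      rw [g_f (by omega) hg] at h1
      have h2 := g_nonneg hg x
      have hdp : (1:ℝ) ≤ f.natDegree := by exact_mod_cast hd.le
      nlinarith

theorem dyn (hf : f.Monic) (hd : 1 < f.natDegree)
    (hg : ∀ z : ℂ, Filter.Tendsto
      (fun n : ℕ => lp ((fun w : ℂ => f.eval w)^[n] z) / (f.natDegree : ℝ) ^ n)
      Filter.atTop (nhds (g z)))
    (hz : ∀ c : ℂ, f.derivative.eval c = 0 → g c ≤ g 0) {C : ℝ} (hC0 : 0 ≤ C)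
    (hC : ∀ z, |lp (f.eval z) - f.natDegree * lp z| ≤ C) (n : ℕ) :
    ∃ k : ℂ → ℂ, DifferentiableOn ℂ k (Metric.ball 0 (Real.exp (-(g 0 + C / (f.natDegree:ℝ) ^ (n+1))))) ∧
      Set.InjOn k (Metric.ball 0 (Real.exp (-(g 0 + C / (f.natDegree:ℝ) ^ (n+1))))) ∧
      k 0 = 0 ∧ HasDerivAt k 1 0 ∧
      f.derivative.eval 0 = f.natDegree * cf f.natDegree k ∧
      ∀ ζ ∈ Metric.ball (0:ℂ) (Real.exp (-(g 0 + C / (f.natDegree:ℝ) ^ (n+1)))), ζ ≠ 0 →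
        k ζ ≠ 0 ∧ g 0 < g (1 / k ζ) := by
  have hd0 : 0 < f.natDegree := by omega
  have hdp : (0:ℝ) < f.natDegree := by exact_mod_cast hd0
  set L := g 0 + C / (f.natDegree:ℝ) ^ (n+1) with hL
  have hcomp : (itr f n).comp f = itr f (n+1) := rfl
  have hexp : Real.exp (((itr f n).comp f).natDegree * L) =
      Real.exp ((f.natDegree:ℝ) ^ (n+1) * g 0 + C) := by
    rw [hcomp, itr_natDegree, hL]
    push_cast
    congr 1
    field_simp
  have hbd : ∀ x, g x ≤ g 0 → ‖((itr f n).comp f).eval x‖ ≤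
      Real.exp (((itr f n).comp f).natDegree * L) := by
    intro x hx
    rw [hexp, hcomp]
    refine (norm_le_exp_lp _).trans (Real.exp_le_exp.2 ?_)
    have h1 := g_close hd hC0 hC hg ((itr f (n+1)).eval x)
    rw [g_iter hd0 hg, abs_le] at h1
    have h2 : (f.natDegree:ℝ) ^ (n+1) * g x ≤ (f.natDegree:ℝ) ^ (n+1) * g 0 := by gcongr
    linarith
  obtain ⟨k, k1, k2, k3, k4, k5, k6⟩ := lem_step hf (itr_monic hf hd0 n)
    (by rw [itr_natDegree]; positivity) hd (L := L)
    (fun x hx => hbd x (crit_g hd hg (g_nonneg hg 0) hz (n+1) x hx)) (hbd 0 le_rfl)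
  refine ⟨k, k1, k2, k3, k4, k5, fun ζ hζ h0 => ⟨(k6 ζ hζ h0).1, ?_⟩⟩
  by_contra hcon
  exact absurd (k6 ζ hζ h0).2 (not_lt.2 (hbd _ (not_lt.1 hcon)))

lemma lim_exp (hd : 1 < f.natDegree) (G C : ℝ) (m : ℝ) :
    Filter.Tendsto (fun n : ℕ => Real.exp (m * (G + C / (f.natDegree:ℝ) ^ (n+1)))) Filter.atTop
      (nhds (Real.exp (m * G))) := by
  have h1 : Filter.Tendsto (fun n : ℕ => C / (f.natDegree:ℝ) ^ (n+1)) Filter.atTop (nhds 0) := by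
    have h2 : Filter.Tendsto (fun n : ℕ => (f.natDegree:ℝ) ^ (n+1)) Filter.atTop Filter.atTop :=
      (Filter.tendsto_add_atTop_iff_nat 1).2
        (tendsto_pow_atTop_atTop_of_one_lt (by exact_mod_cast hd))
    exact h2.const_div_atTop C
  have h3 := ((h1.const_add G).const_mul m)
  rw [add_zero] at h3
  exact (Real.continuous_exp.tendsto _).comp h3

theorem main_weak (hf : f.Monic) (hd : 1 < f.natDegree)
    (hg : ∀ z : ℂ, Filter.Tendsto
      (fun n : ℕ => lp ((fun w : ℂ => f.eval w)^[n] z) / (f.natDegree : ℝ) ^ n)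
      Filter.atTop (nhds (g z)))
    (hz : ∀ c : ℂ, f.derivative.eval c = 0 → g c ≤ g 0) :
    ‖f.derivative.eval 0‖ ≤ (f.natDegree:ℝ) ^ 2 * Real.exp (((f.natDegree:ℝ) - 1) * g 0) := by
  obtain ⟨C, hC0, hC⟩ := lp_bound hf (by omega)
  refine ge_of_tendsto' ((lim_exp hd (g 0) C ((f.natDegree:ℝ) - 1)).const_mul _) fun n => ?_
  obtain ⟨k, k1, k2, k3, k4, k5, k6⟩ := dyn hf hd hg hz hC0 hC n
  obtain ⟨m, hm⟩ : ∃ m, f.natDegree = m + 1 := ⟨f.natDegree - 1, by omega⟩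
  have := DB_scaled k1 k2 k3 k4 m
  rw [k5, norm_mul, Complex.norm_natCast]
  rw [hm] at this ⊢
  push_cast at this ⊢
  rw [add_sub_cancel_right]
  have hmp : (0:ℝ) ≤ m + 1 := by positivity
  calc ((m:ℝ)+1) * ‖cf (m+1) k‖ ≤ (m+1) * _ := mul_le_mul_of_nonneg_left this hmp
    _ = _ := by ring
end dyn
end DB
end

section
open Polynomial
namespace DB

lemma iteratedDeriv_poly (p : ℂ[X]) (n : ℕ) :
    iteratedDeriv n (fun z => p.eval z) = fun z => (derivative^[n] p).eval z := by
  induction n generalizing p with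
  | zero => simp
  | succ n ih =>
    rw [iteratedDeriv_succ']
    have : deriv (fun z => p.eval z) = fun z => p.derivative.eval z := by ext z; exact p.deriv
    rw [this, ih, Function.iterate_succ_apply]

lemma monic_sup (q : ℂ[X]) (l : ℕ) (hq : q.natDegree ≤ l) (hl : q.coeff l = 1) (c : ℂ) {ρ : ℝ}
    (hρ : 0 < ρ) : ∃ x ∈ Metric.sphere c ρ, ρ ^ l / 2 ≤ ‖q.eval x‖ := by
  by_contra hcon
  push Not at hcon
  have h1 := Complex.norm_iteratedDeriv_le_of_forall_mem_sphere_norm_le (f := fun z => q.eval z)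
    (C := ρ ^ l / 2) (c := c) l hρ q.differentiable.diffContOnCl (fun z hz => (hcon z hz).le)
  have h2 : derivative^[l] q = C (l.factorial : ℂ) := by
    ext j
    rw [coeff_iterate_derivative, coeff_C]
    by_cases hj : j = 0
    · simp [hj, hl, Nat.descFactorial_self]
    · rw [if_neg hj, coeff_eq_zero_of_natDegree_lt (by omega), smul_zero]
  rw [iteratedDeriv_poly, h2] at h1
  simp only [eval_C, Complex.norm_natCast] at h1
  have h3 : (l.factorial : ℝ) * (ρ ^ l / 2) / ρ ^ l = l.factorial / 2 := by
    have : ρ ^ l ≠ 0 := by positivity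
    field_simp
  rw [h3] at h1
  have : (0:ℝ) < l.factorial := by exact_mod_cast l.factorial_pos
  linarith

lemma phase (a q : ℂ) : ∃ u : ℂ, ‖u‖ = 1 ∧ ∀ t : ℝ, 0 ≤ t → ‖a + t * u * q‖ = ‖a‖ + t * ‖q‖ := by
  by_cases ha : a = 0
  · exact ⟨1, by simp, fun t ht => by simp [ha, abs_of_nonneg ht]⟩
  by_cases hq : q = 0
  · exact ⟨1, by simp, fun t ht => by simp [hq]⟩
  have ha' : (‖a‖:ℂ) ≠ 0 := by simpa using ha
  have hq' : (‖q‖:ℂ) ≠ 0 := by simpa using hq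
  have ha'' : 0 < ‖a‖ := norm_pos_iff.2 ha
  have hq'' : 0 < ‖q‖ := norm_pos_iff.2 hq
  refine ⟨a / ‖a‖ * (‖q‖ / q), ?_, fun t ht => ?_⟩
  · simp [ha, hq]
  · have : a + t * (a / ‖a‖ * (‖q‖ / q)) * q = a * ((1 + t * ‖q‖ / ‖a‖ : ℝ) : ℂ) := by
      push_cast; field_simp
    rw [this, norm_mul, Complex.norm_real, Real.norm_of_nonneg (by positivity)]
    field_simp

/-- polynomial of the coefficient variation -/
noncomputable def vq (k : ℂ → ℂ) (l : ℕ) : ℂ[X] :=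
  ∑ j ∈ Finset.range (l + 1), C (cf (l + 2) (fun z => k z ^ (j + 2))) * X ^ j

lemma vq_natDegree (k : ℂ → ℂ) (l : ℕ) : (vq k l).natDegree ≤ l := by
  refine natDegree_sum_le_of_forall_le _ _ fun j hj => ?_
  exact (natDegree_C_mul_X_pow_le _ _).trans (Nat.lt_succ_iff.1 (Finset.mem_range.1 hj))

lemma vq_coeff {k : ℂ → ℂ} (hk : AnalyticAt ℂ k 0) (hk0 : k 0 = 0) (hk1 : HasDerivAt k 1 0) (l : ℕ) :
    (vq k l).coeff l = 1 := by
  have hwa : AnalyticAt ℂ (dslope k 0) 0 := an_dslope hk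
  have hw0 : dslope k 0 0 = 1 := by rw [dslope_same, hk1.deriv]
  have hkw : ∀ z, k z = z * dslope k 0 z := fun z => by
    have := dslope_eq k z; rwa [hk0, zero_add] at this
  rw [vq, finsetSum_coeff, Finset.sum_eq_single l]
  · simp only [coeff_C_mul, coeff_X_pow_self, mul_one]
    have h1 := cf_pow_mul (hwa.pow (l+2)) (l+2) 0
    rw [add_zero, cf_zero] at h1
    simp only [Pi.pow_apply, hw0, one_pow] at h1
    rw [← h1]
    congr 1; ext z
    rw [hkw z, mul_pow]
  · intro j hj hjl
    rw [coeff_C_mul, coeff_X_pow, if_neg (Ne.symm hjl), mul_zero]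
  · simp

lemma vq_formula {k : ℂ → ℂ} (hk : AnalyticAt ℂ k 0) (hk0 : k 0 = 0) (l : ℕ) (x : ℂ) :
    cf (l + 2) (fun z => k z ^ 2 / (1 - x * k z)) = (vq k l).eval x := by
  have hwa : AnalyticAt ℂ (dslope k 0) 0 := an_dslope hk
  have hkw : ∀ z, k z = z * dslope k 0 z := fun z => by
    have := dslope_eq k z; rwa [hk0, zero_add] at this
  have hden : AnalyticAt ℂ (fun z => 1 - x * k z) 0 := analyticAt_const.sub (analyticAt_const.mul hk)
  have hden0 : 1 - x * k 0 ≠ 0 := by simp [hk0]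
  have hpoly : ∀ n : ℕ, AnalyticAt ℂ (fun z => ∑ j ∈ Finset.range n, x ^ j * k z ^ (j+2)) 0 ∧
      cf (l + 2) (fun z => ∑ j ∈ Finset.range n, x ^ j * k z ^ (j+2)) =
        ∑ j ∈ Finset.range n, x ^ j * cf (l+2) (fun z => k z ^ (j+2)) := by
    intro n
    induction n with
    | zero =>
      simp only [Finset.range_zero, Finset.sum_empty]
      refine ⟨analyticAt_const, ?_⟩
      simp [cf, iteratedDeriv_const]
    | succ n ih =>
      have ha : AnalyticAt ℂ (fun z => k z ^ (n+2)) 0 := hk.pow _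
      have hb : AnalyticAt ℂ (fun z => x ^ n * k z ^ (n+2)) 0 := analyticAt_const.mul ha
      simp only [Finset.sum_range_succ]
      refine ⟨ih.1.add hb, ?_⟩
      rw [cf_add ih.1 hb, ih.2, cf_const_mul ha]
  have hrem : AnalyticAt ℂ (fun z => x ^ (l+1) * dslope k 0 z ^ (l+3) / (1 - x * k z)) 0 :=
    (analyticAt_const.mul (hwa.pow _)).div hden hden0
  have hrem' : AnalyticAt ℂ (fun z => z ^ (l+2+1) * (x ^ (l+1) * dslope k 0 z ^ (l+3) / (1 - x * k z))) 0 :=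
    (analyticAt_id.pow _).mul hrem
  have heq : (fun z => k z ^ 2 / (1 - x * k z)) =ᶠ[nhds 0]
      fun z => (∑ j ∈ Finset.range (l+1), x ^ j * k z ^ (j+2)) +
        z ^ (l+2+1) * (x ^ (l+1) * dslope k 0 z ^ (l+3) / (1 - x * k z)) := by
    filter_upwards [hden.continuousAt.eventually_ne hden0] with z hz
    have e1 : ∑ j ∈ Finset.range (l+1), x ^ j * k z ^ (j+2) =
        k z ^ 2 * ∑ j ∈ Finset.range (l+1), (x * k z) ^ j := by
      rw [Finset.mul_sum]; refine Finset.sum_congr rfl fun j _ => ?_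
      rw [mul_pow]; ring
    have e2 := mul_neg_geom_sum (x * k z) (l+1)
    have e3 : z ^ (l+2+1) * (x ^ (l+1) * dslope k 0 z ^ (l+3) / (1 - x * k z)) =
        k z ^ 2 * (x * k z) ^ (l+1) / (1 - x * k z) := by
      have : z ^ (l+3) * dslope k 0 z ^ (l+3) = k z ^ (l+3) := by rw [← mul_pow, ← hkw]
      rw [mul_pow, show l + 2 + 1 = l + 3 from rfl]
      field_simp
      linear_combination x ^ (l+1) * this
    rw [e1, e3]
    generalize ∑ j ∈ Finset.range (l+1), (x * k z) ^ j = S at *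
    rw [div_eq_iff hz, add_mul, div_mul_cancel₀ _ hz]
    linear_combination -(k z) ^ 2 * e2
  rw [cf_congr heq, cf_add (hpoly _).1 hrem', (hpoly _).2, cf_pow_mul_lt hrem, add_zero, vq,
    eval_finsetSum]
  refine Finset.sum_congr rfl fun j _ => ?_
  simp; ring

lemma variation {k : ℂ → ℂ} {L : ℝ} (hd : DifferentiableOn ℂ k (Metric.ball 0 (Real.exp (-L))))
    (hi : Set.InjOn k (Metric.ball 0 (Real.exp (-L)))) (h0 : k 0 = 0) (h1 : HasDerivAt k 1 0)
    {x : ℂ} {ρ : ℝ} (hρ : 0 < ρ)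
    (hom : ∀ ζ ∈ Metric.ball (0:ℂ) (Real.exp (-L)), ζ ≠ 0 → k ζ ≠ 0 ∧ ρ ≤ ‖1 / k ζ - x‖)
    {δ : ℂ} (hδ : ‖δ‖ * (2 / ρ + ‖x‖ / ρ ^ 2) < 1) (l : ℕ) :
    ‖cf (l + 2) k + δ * (vq k l).eval x‖ ≤ (l + 2) * Real.exp ((l + 1) * L) := by
  have hka : AnalyticAt ℂ k 0 := an_of_diff (Real.exp_pos _) hd
  set B := Metric.ball (0:ℂ) (Real.exp (-L)) with hB
  have hden : ∀ ζ ∈ B, 1 - x * k ζ ≠ 0 := by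
    intro ζ hζ h
    by_cases hz : ζ = 0
    · rw [hz, h0] at h; simp at h
    · obtain ⟨a, b⟩ := hom ζ hζ hz
      have : 1 / k ζ - x = 0 := by field_simp; linear_combination h
      rw [this, norm_zero] at b
      linarith
  have ha : ∀ ζ ∈ B, ‖k ζ / (1 - x * k ζ)‖ ≤ 1 / ρ := by
    intro ζ hζ
    by_cases hz : ζ = 0
    · rw [hz, h0]; simp; positivity
    · obtain ⟨a, b⟩ := hom ζ hζ hz
      have h2 := hden ζ hζ
      have : k ζ / (1 - x * k ζ) = 1 / (1 / k ζ - x) := by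
        have e : 1 / k ζ - x = (1 - x * k ζ) / k ζ := by field_simp
        rw [e, one_div_div]
      rw [this, norm_div, norm_one]
      exact one_div_le_one_div_of_le hρ b
  have hA : AnalyticAt ℂ (fun z => k z ^ 2 / (1 - x * k z)) 0 :=
    (hka.pow 2).div (analyticAt_const.sub (analyticAt_const.mul hka)) (by simp [h0])
  have hA' : AnalyticAt ℂ (fun z => δ * (k z ^ 2 / (1 - x * k z))) 0 := analyticAt_const.mul hA
  have key := DB_scaled (k := fun z => k z + δ * (k z ^ 2 / (1 - x * k z))) (L := L) ?_ ?_ ?_ ?_ (l+1)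
  · rw [show l + 1 + 1 = l + 2 from rfl, cf_add hka hA', cf_const_mul hA, vq_formula hka h0] at key
    refine key.trans (le_of_eq ?_)
    push_cast; ring
  · exact hd.add ((DifferentiableOn.div (hd.pow 2) ((differentiableOn_const 1).sub (hd.const_mul x)) hden).const_mul δ)
  · intro z hz y hy hzy
    simp only at hzy
    have d1 := hden z hz
    have d2 := hden y hy
    set a := k z / (1 - x * k z) with ha1
    set b := k y / (1 - x * k y) with hb1
    have e : (k z - k y) * (1 + δ * (a + b + x * a * b)) = 0 := by
      have e1 : (k z - k y) * (a + b + x * a * b) =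
          k z ^ 2 / (1 - x * k z) - k y ^ 2 / (1 - x * k y) := by
        have r1 : a * (1 - x * k z) = k z := div_mul_cancel₀ _ d1
        have r2 : b * (1 - x * k y) = k y := div_mul_cancel₀ _ d2
        have s1 : k z ^ 2 / (1 - x * k z) = k z * a := by rw [ha1]; ring
        have s2 : k y ^ 2 / (1 - x * k y) = k y * b := by rw [hb1]; ring
        rw [s1, s2]
        linear_combination a * r2 - b * r1
      linear_combination δ * e1 + hzy
    have hne : 1 + δ * (a + b + x * a * b) ≠ 0 := by
      intro h
      have n1 : ‖δ * (a + b + x * a * b)‖ = 1 := by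
        have : δ * (a + b + x * a * b) = -1 := by linear_combination h
        rw [this]; simp
      have na := ha z hz
      have nb := ha y hy
      have n2 : ‖a + b + x * a * b‖ ≤ 2 / ρ + ‖x‖ / ρ ^ 2 := by
        refine (norm_add₃_le (a := a) (b := b) (c := x * a * b)).trans ?_
        rw [norm_mul, norm_mul]
        have : ‖x‖ * ‖a‖ * ‖b‖ ≤ ‖x‖ * (1/ρ) * (1/ρ) := by gcongr
        have e : ‖x‖ * (1/ρ) * (1/ρ) = ‖x‖ / ρ ^ 2 := by field_simp
        have e' : 2 / ρ = 1/ρ + 1/ρ := by ring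
        linarith
      rw [norm_mul] at n1
      have := mul_le_mul_of_nonneg_left n2 (norm_nonneg δ)
      linarith
    have := (mul_eq_zero.1 e).resolve_right hne
    exact hi hz hy (sub_eq_zero.1 this)
  · simp [h0]
  · have hD := hA.differentiableAt.hasDerivAt
    have e1 : HasDerivAt (fun z => 1 - x * k z) (-(x * 1)) 0 := (h1.const_mul x).const_sub 1
    have e2 := (h1.pow 2).div e1 (by simp [h0])
    refine (h1.add (e2.const_mul δ)).congr_deriv ?_
    simp [h0]

section dyn
variable {f : ℂ[X]} {g : ℂ → ℝ}

lemma lp_continuous : Continuous lp := by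
  unfold lp
  refine Continuous.log (by fun_prop) fun z => ?_
  have : (1:ℝ) ≤ max 1 ‖z‖ := le_max_left _ _
  linarith

lemma exists_disc (hd : 1 < f.natDegree)
    (hg : ∀ z : ℂ, Filter.Tendsto
      (fun n : ℕ => lp ((fun w : ℂ => f.eval w)^[n] z) / (f.natDegree : ℝ) ^ n)
      Filter.atTop (nhds (g z))) {C : ℝ} (hC0 : 0 ≤ C)
    (hC : ∀ z, |lp (f.eval z) - f.natDegree * lp z| ≤ C) {G : ℝ} (hG : 0 < G) :
    ∃ (x₀ : ℂ) (ρ : ℝ), 0 < ρ ∧ ∀ x ∈ Metric.ball x₀ ρ, g x ≤ G := by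
  have hdp : (1:ℝ) < f.natDegree := by exact_mod_cast hd
  have hnd : (f - X).natDegree = f.natDegree :=
    natDegree_sub_eq_left_of_natDegree_lt (by rw [natDegree_X]; exact hd)
  obtain ⟨x₀, hx₀⟩ := Complex.exists_root (f := f - X)
    (natDegree_pos_iff_degree_pos.1 (by rw [hnd]; omega))
  have hfix : f.eval x₀ = x₀ := by
    rw [IsRoot.def, eval_sub, eval_X] at hx₀; exact sub_eq_zero.1 hx₀
  have hg0 : g x₀ = 0 := by
    have := g_f (by omega) hg x₀
    rw [hfix] at this
    have h2 : ((f.natDegree:ℝ) - 1) * g x₀ = 0 := by linarith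
    exact (mul_eq_zero.1 h2).resolve_left (by linarith)
  obtain ⟨n, hn⟩ := ((tendsto_pow_atTop_atTop_of_one_lt hdp).eventually_ge_atTop ((3 * C + 1) / G)).exists
  have hDn : (0:ℝ) < (f.natDegree:ℝ) ^ n := by positivity
  have hn' : 3 * C + 1 ≤ G * (f.natDegree:ℝ) ^ n := by
    rw [div_le_iff₀ hG] at hn; linarith
  have hcont : ContinuousAt (fun x => lp ((itr f n).eval x)) x₀ :=
    (lp_continuous.comp (itr f n).continuous).continuousAt
  have hlt : lp ((itr f n).eval x₀) < C + 1 := by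
    have := g_close hd hC0 hC hg ((itr f n).eval x₀)
    rw [g_iter (by omega) hg, hg0, abs_le] at this
    linarith
  obtain ⟨ρ, hρ, hb⟩ := Metric.eventually_nhds_iff_ball.1 (hcont.eventually_lt continuousAt_const hlt)
  refine ⟨x₀, ρ, hρ, fun x hx => ?_⟩
  have h1 := hb x hx
  have h2 := g_close hd hC0 hC hg ((itr f n).eval x)
  rw [g_iter (by omega) hg, abs_le] at h2
  have h3 : (f.natDegree:ℝ) ^ n * g x ≤ (f.natDegree:ℝ) ^ n * G := by linarith
  exact le_of_mul_le_mul_left h3 hDn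

lemma g_pos (hd : 1 < f.natDegree)
    (hg : ∀ z : ℂ, Filter.Tendsto
      (fun n : ℕ => lp ((fun w : ℂ => f.eval w)^[n] z) / (f.natDegree : ℝ) ^ n)
      Filter.atTop (nhds (g z))) {C : ℝ} (hC0 : 0 ≤ C)
    (hC : ∀ z, |lp (f.eval z) - f.natDegree * lp z| ≤ C) {c : ℂ}
    (hc : ¬ BddAbove (Set.range fun n : ℕ => ‖(fun w : ℂ => f.eval w)^[n] c‖)) : 0 < g c := by
  by_contra hcon
  have hz : g c = 0 := le_antisymm (not_lt.1 hcon) (g_nonneg hg c)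
  apply hc
  refine ⟨Real.exp C, ?_⟩
  rintro _ ⟨n, rfl⟩
  simp only
  rw [← itr_eval]
  refine (norm_le_exp_lp _).trans (Real.exp_le_exp.2 ?_)
  have h2 := g_close hd hC0 hC hg ((itr f n).eval c)
  rw [g_iter (by omega) hg, hz, abs_le] at h2
  linarith

theorem main_strict (hf : f.Monic) (hd : 1 < f.natDegree)
    (hg : ∀ z : ℂ, Filter.Tendsto
      (fun n : ℕ => lp ((fun w : ℂ => f.eval w)^[n] z) / (f.natDegree : ℝ) ^ n)
      Filter.atTop (nhds (g z)))
    (hz : ∀ c : ℂ, f.derivative.eval c = 0 → g c ≤ g 0)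
    (hc : ∃ c : ℂ, f.derivative.eval c = 0 ∧
      ¬ BddAbove (Set.range fun n : ℕ => ‖(fun w : ℂ => f.eval w)^[n] c‖)) :
    ‖f.derivative.eval 0‖ < (f.natDegree:ℝ) ^ 2 * Real.exp (((f.natDegree:ℝ) - 1) * g 0) := by
  obtain ⟨C, hC0, hC⟩ := lp_bound hf (by omega)
  obtain ⟨c, hc1, hc2⟩ := hc
  have hG : 0 < g 0 := (g_pos hd hg hC0 hC hc2).trans_le (hz c hc1)
  obtain ⟨x₀, ρ₀, hρ₀, hdisc⟩ := exists_disc hd hg hC0 hC hG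
  obtain ⟨l, hl⟩ : ∃ l, f.natDegree = l + 2 := ⟨f.natDegree - 2, by omega⟩
  set ρ := ρ₀ / 2 with hρ
  have hρ0 : 0 < ρ := by positivity
  set K := 2 / ρ + (‖x₀‖ + ρ) / ρ ^ 2 with hK
  have hK0 : 0 < K := by positivity
  set δ := 1 / (2 * K) with hδ
  have hδ0 : 0 < δ := by positivity
  have hδK : δ * K = 1 / 2 := by rw [hδ]; field_simp
  set η := δ * (ρ ^ l / 2) with hη
  have hη0 : 0 < η := by positivity
  have hstep : ‖f.derivative.eval 0‖ + (f.natDegree:ℝ) * η ≤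
      (f.natDegree:ℝ) ^ 2 * Real.exp (((f.natDegree:ℝ) - 1) * g 0) := by
    refine ge_of_tendsto' ((lim_exp hd (g 0) C ((f.natDegree:ℝ) - 1)).const_mul _) fun n => ?_
    obtain ⟨k, k1, k2, k3, k4, k5, k6⟩ := dyn hf hd hg hz hC0 hC n
    have hka : AnalyticAt ℂ k 0 := an_of_diff (Real.exp_pos _) k1
    obtain ⟨x, hx, hxq⟩ := monic_sup (vq k l) l (vq_natDegree k l) (vq_coeff hka k3 k4 l) x₀ hρ0
    obtain ⟨u, hu1, hu2⟩ := phase (cf (l+2) k) ((vq k l).eval x)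
    rw [mem_sphere_iff_norm] at hx
    have hxn : ‖x‖ ≤ ‖x₀‖ + ρ := by
      have := norm_add_le x₀ (x - x₀)
      rw [add_sub_cancel, hx] at this; exact this
    have hvar := variation k1 k2 k3 k4 (x := x) hρ0 (fun ζ hζ h0 => ⟨(k6 ζ hζ h0).1, by
      by_contra hcon
      push Not at hcon
      refine absurd (k6 ζ hζ h0).2 (not_lt.2 (hdisc _ ?_))
      rw [mem_ball_iff_norm]
      have := norm_add_le (1 / k ζ - x) (x - x₀)
      rw [sub_add_sub_cancel, hx] at this
      linarith⟩) (δ := δ * u) (by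
        rw [norm_mul, hu1, mul_one, Complex.norm_real, Real.norm_of_nonneg hδ0.le]
        have : 2 / ρ + ‖x‖ / ρ ^ 2 ≤ K := by rw [hK]; gcongr
        have := mul_le_mul_of_nonneg_left this hδ0.le
        linarith) l
    rw [hu2 δ hδ0.le] at hvar
    have h7 : η ≤ δ * ‖(vq k l).eval x‖ := mul_le_mul_of_nonneg_left hxq hδ0.le
    rw [k5, norm_mul, Complex.norm_natCast, ← mul_add]
    rw [hl] at hvar ⊢
    push_cast at hvar ⊢
    have hlp : (0:ℝ) ≤ l + 2 := by positivity
    rw [show (l:ℝ) + 2 - 1 = l + 1 by ring]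
    calc ((l:ℝ) + 2) * (‖cf (l+2) k‖ + η) ≤ (l + 2) * _ :=
          mul_le_mul_of_nonneg_left ((add_le_add_right h7 _).trans hvar) hlp
      _ = _ := by ring
  have : 0 < (f.natDegree:ℝ) * η := by
    have : (0:ℝ) < f.natDegree := by exact_mod_cast (by omega : 0 < f.natDegree)
    positivity
  linarith
end dyn
end DB
end

section
open Polynomial
namespace DB

lemma lp_affine (a b : ℂ) (w : ℂ) : lp (a * w + b) ≤ Real.log (1 + ‖a‖ + ‖b‖) + lp w := by
  unfold lp
  have h1 : (1:ℝ) ≤ max 1 ‖w‖ := le_max_left _ _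
  have h2 : ‖w‖ ≤ max 1 ‖w‖ := le_max_right _ _
  have h3 : (0:ℝ) < 1 + ‖a‖ + ‖b‖ := by positivity
  rw [← Real.log_mul h3.ne' (by linarith)]
  refine Real.log_le_log (lt_of_lt_of_le one_pos (le_max_left _ _)) (max_le ?_ ?_)
  · nlinarith [norm_nonneg a, norm_nonneg b]
  · refine (norm_add_le _ _).trans ?_
    rw [norm_mul]
    nlinarith [norm_nonneg a, norm_nonneg b, mul_le_mul_of_nonneg_left h2 (norm_nonneg a)]

lemma reduction (f : ℂ[X]) (hdeg : 1 < f.natDegree) (g : ℂ → ℝ)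
    (hg : ∀ z : ℂ, Filter.Tendsto
      (fun n : ℕ => lp ((fun w : ℂ => f.eval w)^[n] z) / (f.natDegree : ℝ) ^ n)
      Filter.atTop (nhds (g z)))
    (z₀ : ℂ) (hz₀ : ∀ c : ℂ, f.derivative.eval c = 0 → g c ≤ g z₀) :
    ‖f.derivative.eval z₀‖ ≤
        (f.natDegree : ℝ) ^ 2 * Real.exp (((f.natDegree : ℝ) - 1) * g z₀) ∧
    ((∃ c : ℂ, f.derivative.eval c = 0 ∧
        ¬ BddAbove (Set.range fun n : ℕ => ‖(fun w : ℂ => f.eval w)^[n] c‖)) →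
      ‖f.derivative.eval z₀‖ <
        (f.natDegree : ℝ) ^ 2 * Real.exp (((f.natDegree : ℝ) - 1) * g z₀)) := by
  have hlc : f.leadingCoeff ≠ 0 := by
    intro h; rw [leadingCoeff_eq_zero] at h; rw [h] at hdeg; simp at hdeg
  obtain ⟨s, hs⟩ := IsAlgClosed.exists_pow_nat_eq (f.leadingCoeff⁻¹) (n := f.natDegree - 1) (by omega)
  have hs0 : s ≠ 0 := by
    intro h
    rw [h, zero_pow (by omega)] at hs
    exact inv_ne_zero hlc hs.symm
  set A : ℂ[X] := C s * X + C z₀ with hA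
  have hAd : A.natDegree = 1 := natDegree_linear hs0
  have hAl : A.leadingCoeff = s := leadingCoeff_linear hs0
  have hcd : (f.comp A).natDegree = f.natDegree := by rw [natDegree_comp, hAd, mul_one]
  have hlt : (C z₀).natDegree < (f.comp A).natDegree := by rw [natDegree_C, hcd]; omega
  set F : ℂ[X] := C s⁻¹ * (f.comp A - C z₀) with hF
  have hFd : F.natDegree = f.natDegree := by
    rw [hF, natDegree_C_mul (inv_ne_zero hs0), natDegree_sub_eq_left_of_natDegree_lt hlt, hcd]
  have hFm : F.Monic := by
    rw [Monic, hF, leadingCoeff_mul, leadingCoeff_C,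
      leadingCoeff_sub_of_degree_lt (degree_lt_degree hlt),
      leadingCoeff_comp (by rw [hAd]; exact one_ne_zero), hAl]
    obtain ⟨m, hm⟩ : ∃ m, f.natDegree = m + 1 := ⟨f.natDegree - 1, by omega⟩
    rw [hm, Nat.add_sub_cancel] at hs
    rw [hm, pow_succ, hs]
    field_simp
  have hFe : ∀ y, F.eval y = s⁻¹ * (f.eval (s * y + z₀) - z₀) := fun y => by
    simp [hF, hA, eval_comp]
  have hF' : ∀ y, F.derivative.eval y = f.derivative.eval (s * y + z₀) := fun y => by
    simp [hF, hA, derivative_comp, eval_comp]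
    field_simp
  have hit : ∀ n y, s * ((fun w : ℂ => F.eval w)^[n] y) + z₀ = (fun w : ℂ => f.eval w)^[n] (s * y + z₀) := by
    intro n
    induction n with
    | zero => intro y; rfl
    | succ n ih =>
      intro y
      rw [Function.iterate_succ_apply, Function.iterate_succ_apply, ih, hFe]
      congr 1
      field_simp
      ring
  have hit' : ∀ n y, (fun w : ℂ => F.eval w)^[n] y =
      s⁻¹ * ((fun w : ℂ => f.eval w)^[n] (s * y + z₀)) + (-(s⁻¹ * z₀)) := by
    intro n y
    rw [← hit]; field_simp; ring
  have hdp : (1:ℝ) < f.natDegree := by exact_mod_cast hdeg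
  have hzero : ∀ M : ℝ, Filter.Tendsto (fun n : ℕ => M / (f.natDegree:ℝ) ^ n) Filter.atTop (nhds 0) :=
    fun M => (tendsto_pow_atTop_atTop_of_one_lt hdp).const_div_atTop M
  have hG : ∀ z : ℂ, Filter.Tendsto
      (fun n : ℕ => lp ((fun w : ℂ => F.eval w)^[n] z) / (F.natDegree : ℝ) ^ n)
      Filter.atTop (nhds (g (s * z + z₀))) := by
    intro z
    rw [hFd]
    have h1 := hg (s * z + z₀)
    have hlow := h1.sub (hzero (Real.log (1 + ‖s‖ + ‖z₀‖)))
    have hup := h1.add (hzero (Real.log (1 + ‖s⁻¹‖ + ‖-(s⁻¹ * z₀)‖)))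
    rw [sub_zero] at hlow
    rw [add_zero] at hup
    refine tendsto_of_tendsto_of_tendsto_of_le_of_le hlow hup (fun n => ?_) (fun n => ?_)
    · have := lp_affine s z₀ ((fun w : ℂ => F.eval w)^[n] z)
      rw [hit] at this
      simp only
      rw [← sub_div]
      gcongr
      linarith
    · have := lp_affine s⁻¹ (-(s⁻¹ * z₀)) ((fun w : ℂ => f.eval w)^[n] (s * z + z₀))
      rw [← hit'] at this
      simp only
      rw [← add_div]
      gcongr
      linarith
  have hZ : ∀ c : ℂ, F.derivative.eval c = 0 → g (s * c + z₀) ≤ g (s * 0 + z₀) := by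
    intro c hc
    rw [hF'] at hc
    rw [mul_zero, zero_add]
    exact hz₀ _ hc
  refine ⟨?_, ?_⟩
  · have := main_weak (g := fun y => g (s * y + z₀)) hFm (by rw [hFd]; exact hdeg) hG hZ
    rw [hF', hFd] at this
    simpa using this
  · rintro ⟨c, hc, hcb⟩
    have hcc : s * (s⁻¹ * (c - z₀)) + z₀ = c := by field_simp; ring
    have := main_strict (g := fun y => g (s * y + z₀)) hFm (by rw [hFd]; exact hdeg) hG hZ
      ⟨s⁻¹ * (c - z₀), by rw [hF', hcc]; exact hc, by
        rintro ⟨M, hM⟩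
        apply hcb
        refine ⟨‖s‖ * M + ‖z₀‖, ?_⟩
        rintro _ ⟨n, rfl⟩
        have h1 := hit n (s⁻¹ * (c - z₀))
        rw [hcc] at h1
        simp only
        rw [← h1]
        refine (norm_add_le _ _).trans ?_
        rw [norm_mul]
        have h2 := hM ⟨n, rfl⟩
        simp only at h2
        gcongr⟩
    rw [hF', hFd] at this
    simpa using this

end DB
end

theorem statement5 (f : Polynomial ℂ) (hdeg : 1 < f.natDegree) (g : ℂ → ℝ)
    (hg : ∀ z : ℂ, Filter.Tendsto
      (fun n : ℕ => Real.log (max 1 ‖(fun w : ℂ => f.eval w)^[n] z‖) / (f.natDegree : ℝ) ^ n)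
      Filter.atTop (nhds (g z)))
    (z₀ : ℂ) (hz₀ : ∀ c : ℂ, f.derivative.eval c = 0 → g c ≤ g z₀) :
    ‖f.derivative.eval z₀‖ ≤
        (f.natDegree : ℝ) ^ 2 * Real.exp (((f.natDegree : ℝ) - 1) * g z₀) ∧
    ((∃ c : ℂ, f.derivative.eval c = 0 ∧
        ¬ BddAbove (Set.range fun n : ℕ => ‖(fun w : ℂ => f.eval w)^[n] c‖)) →
      ‖f.derivative.eval z₀‖ <
        (f.natDegree : ℝ) ^ 2 * Real.exp (((f.natDegree : ℝ) - 1) * g z₀)) := by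
  exact DB.reduction f hdeg g hg z₀ hz₀
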